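/- If M is a countable transitive set such that (M,∈) satisfies all axioms of ZFC, then there exists a countable transitive set N with M ⊆ N, containing exactly the same ordinals as M (for every ordinal α, α ∈ M iff α ∈ N), such that (N,∈) satisfies ZFC together with the negation of the Continuum Hypothesis. -/

import Mathlib

namespace CtmForcing

open FirstOrder FirstOrder.Language

/-! ### The first-order language of set theory -/

/-- The relation symbols of the language of set theory: a single binary relation `∈`. -/
inductive memRel : ℕ → Type
  | mem : memRel 2

/-- The first-order language `L` of set theory, with a single binary relation symbol `∈`. -/
def SetLang : Language := ⟨fun _ => Empty, memRel⟩

/-- The membership relation symbol. -/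
abbrev memSymb : SetLang.Relations 2 := .mem

/-- `L`-formulas (with no free "unbounded" variables) whose free variables are among
`v₀, …, v_{n-1}`. -/
abbrev BF (n : ℕ) := SetLang.BoundedFormula Empty n

/-- The atomic formula `vᵢ ∈ vⱼ`. -/
def memf {n : ℕ} (i j : Fin n) : BF n :=
  memSymb.boundedFormula₂ (Term.var (Sum.inr i)) (Term.var (Sum.inr j))

/-- The atomic formula `vᵢ = vⱼ`. -/
def eqf {n : ℕ} (i j : Fin n) : BF n :=
  Term.bdEqual (Term.var (Sum.inr i)) (Term.var (Sum.inr j))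

/-- Rename the free variables of a formula along `f`. -/
def reindex {m k : ℕ} (f : Fin m → Fin k) (φ : BF m) : BF k :=
  (BoundedFormula.relabel (Sum.map id f) φ.toFormula : SetLang.BoundedFormula Empty (k + 0))

/-- Conjunction. -/
def andF {n : ℕ} (φ ψ : BF n) : BF n := (φ.imp ψ.not).not

/-- Disjunction. -/
def orF {n : ℕ} (φ ψ : BF n) : BF n := (φ.not).imp ψ

/-- Biimplication. -/
def iffF {n : ℕ} (φ ψ : BF n) : BF n := andF (φ.imp ψ) (ψ.imp φ)

/-! ### Basic set-theoretic formulas -/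

/-- `v₀ ⊆ v₁`. -/
def subF : BF 2 := ((memf 2 0).imp (memf 2 1)).all

/-- `v₀ = ∅`. -/
def emptyF : BF 1 := ((memf 1 0).not).all

/-- `v₂ = {v₀, v₁}`. -/
def pairSetF : BF 3 := (iffF (memf 3 2) (orF (eqf 3 0) (eqf 3 1))).all

/-- `v₁ = {v₀}`. -/
def singF : BF 2 := reindex ![0, 0, 1] pairSetF

/-- `v₂ = ⟨v₀, v₁⟩` (Kuratowski ordered pair). -/
def opF : BF 3 :=
  (iffF (memf 3 2) (orF (reindex ![0, 3] singF) (reindex ![0, 1, 3] pairSetF))).all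

/-- `v₁ = v₀ ∪ {v₀}`. -/
def succF : BF 2 := (iffF (memf 2 1) (orF (memf 2 0) (eqf 2 0))).all

/-- `v₀` is transitive. -/
def transF : BF 1 := ((memf 1 0).imp (reindex ![1, 0] subF)).all

/-- `v₀` is an ordinal (a transitive set of transitive sets). -/
def ordF : BF 1 := andF transF (((memf 1 0).imp (reindex ![1] transF)).all)

/-- `⟨v₀, v₁⟩ ∈ v₂`. -/
def relMemF : BF 3 := (andF (reindex ![0, 1, 3] opF) (memf 3 2)).ex

/-- `v₂` is a function with domain `v₀` mapping onto `v₁` (a surjection from `v₀` onto `v₁`). -/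
def isFuncF : BF 3 :=
  andF
    (andF
      -- v₂ ⊆ v₀ × v₁
      (((memf 3 2).imp
        (((andF (andF (memf 4 0) (memf 5 1)) (reindex ![4, 5, 3] opF)).ex).ex)).all)
      -- total on v₀
      (((memf 3 0).imp ((andF (memf 4 1) (reindex ![3, 4, 2] relMemF)).ex)).all))
    (andF
      -- functional
      ((((andF (reindex ![3, 4, 2] relMemF) (reindex ![3, 5, 2] relMemF)).imp
          (eqf 4 5)).all).all.all)
      -- onto v₁
      (((memf 3 1).imp ((andF (memf 4 0) (reindex ![4, 3, 2] relMemF)).ex)).all))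

/-- `v₂` is injective (as a set of ordered pairs). -/
def injF : BF 3 :=
  ((((andF (reindex ![3, 5, 2] relMemF) (reindex ![4, 5, 2] relMemF)).imp
      (eqf 3 4)).all).all).all

/-- `v₂` is a bijection from `v₀` onto `v₁`. -/
def bijF : BF 3 := andF isFuncF injF

/-! ### The axioms of set theory as `L`-sentences -/

/-- Extensionality. -/
def extAx : SetLang.Sentence :=
  ((((andF subF (reindex ![1, 0] subF)).imp (eqf 0 1)).all).all : BF 0)

/-- Foundation. -/
def foundAx : SetLang.Sentence :=
  (((((memf 1 0).ex).imp
    ((andF (memf 1 0) (((memf 2 0).imp ((memf 2 1).not)).all)).ex)).all) : BF 0)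

/-- Pairing. -/
def pairAx : SetLang.Sentence := (((pairSetF.ex).all).all : BF 0)

/-- Union. -/
def unionAx : SetLang.Sentence :=
  (((((iffF (memf 2 1) ((andF (memf 3 0) (memf 2 3)).ex)).all).ex).all : BF 0))

/-- Powerset. -/
def powF : BF 2 := (iffF (memf 2 1) (reindex ![2, 0] subF)).all

/-- Powerset axiom. -/
def powAx : SetLang.Sentence := (((powF.ex).all) : BF 0)

/-- Infinity. -/
def infAx : SetLang.Sentence :=
  (((andF ((andF (memf 1 0) (reindex ![1] emptyF)).ex)
    (((memf 1 0).imp ((andF (memf 2 0) (reindex ![1, 2] succF)).ex)).all)).ex) : BF 0)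

/-- The instance of the Separation scheme given by `φ`, whose free variables are among
`v₀, …, vₙ`: the parameters are `v₀, …, v_{n-1}` and the tested element is `vₙ`.  It is the
universal closure of `∀A ∃B ∀x (x ∈ B ↔ x ∈ A ∧ φ(params, x))`. -/
def sepAx {n : ℕ} (φ : BF (n + 1)) : SetLang.Sentence :=
  -- context `n+3`: parameters `0,…,n-1`, `A = n`, `B = n+1`, `x = n+2`
  let A : Fin (n + 3) := ⟨n, by omega⟩
  let B : Fin (n + 3) := ⟨n + 1, by omega⟩
  let x : Fin (n + 3) := ⟨n + 2, by omega⟩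
  let φ' : BF (n + 3) := reindex (fun i => if h : (i : ℕ) < n then ⟨i, by omega⟩ else x) φ
  ((((iffF (memf x B) (andF (memf x A) φ')).all).ex).all).alls

/-- The instance of the Replacement scheme given by `φ`, whose free variables are among
`v₀, …, v_{n+1}`: the parameters are `v₀, …, v_{n-1}`, the argument is `x = vₙ`, and the
value is `y = v_{n+1}`.  It is the universal closure of
`∀A [(∀x∈A ∀y ∀y' (φ(x,y) ∧ φ(x,y') → y = y')) → ∃B ∀y (y ∈ B ↔ ∃x∈A φ(x,y))]`. -/
def replAx {n : ℕ} (φ : BF (n + 2)) : SetLang.Sentence :=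
  -- functionality context `n+4`: parameters, `A = n`, `x = n+1`, `y = n+2`, `y' = n+3`
  let A : Fin (n + 4) := ⟨n, by omega⟩
  let x : Fin (n + 4) := ⟨n + 1, by omega⟩
  let y : Fin (n + 4) := ⟨n + 2, by omega⟩
  let y' : Fin (n + 4) := ⟨n + 3, by omega⟩
  let φ₁ : BF (n + 4) :=
    reindex (fun i => if h : (i : ℕ) < n then ⟨i, by omega⟩ else if (i : ℕ) = n then x else y) φ
  let φ₂ : BF (n + 4) :=
    reindex (fun i => if h : (i : ℕ) < n then ⟨i, by omega⟩ else if (i : ℕ) = n then x else y') φ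
  let funcl : BF (n + 1) :=
    ((((andF (memf x A) (andF φ₁ φ₂)).imp (eqf y y')).all).all).all
  -- image context `n+4`: parameters, `A = n`, `B = n+1`, `y = n+2`, `x = n+3`
  let xi : Fin (n + 4) := ⟨n + 3, by omega⟩
  let yi : Fin (n + 4) := ⟨n + 2, by omega⟩
  let B3 : Fin (n + 3) := ⟨n + 1, by omega⟩
  let y3 : Fin (n + 3) := ⟨n + 2, by omega⟩
  let φ₃ : BF (n + 4) :=
    reindex (fun i => if h : (i : ℕ) < n then ⟨i, by omega⟩ else if (i : ℕ) = n then xi else yi) φ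
  let image : BF (n + 1) :=
    (((iffF (memf y3 B3) ((andF (memf xi A) φ₃).ex)).all).ex)
  ((funcl.imp image).all).alls

/-- The Axiom of Choice: every set is the surjective image of an ordinal. -/
def acAx : SetLang.Sentence :=
  ((((andF (reindex ![1] ordF) (reindex ![1, 0, 2] isFuncF)).ex).ex).all : BF 0)

/-- `v₀ = ω`: `v₀` is an ordinal containing `∅`, closed under successors, each of whose
elements is `∅` or a successor. -/
def omegaF : BF 1 :=
  andF (andF ordF ((andF (memf 1 0) (reindex ![1] emptyF)).ex))
    (andF (((memf 1 0).imp ((andF (memf 2 0) (reindex ![1, 2] succF)).ex)).all)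
      (((memf 1 0).imp
        (orF (reindex ![1] emptyF) ((andF (memf 2 1) (reindex ![2, 1] succF)).ex))).all))

/-- Given `v₀ = ω`, `v₁ = ℵ₁`: `v₁` is an ordinal, there is no surjection from `ω` onto `v₁`,
and every element of `v₁` is empty or a surjective image of `ω`. -/
def alephOneF : BF 2 :=
  andF (andF (reindex ![1] ordF) (((reindex ![0, 1, 2] isFuncF).ex).not))
    (((memf 2 1).imp (orF (reindex ![2] emptyF) ((reindex ![0, 2, 3] isFuncF).ex))).all)

/-- The Continuum Hypothesis `ℵ₁ = 2^ℵ₀`: there is a bijection between `𝒫(ω)` and `ℵ₁`. -/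
def chSent : SetLang.Sentence :=
  (((((andF (andF (reindex ![0] omegaF) (reindex ![0, 1] powF))
      (andF (reindex ![0, 2] alephOneF) (reindex ![1, 2, 3] bijF))).ex).ex).ex).ex : BF 0)

/-! ### The theories `Z`, `ZF`, `ZC`, `ZFC` -/

/-- The finitely many non-scheme axioms of `ZF`. -/
def zfFin : SetLang.Theory := {extAx, foundAx, pairAx, unionAx, powAx, infAx}

/-- All instances of the Separation scheme. -/
def sepScheme : SetLang.Theory := Set.range fun p : Σ n, BF (n + 1) => sepAx p.2

/-- All instances of the Replacement scheme. -/
def replScheme : SetLang.Theory := Set.range fun p : Σ n, BF (n + 2) => replAx p.2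

/-- Zermelo set theory. -/
def Z : SetLang.Theory := zfFin ∪ sepScheme

/-- Zermelo–Fraenkel set theory. -/
def ZF : SetLang.Theory := Z ∪ replScheme

/-- Zermelo set theory with Choice. -/
def ZC : SetLang.Theory := Z ∪ {acAx}

/-- Zermelo–Fraenkel set theory with Choice. -/
def ZFC : SetLang.Theory := ZF ∪ {acAx}

/-! ### Satisfaction in a set with the true membership relation -/

/-- The `L`-structure on (the elements of) a `ZFSet` `M`, with `∈` interpreted as true
membership. -/
def zfStruct (M : ZFSet) : SetLang.Structure {x : ZFSet // x ∈ M} where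
  funMap := fun f _ => f.elim
  RelMap | .mem => fun v => ((v 0 : {x : ZFSet // x ∈ M}) : ZFSet) ∈ ((v 1 : {x : ZFSet // x ∈ M}) : ZFSet)

/-- `(M, ∈) ⊨ T`: the structure on `M` with true membership satisfies every sentence of `T`. -/
def ZModels (M : ZFSet) (T : SetLang.Theory) : Prop :=
  ∀ φ ∈ T, letI := zfStruct M; Sentence.Realize (M := {x : ZFSet // x ∈ M}) φ

/-- `(M, ∈) ⊨ φ[v₀, …, v_{k-1}]`: satisfaction of the formula `φ` in `M`, with the
(membership-checked) valuation `v` of its free variables. -/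
def ZRealize (M : ZFSet) {k : ℕ} (φ : BF k) (v : Fin k → ZFSet) : Prop :=
  ∀ h : ∀ i, v i ∈ M,
    letI := zfStruct M
    BoundedFormula.Realize (M := {x : ZFSet // x ∈ M}) φ (fun e => e.elim) (fun i => ⟨v i, h i⟩)

/-- `x` is a (von Neumann) ordinal: a transitive set of transitive sets. -/
def IsOrd (x : ZFSet) : Prop := x.IsTransitive ∧ ∀ y ∈ x, ZFSet.IsTransitive y


/-! ### Part 1: realization lemmas -/

abbrev Vs (N : ZFSet) := {x : ZFSet // x ∈ N}

/-- Realization in the structure `(N,∈)`. -/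
def Rl {N : ZFSet} {n : ℕ} (φ : BF n) (v : Fin n → Vs N) : Prop :=
  let _ := zfStruct N; φ.Realize (fun e => e.elim) v

section
variable {N : ZFSet} {n : ℕ}

@[simp] lemma Rl_memf (i j : Fin n) (v : Fin n → Vs N) :
    Rl (memf i j) v ↔ (v i).1 ∈ (v j).1 := by
  let _ := zfStruct N
  unfold Rl memf
  exact BoundedFormula.realize_rel₂

@[simp] lemma Rl_eqf (i j : Fin n) (v : Fin n → Vs N) :
    Rl (eqf i j) v ↔ (v i).1 = (v j).1 := by
  let _ := zfStruct N
  unfold Rl eqf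
  exact (BoundedFormula.realize_bdEqual _ _).trans Subtype.ext_iff

@[simp] lemma Rl_imp (φ ψ : BF n) (v : Fin n → Vs N) :
    Rl (φ.imp ψ) v ↔ (Rl φ v → Rl ψ v) := by
  let _ := zfStruct N
  exact BoundedFormula.realize_imp

@[simp] lemma Rl_not (φ : BF n) (v : Fin n → Vs N) :
    Rl (φ.not) v ↔ ¬ Rl φ v := by
  let _ := zfStruct N
  exact BoundedFormula.realize_not

@[simp] lemma Rl_and (φ ψ : BF n) (v : Fin n → Vs N) :
    Rl (andF φ ψ) v ↔ (Rl φ v ∧ Rl ψ v) := by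
  unfold andF; simp

@[simp] lemma Rl_or (φ ψ : BF n) (v : Fin n → Vs N) :
    Rl (orF φ ψ) v ↔ (Rl φ v ∨ Rl ψ v) := by
  unfold orF; simp; tauto

@[simp] lemma Rl_iff (φ ψ : BF n) (v : Fin n → Vs N) :
    Rl (iffF φ ψ) v ↔ (Rl φ v ↔ Rl ψ v) := by
  unfold iffF; simp; tauto

@[simp] lemma Rl_all (φ : BF (n+1)) (v : Fin n → Vs N) :
    Rl φ.all v ↔ ∀ x, Rl φ (Fin.snoc v x : Fin (n+1) → Vs N) := by
  let _ := zfStruct N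
  exact BoundedFormula.realize_all

@[simp] lemma Rl_ex (φ : BF (n+1)) (v : Fin n → Vs N) :
    Rl φ.ex v ↔ ∃ x, Rl φ (Fin.snoc v x : Fin (n+1) → Vs N) := by
  let _ := zfStruct N
  exact BoundedFormula.realize_ex

@[simp] lemma Rl_reindex {m : ℕ} (f : Fin m → Fin n) (φ : BF m) (v : Fin n → Vs N) :
    Rl (reindex f φ) v ↔ Rl φ (fun i => v (f i)) := by
  let _ := zfStruct N
  unfold Rl reindex
  erw [BoundedFormula.realize_relabel]
  have := BoundedFormula.realize_toFormula φ (Sum.elim (fun e : Empty => (e.elim : Vs N)) (v ∘ f))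
  unfold Formula.Realize at this
  refine Iff.trans (iff_of_eq ?_) (this.trans (iff_of_eq ?_))
  · congr 1
    · funext x; rcases x with x | x
      · exact x.elim
      · simp
    · funext x; exact x.elim0
  · congr 1

lemma Rl_alls (φ : BF n) :
    (letI := zfStruct N; Sentence.Realize (M := Vs N) φ.alls) ↔ ∀ v : Fin n → Vs N, Rl φ v := by
  let _ := zfStruct N
  unfold Sentence.Realize
  rw [show (∀ v : Fin n → Vs N, Rl φ v) ↔
    ∀ v : Fin n → Vs N, φ.Realize (default : Empty → Vs N) v by
      unfold Rl; rw [Subsingleton.elim (default : Empty → Vs N) (fun e => e.elim)] ]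
  exact BoundedFormula.realize_alls

lemma Rl_sent (φ : BF 0) :
    (letI := zfStruct N; Sentence.Realize (M := Vs N) φ) ↔ Rl (N := N) φ Fin.elim0 := by
  let _ := zfStruct N
  unfold Sentence.Realize Formula.Realize Rl
  rw [Subsingleton.elim (default : Empty → Vs N) (fun e => e.elim),
    Subsingleton.elim (default : Fin 0 → Vs N)]

/-- every formula can be turned into a `BF`. -/
lemma exists_BF {α : Type*} (φ : SetLang.Formula α) :
    ∃ (m : ℕ) (f : Fin m → α) (ψ : BF m), ∀ v : α → Vs N,
      (letI := zfStruct N; φ.Realize v) ↔ Rl ψ (fun i => v (f i)) := by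
  classical
  let _ := zfStruct N
  let s := φ.freeVarFinset
  let e := Fintype.equivFin s
  refine ⟨_, fun i => (e.symm i).1,
    (BoundedFormula.relabel (fun x => Sum.inr (e x)) (φ.restrictFreeVar id) : BF (_ + 0)), ?_⟩
  intro v
  unfold Rl
  have := BoundedFormula.realize_restrictFreeVar (φ := φ) (f := (id : s → s)) (v := fun a => v a)
    (v' := v) (xs := (default : Fin 0 → Vs N)) (by simp)
  unfold Formula.Realize
  rw [← this]
  erw [BoundedFormula.realize_relabel]
  apply iff_of_eq
  congr 1
  · funext x; simp
  · funext x; exact x.elim0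

end

/-! ### Part 2: definable relations over a set -/

/-- Definability, with parameters, over `(M,∈)`. -/
def Dfb (M : ZFSet) (R : (ℕ → ZFSet) → Prop) : Prop :=
  ∃ φ : SetLang.Formula (ℕ ⊕ Vs M), ∀ v : ℕ → Vs M,
    R (fun i => (v i).1) ↔ (letI := zfStruct M; φ.Realize (Sum.elim v id))

/-- definable functions -/
def Dfn (M : ZFSet) (F : (ℕ → ZFSet) → ZFSet) : Prop :=
  (∀ v : ℕ → ZFSet, (∀ i, v i ∈ M) → F v ∈ M) ∧ Dfb M (fun v => v 0 = F (fun i => v (i+1)))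

section
variable {M : ZFSet} {R S : (ℕ → ZFSet) → Prop}

lemma Dfb.congr (h : Dfb M R) (H : ∀ v : ℕ → ZFSet, (∀ i, v i ∈ M) → (S v ↔ R v)) : Dfb M S := by
  obtain ⟨φ, hφ⟩ := h
  exact ⟨φ, fun v => (H _ (fun i => (v i).2)).trans (hφ v)⟩

lemma Dfb.vmem (i j : ℕ) : Dfb M (fun v => v i ∈ v j) := by
  let _ := zfStruct M
  exact ⟨memSymb.formula₂ (Term.var (Sum.inl i)) (Term.var (Sum.inl j)),
    fun v => by rw [Formula.realize_rel₂]; exact Iff.rfl⟩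

lemma Dfb.veq (i j : ℕ) : Dfb M (fun v => v i = v j) := by
  let _ := zfStruct M
  refine ⟨Term.equal (Term.var (Sum.inl i)) (Term.var (Sum.inl j)), fun v => ?_⟩
  rw [Formula.realize_equal]
  exact Subtype.ext_iff.symm

lemma Dfb.ceq (i : ℕ) {c : ZFSet} (hc : c ∈ M) : Dfb M (fun v => v i = c) := by
  let _ := zfStruct M
  refine ⟨Term.equal (Term.var (Sum.inl i)) (Term.var (Sum.inr ⟨c, hc⟩)), fun v => ?_⟩
  rw [Formula.realize_equal]
  exact (Subtype.ext_iff (a1 := v i) (a2 := ⟨c, hc⟩)).symm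

lemma Dfb.imp (h : Dfb M R) (h' : Dfb M S) : Dfb M (fun v => R v → S v) := by
  let _ := zfStruct M
  obtain ⟨φ, hφ⟩ := h
  obtain ⟨ψ, hψ⟩ := h'
  refine ⟨φ.imp ψ, fun v => ?_⟩
  rw [Formula.realize_imp]
  exact imp_congr (hφ v) (hψ v)

lemma Dfb.false : Dfb M (fun _ => False) := by
  let _ := zfStruct M
  exact ⟨⊥, fun v => by rw [Formula.realize_bot]⟩

lemma Dfb.not (h : Dfb M R) : Dfb M (fun v => ¬ R v) := Dfb.imp h Dfb.false
lemma Dfb.true : Dfb M (fun _ => True) := (Dfb.not .false).congr (by simp)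
lemma Dfb.and (h : Dfb M R) (h' : Dfb M S) : Dfb M (fun v => R v ∧ S v) :=
  (Dfb.not (Dfb.imp h (Dfb.not h'))).congr (by simp)
lemma Dfb.or (h : Dfb M R) (h' : Dfb M S) : Dfb M (fun v => R v ∨ S v) :=
  (Dfb.imp (Dfb.not h) h').congr (by intros; tauto)
lemma Dfb.iff (h : Dfb M R) (h' : Dfb M S) : Dfb M (fun v => R v ↔ S v) :=
  (Dfb.and (Dfb.imp h h') (Dfb.imp h' h)).congr (by intros; tauto)

/-- Closed under arbitrary renaming of variables. -/
lemma Dfb.rename (h : Dfb M R) (f : ℕ → ℕ) : Dfb M (fun v => R (fun i => v (f i))) := by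
  let _ := zfStruct M
  obtain ⟨φ, hφ⟩ := h
  refine ⟨φ.relabel (Sum.map f id), fun v => ?_⟩
  rw [Formula.realize_relabel]
  refine (hφ (fun i => v (f i))).trans (iff_of_eq ?_)
  congr 1
  funext x; rcases x with x | x <;> rfl

lemma Dfb.allM {R : (ℕ → ZFSet) → ZFSet → Prop} (h : Dfb M (fun v => R (fun i => v (i+1)) (v 0))) :
    Dfb M (fun v => ∀ x, x ∈ M → R v x) := by
  let _ := zfStruct M
  obtain ⟨φ, hφ⟩ := h
  let g : ℕ ⊕ Vs M → (ℕ ⊕ Vs M) ⊕ Fin 1 := fun x => match x with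
    | .inl 0 => .inr 0
    | .inl (i+1) => .inl (.inl i)
    | .inr c => .inl (.inr c)
  refine ⟨(BoundedFormula.relabel g φ : SetLang.BoundedFormula _ (1 + 0)).all, fun v => ?_⟩
  unfold Formula.Realize
  erw [BoundedFormula.realize_all]
  refine Subtype.forall'.trans (forall_congr' fun a => ?_)
  erw [BoundedFormula.realize_relabel]
  have := hφ (fun i => match i with | 0 => a | i+1 => v i)
  refine this.trans (iff_of_eq ?_)
  unfold Formula.Realize
  congr 1
  · funext x
    rcases x with (_|x) | x <;> rfl
  · funext x; exact x.elim0

lemma Dfb.exM {R : (ℕ → ZFSet) → ZFSet → Prop} (h : Dfb M (fun v => R (fun i => v (i+1)) (v 0))) :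
    Dfb M (fun v => ∃ x, x ∈ M ∧ R v x) :=
  (Dfb.not (Dfb.allM (R := fun v x => ¬ R v x) (Dfb.not h))).congr (by simp)

/-- Substituting a definable function. -/
lemma Dfb.subst {R : (ℕ → ZFSet) → ZFSet → Prop} {F : (ℕ → ZFSet) → ZFSet}
    (h : Dfb M (fun v => R (fun i => v (i+1)) (v 0))) (hF : Dfn M F) :
    Dfb M (fun v => R v (F v)) := by
  refine (Dfb.exM (R := fun v x => x = F v ∧ R v x) (Dfb.and hF.2 h)).congr fun v hv => ?_
  exact ⟨fun h => ⟨_, hF.1 v hv, rfl, h⟩, by rintro ⟨x, _, rfl, h⟩; exact h⟩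

lemma Dfn.var (i : ℕ) : Dfn M (fun v => v i) := ⟨fun _ h => h i, Dfb.veq 0 (i+1)⟩
lemma Dfn.const {c : ZFSet} (hc : c ∈ M) : Dfn M (fun _ => c) := ⟨fun _ _ => hc, Dfb.ceq 0 hc⟩

variable {F G H : (ℕ → ZFSet) → ZFSet}

lemma Dfn.rename (h : Dfn M F) (f : ℕ → ℕ) : Dfn M (fun v => F (fun i => v (f i))) := by
  refine ⟨fun v hv => h.1 _ fun i => hv _, ?_⟩
  exact (h.2.rename (fun i => match i with | 0 => 0 | i+1 => f i + 1))

lemma Dfn.shift (h : Dfn M F) : Dfn M (fun v => F (fun i => v (i+1))) := h.rename _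

/-- Unary and binary and ternary substitution. -/
lemma Dfb.app1 {R : ZFSet → Prop} (h : Dfb M (fun v => R (v 0))) (hF : Dfn M F) :
    Dfb M (fun v => R (F v)) := Dfb.subst (R := fun _ x => R x) h hF

lemma Dfb.app2 {R : ZFSet → ZFSet → Prop} (h : Dfb M (fun v => R (v 0) (v 1))) (hF : Dfn M F)
    (hG : Dfn M G) : Dfb M (fun v => R (F v) (G v)) := by
  refine Dfb.subst (R := fun v x => R x (G v)) ?_ hF
  refine Dfb.subst (R := fun v x => R (v 0) x) ?_ hG.shift
  exact h.rename (fun i => match i with | 0 => 1 | _ => 0)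

lemma Dfb.app3 {R : ZFSet → ZFSet → ZFSet → Prop} (h : Dfb M (fun v => R (v 0) (v 1) (v 2)))
    (hF : Dfn M F) (hG : Dfn M G) (hH : Dfn M H) : Dfb M (fun v => R (F v) (G v) (H v)) := by
  refine Dfb.subst (R := fun v x => R x (G v) (H v)) ?_ hF
  refine Dfb.subst (R := fun v x => R (v 0) x (H _)) ?_ hG.shift
  refine Dfb.subst (R := fun v x => R (v 1) (v 0) x) ?_ hH.shift.shift
  exact h.rename (fun i => match i with | 0 => 2 | 1 => 1 | _ => 0)

lemma Dfb.mem (hF : Dfn M F) (hG : Dfn M G) : Dfb M (fun v => F v ∈ G v) :=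
  Dfb.app2 (R := fun x y => x ∈ y) (Dfb.vmem 0 1) hF hG
lemma Dfb.eq (hF : Dfn M F) (hG : Dfn M G) : Dfb M (fun v => F v = G v) :=
  Dfb.app2 (R := fun x y => x = y) (Dfb.veq 0 1) hF hG

lemma Dfn.app1 {f : ZFSet → ZFSet} (h : Dfn M (fun v => f (v 0))) (hF : Dfn M F) :
    Dfn M (fun v => f (F v)) := by
  refine ⟨fun v hv => h.1 (fun _ => F v) (fun _ => hF.1 v hv), ?_⟩
  exact Dfb.app2 (R := fun x y => x = f y) (h.2.rename id) (Dfn.var 0) hF.shift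

lemma Dfn.app2 {f : ZFSet → ZFSet → ZFSet} (h : Dfn M (fun v => f (v 0) (v 1))) (hF : Dfn M F)
    (hG : Dfn M G) : Dfn M (fun v => f (F v) (G v)) := by
  refine ⟨fun v hv => h.1 (fun i => match i with | 0 => F v | _ => G v) (fun i => ?_), ?_⟩
  · rcases i with _ | i
    exacts [hF.1 v hv, hG.1 v hv]
  · exact Dfb.app3 (R := fun x y z => x = f y z) (h.2.rename id) (Dfn.var 0) hF.shift hG.shift

/-- Instantiate the variables with elements of `M`. -/
lemma Dfb.inst1 {R : ZFSet → ZFSet → Prop} (h : Dfb M (fun v => R (v 0) (v 1))) {c : ZFSet}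
    (hc : c ∈ M) : Dfb M (fun v => R (v 0) c) := Dfb.app2 h (.var 0) (.const hc)

section trans
variable (hM : M.IsTransitive)
include hM

lemma Dfb.ball {R : (ℕ → ZFSet) → ZFSet → Prop} (hF : Dfn M F)
    (h : Dfb M (fun v => R (fun i => v (i+1)) (v 0))) :
    Dfb M (fun v => ∀ x, x ∈ F v → R v x) := by
  refine (Dfb.allM (R := fun v x => x ∈ F v → R v x)
    (Dfb.imp (Dfb.mem (Dfn.var 0) hF.shift) h)).congr fun v hv => ?_
  exact ⟨fun h x _ hx => h x hx, fun h x hx => h x (hM _ (hF.1 v hv) hx) hx⟩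

lemma Dfb.bex {R : (ℕ → ZFSet) → ZFSet → Prop} (hF : Dfn M F)
    (h : Dfb M (fun v => R (fun i => v (i+1)) (v 0))) :
    Dfb M (fun v => ∃ x, x ∈ F v ∧ R v x) := by
  refine (Dfb.exM (R := fun v x => x ∈ F v ∧ R v x)
    (Dfb.and (Dfb.mem (Dfn.var 0) hF.shift) h)).congr fun v hv => ?_
  exact ⟨fun ⟨x, hx, h⟩ => ⟨x, hM _ (hF.1 v hv) hx, hx, h⟩, fun ⟨x, _, hx, h⟩ => ⟨x, hx, h⟩⟩

lemma Dfb.sub (hF : Dfn M F) (hG : Dfn M G) : Dfb M (fun v => F v ⊆ G v) :=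
  Dfb.ball hM hF (R := fun v x => x ∈ G v) (Dfb.mem (Dfn.var 0) hG.shift)

lemma Dfn.of_mem (h1 : ∀ v : ℕ → ZFSet, (∀ i, v i ∈ M) → F v ∈ M)
    (h : Dfb M (fun v => v 0 ∈ F (fun i => v (i+1)))) : Dfn M F := by
  refine ⟨h1, ?_⟩
  refine (Dfb.allM (R := fun v x => x ∈ v 0 ↔ x ∈ F (fun i => v (i+1)))
    (Dfb.iff (Dfb.vmem 0 1) (h.rename (fun i => match i with | 0 => 0 | i+1 => i+2)))).congr
    fun v hv => ?_
  constructor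
  · intro h x _; rw [h]
  · intro h'; ext x
    by_cases hx : x ∈ M
    · exact h' x hx
    · exact ⟨fun h => (hx (hM _ (hv 0) h)).elim,
        fun h => (hx (hM _ (h1 _ (fun i => hv (i+1))) h)).elim⟩

end trans
end

/-! ### Part 3: meaning of the basic formulas -/

def nn : ℕ → ZFSet
  | 0 => ∅
  | n+1 => insert (nn n) (nn n)

lemma mem_omega {x : ZFSet} : x ∈ ZFSet.omega ↔ ∃ n, x = nn n := by
  have key : ∀ n, ZFSet.mk (PSet.ofNat n) = nn n := by
    intro n
    induction n with
    | zero => rfl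
    | succ n ih => rw [nn, ← ih]; rfl
  constructor
  · induction x using Quotient.inductionOn with | _ x
    rintro ⟨⟨n⟩, h⟩
    exact ⟨n, (ZFSet.sound h).trans (key n)⟩
  · rintro ⟨n, rfl⟩
    induction n with
    | zero => exact ZFSet.omega_zero
    | succ n ih => exact ZFSet.omega_succ ih

lemma sn_lt {n : ℕ} {α : Type*} (v : Fin n → α) (x : α) (i : ℕ) (h : i < n) (h' : i < n+1) :
    (Fin.snoc v x : Fin (n+1) → α) ⟨i, h'⟩ = v ⟨i, h⟩ := Fin.snoc_castSucc (α := fun _ => α) x v ⟨i, h⟩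
lemma sn_last {n : ℕ} {α : Type*} (v : Fin n → α) (x : α) (h' : n < n+1) :
    (Fin.snoc v x : Fin (n+1) → α) ⟨n, h'⟩ = x := Fin.snoc_last (α := fun _ => α) x v

/-- surjection as a set of pairs -/
def Fsurj (a b f : ZFSet) : Prop :=
  (∀ p ∈ f, ∃ x ∈ a, ∃ y ∈ b, p = ZFSet.pair x y) ∧ (∀ x ∈ a, ∃ y ∈ b, ZFSet.pair x y ∈ f) ∧
  (∀ x y y', ZFSet.pair x y ∈ f → ZFSet.pair x y' ∈ f → y = y') ∧
  (∀ y ∈ b, ∃ x ∈ a, ZFSet.pair x y ∈ f)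

section
variable {N : ZFSet} (hN : N.IsTransitive)
include hN

lemma Rl_subF (v : Fin 2 → Vs N) : Rl subF v ↔ (v 0).1 ⊆ (v 1).1 := by
  simp only [subF, Rl_all, Rl_imp, Rl_memf, Subtype.forall, Fin.snoc, ZFSet.subset_def]
  exact ⟨fun h x hx => h x (hN _ (v 0).2 hx) hx, fun h x _ hx => h hx⟩

lemma Rl_emptyF (v : Fin 1 → Vs N) : Rl emptyF v ↔ (v 0).1 = ∅ := by
  simp only [emptyF, Rl_all, Rl_not, Rl_memf, Subtype.forall, Fin.snoc, ZFSet.eq_empty]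
  exact ⟨fun h x hx => h x (hN _ (v 0).2 hx) hx, fun h x _ hx => h x hx⟩

lemma Rl_pairSetF (v : Fin 3 → Vs N) : Rl pairSetF v ↔ (v 2).1 = {(v 0).1, (v 1).1} := by
  simp only [pairSetF, Rl_all, Rl_iff, Rl_or, Rl_eqf, Rl_memf, Subtype.forall, Fin.snoc]
  rw [ZFSet.ext_iff]
  simp only [ZFSet.mem_pair]
  exact ⟨fun h x => ⟨fun hx => (h x (hN _ (v 2).2 hx)).1 hx, by
    rintro (rfl | rfl)
    exacts [(h _ (v 0).2).2 (Or.inl rfl), (h _ (v 1).2).2 (Or.inr rfl)]⟩, fun h x _ => h x⟩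

lemma Rl_singF (v : Fin 2 → Vs N) : Rl singF v ↔ (v 1).1 = {(v 0).1} := by
  simp [singF, Rl_pairSetF hN]

lemma Rl_succF (v : Fin 2 → Vs N) : Rl succF v ↔ (v 1).1 = insert (v 0).1 (v 0).1 := by
  simp only [succF, Rl_all, Rl_iff, Rl_or, Rl_eqf, Rl_memf, Subtype.forall, Fin.snoc]
  rw [ZFSet.ext_iff]
  simp only [ZFSet.mem_insert_iff]
  refine ⟨fun h x => ⟨fun hx => ((h x (hN _ (v 1).2 hx)).1 hx).symm, ?_⟩,
    fun h x _ => (h x).trans or_comm⟩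
  rintro (rfl | hx)
  · exact (h _ (v 0).2).2 (Or.inr rfl)
  · exact (h x (hN _ (v 0).2 hx)).2 (Or.inl hx)

lemma Rl_transF (v : Fin 1 → Vs N) : Rl transF v ↔ (v 0).1.IsTransitive := by
  simp only [transF, Rl_all, Rl_imp, Rl_memf, Rl_reindex, Rl_subF hN, Subtype.forall]
  exact ⟨fun h x hx => h x (hN _ (v 0).2 hx) hx, fun h x _ hx => h x hx⟩

lemma Rl_ordF (v : Fin 1 → Vs N) : Rl ordF v ↔ IsOrd (v 0).1 := by
  simp only [ordF, Rl_and, Rl_all, Rl_imp, Rl_memf, Rl_reindex, Rl_transF hN, Subtype.forall, IsOrd]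
  exact and_congr_right fun _ =>
    ⟨fun h x hx => h x (hN _ (v 0).2 hx) hx, fun h x _ hx => h x hx⟩

lemma Rl_powF (v : Fin 2 → Vs N) : Rl powF v ↔ ∀ x ∈ N, x ∈ (v 1).1 ↔ x ⊆ (v 0).1 := by
  simp only [powF, Rl_all, Rl_iff, Rl_memf, Rl_reindex, Rl_subF hN, Subtype.forall]
  exact Iff.rfl

lemma Rl_omegaF (v : Fin 1 → Vs N) : Rl omegaF v → (v 0).1 = ZFSet.omega := by
  simp only [omegaF, Rl_and, Rl_or, Rl_ex, Rl_all, Rl_imp, Rl_memf, Rl_reindex, Rl_ordF hN,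
    Rl_emptyF hN, Rl_succF hN, Subtype.forall, Subtype.exists]
  rintro ⟨⟨⟨h1, -⟩, x, hx, hx1, hx2⟩, h3, h4⟩
  change x = ∅ at hx2
  subst hx2
  ext y
  rw [mem_omega]
  constructor
  · intro hy
    induction y using ZFSet.inductionOn with | _ y ih
    rcases h4 y (hN _ (v 0).2 hy) hy with h | ⟨z, hz, h, h'⟩
    · exact ⟨0, h⟩
    · change y = insert z z at h'
      change z ∈ y at h
      obtain ⟨n, rfl⟩ := ih z h (h1 _ hy h)
      exact ⟨n+1, h'⟩
  · rintro ⟨n, rfl⟩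
    induction n with
    | zero => exact hx1
    | succ n ih =>
      obtain ⟨z, hz, h, h'⟩ := h3 (nn n) (hN _ (v 0).2 ih) ih
      change z = insert (nn n) (nn n) at h'
      subst h'; exact h

variable (hp : ∀ a ∈ N, ∀ b ∈ N, ({a, b} : ZFSet) ∈ N)
include hp

lemma op_mem {a b : ZFSet} (ha : a ∈ N) (hb : b ∈ N) : ZFSet.pair a b ∈ N := by
  have := hp _ (hp a ha a ha) _ (hp a ha b hb)
  rwa [ZFSet.pair_eq_singleton] at this

lemma Rl_opF (v : Fin 3 → Vs N) : Rl opF v ↔ (v 2).1 = ZFSet.pair (v 0).1 (v 1).1 := by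
  simp only [opF, Rl_all, Rl_iff, Rl_or, Rl_reindex, Rl_singF hN, Rl_pairSetF hN, Rl_memf,
    Subtype.forall]
  rw [ZFSet.ext_iff]
  simp only [ZFSet.pair, ZFSet.mem_pair]
  refine ⟨fun h x => ⟨fun hx => (h x (hN _ (v 2).2 hx)).1 hx, ?_⟩, fun h x _ => h x⟩
  rintro (rfl | rfl)
  · have := hp _ (v 0).2 _ (v 0).2
    rw [ZFSet.pair_eq_singleton] at this
    exact (h _ this).2 (Or.inl rfl)
  · exact (h _ (hp _ (v 0).2 _ (v 1).2)).2 (Or.inr rfl)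

lemma Rl_relMemF (v : Fin 3 → Vs N) : Rl relMemF v ↔ ZFSet.pair (v 0).1 (v 1).1 ∈ (v 2).1 := by
  simp only [relMemF, Rl_ex, Rl_and, Rl_reindex, Rl_opF hN hp, Rl_memf, Subtype.exists]
  exact ⟨by rintro ⟨x, hx, h, h'⟩; change x = ZFSet.pair (v 0).1 (v 1).1 at h; subst h; exact h',
    fun h => ⟨_, hN _ (v 2).2 h, rfl, h⟩⟩

lemma fst_mem {a b : ZFSet} (h : ZFSet.pair a b ∈ N) : a ∈ N ∧ b ∈ N := by
  have := hN _ (hN _ h (show ({a, b} : ZFSet) ∈ _ by simp [ZFSet.pair]))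
  exact ⟨this (by simp), this (by simp)⟩

lemma Rl_isFuncF (v : Fin 3 → Vs N) : Rl isFuncF v ↔ Fsurj (v 0).1 (v 1).1 (v 2).1 := by
  simp only [isFuncF, Rl_ex, Rl_all, Rl_imp, Rl_and, Rl_reindex, Rl_opF hN hp, Rl_relMemF hN hp,
    Rl_memf, Rl_eqf, Subtype.exists, Subtype.forall, Fsurj]
  rw [and_assoc]
  refine and_congr ?_ (and_congr ?_ (and_congr ?_ ?_))
  · constructor
    · intro h p hp
      obtain ⟨x, hx, y, hy, ⟨h1, h2⟩, h3⟩ := h p (hN _ (v 2).2 hp) hp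
      exact ⟨x, h1, y, h2, h3⟩
    · intro h p _ hp
      obtain ⟨x, hx, y, hy, e⟩ := h p hp
      exact ⟨x, hN _ (v 0).2 hx, y, hN _ (v 1).2 hy, ⟨hx, hy⟩, e⟩
  · constructor
    · intro h x hx
      obtain ⟨y, hy, h1, h2⟩ := h x (hN _ (v 0).2 hx) hx
      exact ⟨y, h1, h2⟩
    · intro h x _ hx
      obtain ⟨y, hy, e⟩ := h x hx
      exact ⟨y, hN _ (v 1).2 hy, hy, e⟩
  · constructor
    · intro h x y y' h1 h2
      have h3 := fst_mem hN hp (hN _ (v 2).2 h1)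
      have h4 := fst_mem hN hp (hN _ (v 2).2 h2)
      exact h x h3.1 y h3.2 y' h4.2 ⟨h1, h2⟩
    · intro h x hx y hy y' hy' e
      exact h x y y' e.1 e.2
  · constructor
    · intro h x hx
      obtain ⟨y, hy, h1, h2⟩ := h x (hN _ (v 1).2 hx) hx
      exact ⟨y, h1, h2⟩
    · intro h x _ hx
      obtain ⟨y, hy, e⟩ := h x hx
      exact ⟨y, hN _ (v 0).2 hy, hy, e⟩

lemma Rl_injF (v : Fin 3 → Vs N) : Rl injF v →
    ∀ x y z, ZFSet.pair x z ∈ (v 2).1 → ZFSet.pair y z ∈ (v 2).1 → x = y := by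
  simp only [injF, Rl_all, Rl_imp, Rl_and, Rl_reindex, Rl_relMemF hN hp,
    Rl_eqf, Subtype.forall]
  intro h x y z h1 h2
  have h3 := fst_mem hN hp (hN _ (v 2).2 h1)
  have h4 := fst_mem hN hp (hN _ (v 2).2 h2)
  exact h x h3.1 y h4.1 z h3.2 ⟨h1, h2⟩

end

/-! ### Part 4: transitive models of ZF, semantically -/

/-- relativized power set -/
noncomputable def Pw (N a : ZFSet) : ZFSet := ZFSet.sep (fun x => x ∈ N) a.powerset

@[simp] lemma mem_Pw {N a x : ZFSet} : x ∈ Pw N a ↔ x ⊆ a ∧ x ∈ N := by simp [Pw]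

structure ZFM (N : ZFSet) : Prop where
  tr : N.IsTransitive
  pair : ∀ a ∈ N, ∀ b ∈ N, ({a, b} : ZFSet) ∈ N
  union : ∀ a ∈ N, ZFSet.sUnion a ∈ N
  pow : ∀ a ∈ N, Pw N a ∈ N
  om : ZFSet.omega ∈ N
  sep : ∀ R : ZFSet → Prop, Dfb N (fun v => R (v 0)) → ∀ a ∈ N, ZFSet.sep R a ∈ N
  repl : ∀ R : ZFSet → ZFSet → Prop, Dfb N (fun v => R (v 0) (v 1)) → ∀ a ∈ N,
    (∀ x ∈ a, ∀ y ∈ N, ∀ y' ∈ N, R x y → R x y' → y = y') →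
    ∃ b ∈ N, ∀ y, y ∈ b ↔ y ∈ N ∧ ∃ x ∈ a, R x y

section
variable {N : ZFSet}

lemma Dfb_of_BF {m : ℕ} (ψ : BF m) (t : Fin m → ℕ ⊕ Vs N) :
    Dfb N (fun v => ∃ h : ∀ i, v i ∈ N,
      Rl ψ (fun i => Sum.elim (fun k => (⟨v k, h k⟩ : Vs N)) id (t i))) := by
  let _ := zfStruct N
  refine ⟨ψ.toFormula.relabel (Sum.elim (fun e => e.elim) t), fun v => ?_⟩
  rw [Formula.realize_relabel, BoundedFormula.realize_toFormula]
  refine ⟨fun ⟨_, h⟩ => ?_, fun h => ⟨fun i => (v i).2, ?_⟩⟩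
  · refine (iff_of_eq ?_).1 h
    unfold Rl; dsimp only; congr 1; funext x; exact x.elim
  · refine (iff_of_eq ?_).1 h
    unfold Rl; dsimp only; congr 1; funext x; exact x.elim

lemma snE {n : ℕ} {α : Type*} (v : Fin n → α) (x : α) (i : ℕ) (h' : i < n+1) :
    (Fin.snoc v x : Fin (n+1) → α) ⟨i, h'⟩ = if h : i < n then v ⟨i, h⟩ else x := by
  split
  · rw [sn_lt]
  · obtain rfl : i = n := by omega
    rw [sn_last]

abbrev sn {n : ℕ} (w : Fin n → Vs N) (x : Vs N) : Fin (n+1) → Vs N := Fin.snoc w x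

lemma Rl_sepAx {n : ℕ} (φ : BF (n+1)) :
    (letI := zfStruct N; Sentence.Realize (M := Vs N) (sepAx φ)) ↔
    ∀ (w : Fin n → Vs N) (a : Vs N), ∃ b : Vs N, ∀ x : Vs N,
      x.1 ∈ b.1 ↔ x.1 ∈ a.1 ∧ Rl φ (sn w x) := by
  simp only [sepAx]
  rw [Rl_alls]
  simp only [Rl_all, Rl_ex, Rl_iff, Rl_and, Rl_memf, Rl_reindex]
  refine forall_congr' fun w => forall_congr' fun a => exists_congr fun b => forall_congr' fun x => ?_
  refine iff_congr (by simp [snE]) (and_congr (by simp [snE]) (iff_of_eq ?_))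
  congr 1
  funext ⟨i, hi⟩
  simp only [snE]
  split <;> simp [snE] <;> grind

lemma Rl_replAx {n : ℕ} (φ : BF (n+2)) :
    (letI := zfStruct N; Sentence.Realize (M := Vs N) (replAx φ)) ↔
    ∀ (w : Fin n → Vs N) (a : Vs N),
      (∀ x y y' : Vs N, x.1 ∈ a.1 ∧ Rl φ (sn (sn w x) y) ∧ Rl φ (sn (sn w x) y') → y.1 = y'.1) →
      ∃ b : Vs N, ∀ y : Vs N, y.1 ∈ b.1 ↔ ∃ x : Vs N, x.1 ∈ a.1 ∧ Rl φ (sn (sn w x) y) := by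
  simp only [replAx]
  rw [Rl_alls]
  simp only [Rl_all, Rl_ex, Rl_iff, Rl_and, Rl_memf, Rl_reindex, Rl_imp, Rl_eqf]
  refine forall_congr' fun w => forall_congr' fun a => imp_congr ?_ ?_
  · refine forall_congr' fun x => forall_congr' fun y => forall_congr' fun y' => imp_congr ?_ (by simp [snE])
    refine and_congr (by simp [snE, show n ≤ n+1+1 by omega]) (and_congr (iff_of_eq ?_) (iff_of_eq ?_)) <;>
    · congr 1
      funext ⟨i, hi⟩
      simp only [snE]
      rcases lt_trichotomy i n with h | h | h
      · simp [snE, h]; grind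
      · simp [snE, h]
      · obtain rfl : i = n+1 := by omega
        simp [snE]
  · refine exists_congr fun b => forall_congr' fun y => iff_congr (by simp [snE]) ?_
    refine exists_congr fun x => and_congr (by simp [snE, show n ≤ n+1+1 by omega]) (iff_of_eq ?_)
    congr 1
    funext ⟨i, hi⟩
    simp only [snE]
    rcases lt_trichotomy i n with h | h | h
    · simp [snE, h]; grind
    · simp [snE, h]
    · obtain rfl : i = n+1 := by omega
      simp [snE]

/-- semantic form of separation from the scheme -/
lemma sep_of_scheme (h : ZModels N sepScheme) (R : ZFSet → Prop) (hR : Dfb N (fun v => R (v 0)))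
    (a : ZFSet) (ha : a ∈ N) : ∃ b ∈ N, ∀ x ∈ N, x ∈ b ↔ x ∈ a ∧ R x := by
  let _ := zfStruct N
  obtain ⟨φ, hφ⟩ := hR
  obtain ⟨m, f, ψ, hψ⟩ := exists_BF (N := N) φ
  let g : Fin m → Fin (m+1) := fun i => match f i with
    | .inl _ => ⟨m, by omega⟩
    | .inr _ => ⟨i, by omega⟩
  let w : Fin m → Vs N := fun i => match f i with
    | .inl _ => ⟨a, ha⟩
    | .inr c => c
  obtain ⟨b, hb⟩ := (Rl_sepAx _).1 (h _ ⟨⟨m, reindex g ψ⟩, rfl⟩) w ⟨a, ha⟩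
  refine ⟨b.1, b.2, fun x hx => (hb ⟨x, hx⟩).trans (and_congr_right fun _ => ?_)⟩
  rw [show R x ↔ _ from hφ (fun _ => ⟨x, hx⟩), Rl_reindex]
  refine Iff.trans (iff_of_eq ?_) (hψ (Sum.elim (fun _ => ⟨x, hx⟩) id)).symm
  congr 1
  funext i
  cases e : f i with
  | inl k => simp [g, e, snE]
  | inr c => simp [g, w, e, snE]

lemma repl_of_scheme (h : ZModels N replScheme) (R : ZFSet → ZFSet → Prop)
    (hR : Dfb N (fun v => R (v 0) (v 1))) (a : ZFSet) (ha : a ∈ N)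
    (hf : ∀ x ∈ N, x ∈ a → ∀ y ∈ N, ∀ y' ∈ N, R x y → R x y' → y = y') :
    ∃ b ∈ N, ∀ y ∈ N, y ∈ b ↔ ∃ x ∈ N, x ∈ a ∧ R x y := by
  let _ := zfStruct N
  obtain ⟨φ, hφ⟩ := hR
  obtain ⟨m, f, ψ, hψ⟩ := exists_BF (N := N) φ
  let g : Fin m → Fin (m+2) := fun i => match f i with
    | .inl 0 => ⟨m, by omega⟩
    | .inl (_ + 1) => ⟨m+1, by omega⟩
    | .inr _ => ⟨i, by omega⟩
  let w : Fin m → Vs N := fun i => match f i with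
    | .inl _ => ⟨a, ha⟩
    | .inr c => c
  have key : ∀ x y (hx : x ∈ N) (hy : y ∈ N), R x y ↔
      Rl (reindex g ψ) (sn (sn w ⟨x, hx⟩) ⟨y, hy⟩) := by
    intro x y hx hy
    rw [show R x y ↔ _ from hφ (fun i => match i with | 0 => ⟨x, hx⟩ | _ => ⟨y, hy⟩), Rl_reindex]
    refine (hψ _).trans (iff_of_eq ?_)
    congr 1
    funext i
    match e : f i with
    | .inl 0 => simp [g, e, snE]
    | .inl (k+1) => simp [g, e, snE]
    | .inr c => simp [g, w, e, snE]
  obtain ⟨b, hb⟩ := (Rl_replAx _).1 (h _ ⟨⟨m, reindex g ψ⟩, rfl⟩) w ⟨a, ha⟩ (by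
    rintro ⟨x, hx⟩ ⟨y, hy⟩ ⟨y', hy'⟩ ⟨h1, h2, h3⟩
    exact hf x hx h1 y hy y' hy' ((key _ _ hx hy).2 h2) ((key _ _ hx hy').2 h3))
  refine ⟨b.1, b.2, fun y hy => (hb ⟨y, hy⟩).trans ?_⟩
  constructor
  · rintro ⟨⟨x, hx⟩, h, h'⟩
    exact ⟨x, hx, h, (key _ _ hx hy).2 h'⟩
  · rintro ⟨x, hx, h, h'⟩
    exact ⟨⟨x, hx⟩, h, (key _ _ hx hy).1 h'⟩


lemma ZFM_of_models (hN : N.IsTransitive) (h : ZModels N ZF) : ZFM N := by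
  have h1 : ZModels N zfFin := fun φ hφ => h φ (Or.inl (Or.inl hφ))
  have h2 : ZModels N sepScheme := fun φ hφ => h φ (Or.inl (Or.inr hφ))
  have h3 : ZModels N replScheme := fun φ hφ => h φ (Or.inr hφ)
  have hsep : ∀ R : ZFSet → Prop, Dfb N (fun v => R (v 0)) → ∀ a ∈ N, ZFSet.sep R a ∈ N := by
    intro R hR a ha
    obtain ⟨b, hb, h⟩ := sep_of_scheme h2 R hR a ha
    suffices ZFSet.sep R a = b by rwa [this]
    ext x
    rw [ZFSet.mem_sep]
    exact ⟨fun hx => (h x (hN _ ha hx.1)).2 hx, fun hx => (h x (hN _ hb hx)).1 hx⟩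
  have hpair : ∀ a ∈ N, ∀ b ∈ N, ({a, b} : ZFSet) ∈ N := by
    intro a ha b hb
    have := (Rl_sent _).1 (h1 pairAx (by simp [zfFin]))
    simp only [pairAx, Rl_all, Rl_ex, Rl_pairSetF hN] at this
    obtain ⟨c, hc⟩ := this ⟨a, ha⟩ ⟨b, hb⟩
    change c.1 = {a, b} at hc
    rw [← hc]; exact c.2
  refine ⟨hN, hpair, ?_, ?_, ?_, hsep, ?_⟩
  · intro a ha
    have := (Rl_sent _).1 (h1 unionAx (by simp [zfFin]))
    simp only [unionAx, Rl_all, Rl_ex, Rl_iff, Rl_and, Rl_memf] at this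
    obtain ⟨c, hc⟩ := this ⟨a, ha⟩
    change ∀ x : Vs N, x.1 ∈ c.1 ↔ ∃ y : Vs N, y.1 ∈ a ∧ x.1 ∈ y.1 at hc
    suffices ZFSet.sUnion a = c by rw [this]; exact c.2
    ext x
    rw [ZFSet.mem_sUnion]
    constructor
    · rintro ⟨y, hy, hx⟩
      have hy' := hN _ ha hy
      exact (hc ⟨x, hN _ hy' hx⟩).2 ⟨⟨y, hy'⟩, hy, hx⟩
    · intro hx
      obtain ⟨y, hy, hx⟩ := (hc ⟨x, hN _ c.2 hx⟩).1 hx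
      exact ⟨y, hy, hx⟩
  · intro a ha
    have := (Rl_sent _).1 (h1 powAx (by simp [zfFin]))
    simp only [powAx, Rl_all, Rl_ex, Rl_powF hN] at this
    obtain ⟨c, hc⟩ := this ⟨a, ha⟩
    change ∀ x ∈ N, x ∈ c.1 ↔ x ⊆ a at hc
    suffices Pw N a = c by rw [this]; exact c.2
    ext x
    rw [mem_Pw]
    exact ⟨fun h => (hc x h.2).2 h.1, fun h => ⟨(hc x (hN _ c.2 h)).1 h, hN _ c.2 h⟩⟩
  · have := (Rl_sent _).1 (h1 infAx (by simp [zfFin]))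
    simp only [infAx, Rl_all, Rl_ex, Rl_and, Rl_imp, Rl_memf, Rl_reindex, Rl_emptyF hN, Rl_succF hN] at this
    obtain ⟨I, ⟨z, h1, h2⟩, h3⟩ := this
    change z.1 ∈ I.1 at h1
    change z.1 = ∅ at h2
    change ∀ x : Vs N, x.1 ∈ I.1 → ∃ y : Vs N, y.1 ∈ I.1 ∧ y.1 = insert x.1 x.1 at h3
    let Q : ZFSet → Prop := fun y => (∀ z, z ∈ y → False) ∨ ∃ z, z ∈ y ∧
      ((∀ u, u ∈ y → (u ∈ z ∨ u = z)) ∧ z ⊆ y)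
    have hQ : Dfb N (fun v => Q (v 0)) := by
      refine Dfb.or (Dfb.ball hN (.var 0) .false) (Dfb.bex hN (.var 0) (Dfb.and ?_ ?_))
      · exact Dfb.ball hN (.var 1) (Dfb.or (Dfb.vmem 0 1) (Dfb.veq 0 1))
      · exact Dfb.sub hN (.var 0) (.var 1)
    have hQ' : ∀ y, Q y → y = ∅ ∨ ∃ z, y = insert z z := by
      rintro y (h | ⟨z, hz, h, h'⟩)
      · exact Or.inl ((ZFSet.eq_empty _).2 fun x hx => h x hx)
      · refine Or.inr ⟨z, ?_⟩
        ext u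
        rw [ZFSet.mem_insert_iff]
        exact ⟨fun hu => (h u hu).symm, by rintro (rfl | hu); exacts [hz, h' hu]⟩
    have hQ'' : ∀ n, Q (nn n) := by
      rintro (_ | n)
      · left; intro z hz; exact ZFSet.notMem_empty _ hz
      · right
        exact ⟨nn n, ZFSet.mem_insert _ _, fun u hu => ((ZFSet.mem_insert_iff).1 hu).symm,
          fun u hu => ZFSet.mem_insert_of_mem _ hu⟩
    have hnn : ∀ n x, x ∈ nn n → ∃ m, x = nn m := by
      intro n
      induction n with
      | zero => intro x hx; exact (ZFSet.notMem_empty _ hx).elim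
      | succ n ih =>
        intro x hx
        rcases ZFSet.mem_insert_iff.1 hx with h | h
        exacts [⟨n, h⟩, ih _ h]
    have := hsep (fun x => Q x ∧ ∀ y, y ∈ x → Q y)
      (Dfb.and hQ (Dfb.ball hN (.var 0) (R := fun _ y => Q y) hQ)) I.1 I.2
    convert this
    ext x
    rw [mem_omega, ZFSet.mem_sep]
    constructor
    · rintro ⟨n, rfl⟩
      refine ⟨?_, hQ'' n, fun y hy => ?_⟩
      · induction n with
        | zero => rw [h2] at h1; exact h1
        | succ n ih =>
          obtain ⟨y, hy, e⟩ := h3 ⟨_, hN _ I.2 ih⟩ ih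
          rw [e] at hy; exact hy
      · obtain ⟨m, rfl⟩ := hnn _ _ hy
        exact hQ'' m
    · rintro ⟨-, hx, hx'⟩
      induction x using ZFSet.inductionOn with | _ x ih
      rcases hQ' x hx with rfl | ⟨z, rfl⟩
      · exact ⟨0, rfl⟩
      · obtain ⟨n, rfl⟩ := ih z (ZFSet.mem_insert _ _) (hx' z (ZFSet.mem_insert _ _))
          (fun y hy => hx' y (ZFSet.mem_insert_of_mem _ hy))
        exact ⟨n+1, rfl⟩
  · intro R hR a ha hf
    obtain ⟨b, hb, h⟩ := repl_of_scheme h3 R hR a ha (fun x _ hx => hf x hx)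
    refine ⟨b, hb, fun y => ⟨fun hy => ?_, ?_⟩⟩
    · obtain ⟨x, _, hx, hr⟩ := (h y (hN _ hb hy)).1 hy
      exact ⟨hN _ hb hy, x, hx, hr⟩
    · rintro ⟨hy, x, hx, hr⟩
      exact (h y hy).2 ⟨x, hN _ ha hx, hx, hr⟩

lemma models_of_ZFM (h : ZFM N) : ZModels N ZF := by
  have hN := h.tr
  rintro φ ((hφ | hφ) | hφ)
  · simp only [zfFin, Set.mem_insert_iff, Set.mem_singleton_iff] at hφ
    rcases hφ with rfl | rfl | rfl | rfl | rfl | rfl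
    · refine (Rl_sent _).2 ?_
      simp only [extAx, Rl_all, Rl_imp, Rl_and, Rl_reindex, Rl_subF hN, Rl_eqf]
      exact fun x y h => le_antisymm h.1 h.2
    · refine (Rl_sent _).2 ?_
      simp only [foundAx, Rl_all, Rl_imp, Rl_and, Rl_not, Rl_memf, Rl_ex]
      rintro x ⟨y, hy⟩
      change y.1 ∈ x.1 at hy
      obtain ⟨z, hz, e⟩ := ZFSet.regularity x.1 (by rintro e; rw [e] at hy; exact ZFSet.notMem_empty _ hy)
      refine ⟨⟨z, hN _ x.2 hz⟩, hz, fun u h1 h2 => ?_⟩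
      change u.1 ∈ x.1 at h1
      change u.1 ∈ z at h2
      exact ZFSet.notMem_empty u.1 (by rw [← e]; simp [h1, h2])
    · refine (Rl_sent _).2 ?_
      simp only [pairAx, Rl_all, Rl_ex, Rl_pairSetF hN]
      exact fun x y => ⟨⟨_, h.pair _ x.2 _ y.2⟩, rfl⟩
    · refine (Rl_sent _).2 ?_
      simp only [unionAx, Rl_all, Rl_ex, Rl_iff, Rl_and, Rl_memf]
      refine fun x => ⟨⟨_, h.union _ x.2⟩, fun y => ZFSet.mem_sUnion.trans ⟨?_, ?_⟩⟩
      · rintro ⟨z, hz, hy⟩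
        exact ⟨⟨z, hN _ x.2 hz⟩, hz, hy⟩
      · rintro ⟨z, hz, hy⟩
        exact ⟨z, hz, hy⟩
    · refine (Rl_sent _).2 ?_
      simp only [powAx, Rl_all, Rl_ex, Rl_powF hN]
      exact fun x => ⟨⟨_, h.pow _ x.2⟩, fun y hy => mem_Pw.trans ⟨fun h => h.1, fun h => ⟨h, hy⟩⟩⟩
    · refine (Rl_sent _).2 ?_
      simp only [infAx, Rl_all, Rl_ex, Rl_and, Rl_imp, Rl_memf, Rl_reindex, Rl_emptyF hN, Rl_succF hN]
      refine ⟨⟨_, h.om⟩, ⟨⟨_, hN _ h.om ZFSet.omega_zero⟩, ZFSet.omega_zero, rfl⟩, fun x hx => ?_⟩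
      have := ZFSet.omega_succ hx
      exact ⟨⟨_, hN _ h.om this⟩, this, rfl⟩
  · obtain ⟨⟨n, φ⟩, rfl⟩ := hφ
    refine (Rl_sepAx φ).2 fun w a => ?_
    refine ⟨⟨_, h.sep (fun x => ∃ hx : x ∈ N, Rl φ (sn w ⟨x, hx⟩)) ?_ a.1 a.2⟩, fun x => ?_⟩
    · refine (Dfb_of_BF φ (fun i => if hi : i.1 < n then .inr (w ⟨i, hi⟩) else .inl 0)).congr
        fun v hv => ?_
      refine ⟨fun ⟨_, h⟩ => ⟨hv, (iff_of_eq ?_).1 h⟩, fun ⟨_, h⟩ => ⟨hv 0, (iff_of_eq ?_).1 h⟩⟩ <;>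
      · congr 1; funext ⟨i, hi⟩; simp only [snE]; split <;> rfl
    · simp [ZFSet.mem_sep]
  · obtain ⟨⟨n, φ⟩, rfl⟩ := hφ
    refine (Rl_replAx φ).2 fun w a hf => ?_
    obtain ⟨b, hb, hb'⟩ := h.repl
      (fun x y => ∃ (hx : x ∈ N) (hy : y ∈ N), Rl φ (sn (sn w ⟨x, hx⟩) ⟨y, hy⟩)) (by
        refine (Dfb_of_BF φ (fun i => if hi : i.1 < n then .inr (w ⟨i, hi⟩) else
          if i.1 = n then .inl 0 else .inl 1)).congr fun v hv => ?_
        refine ⟨fun ⟨_, _, h⟩ => ⟨hv, (iff_of_eq ?_).1 h⟩,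
          fun ⟨_, h⟩ => ⟨hv 0, hv 1, (iff_of_eq ?_).1 h⟩⟩ <;>
        · congr 1; funext ⟨i, hi⟩; simp only [snE]
          rcases lt_trichotomy i n with h | h | h
          · simp [h, h.trans (Nat.lt_succ_self n)]
          · simp [h]
          · obtain rfl : i = n+1 := by omega
            simp) a.1 a.2
      (by rintro x hx y hy y' hy' ⟨h1, _, h2⟩ ⟨_, _, h3⟩; exact hf ⟨x, h1⟩ ⟨y, hy⟩ ⟨y', hy'⟩ ⟨hx, h2, h3⟩)
    refine ⟨⟨b, hb⟩, fun y => (hb' _).trans ⟨?_, ?_⟩⟩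
    · rintro ⟨_, x, hx, h1, h2, h3⟩
      exact ⟨⟨x, h1⟩, hx, h3⟩
    · rintro ⟨x, hx, h⟩
      exact ⟨y.2, x.1, hx, x.2, y.2, h⟩

/-- the semantic axiom of choice -/
def ACM (N : ZFSet) : Prop := ∀ x ∈ N, ∃ α ∈ N, IsOrd α ∧ ∃ f ∈ N, Fsurj α x f

lemma acAx_iff (h : ZFM N) :
    (letI := zfStruct N; Sentence.Realize (M := Vs N) acAx) ↔ ACM N := by
  refine (Rl_sent _).trans ?_
  simp only [acAx, Rl_all, Rl_ex, Rl_and, Rl_reindex, Rl_ordF h.tr, Rl_isFuncF h.tr h.pair]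
  constructor
  · intro H x hx
    obtain ⟨α, f, h1, h2⟩ := H ⟨x, hx⟩
    exact ⟨α.1, α.2, h1, f.1, f.2, h2⟩
  · rintro H ⟨x, hx⟩
    obtain ⟨α, h1, h2, f, h3, h4⟩ := H x hx
    exact ⟨⟨α, h1⟩, ⟨f, h3⟩, h2, h4⟩

/-- what CH says in a transitive model -/
lemma of_chSent (h : ZFM N) (hc : letI := zfStruct N; Sentence.Realize (M := Vs N) chSent) :
    ∃ α ∈ N, ∃ b ∈ N, IsOrd α ∧
      (∀ β ∈ α, β = ∅ ∨ ∃ f ∈ N, Fsurj ZFSet.omega β f) ∧ Fsurj (Pw N ZFSet.omega) α b ∧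
      ∀ x y z, ZFSet.pair x z ∈ b → ZFSet.pair y z ∈ b → x = y := by
  have hN := h.tr
  have hp := h.pair
  replace hc := (Rl_sent _).1 hc
  simp only [chSent, Rl_ex, Rl_and, Rl_or, Rl_reindex, Rl_powF hN, alephOneF, Rl_all, Rl_imp, Rl_memf,
    Rl_emptyF hN, Rl_ordF hN, bijF, Rl_isFuncF hN hp] at hc
  obtain ⟨w, P, α, b, ⟨h1, h2⟩, ⟨⟨h3, -⟩, h4⟩, h5, h6⟩ := hc
  have e := Rl_omegaF hN _ h1
  change w.1 = _ at e
  change ∀ x ∈ N, x ∈ P.1 ↔ x ⊆ w.1 at h2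
  change Fsurj P.1 α.1 b.1 at h5
  have e' : P.1 = Pw N ZFSet.omega := by
    ext x
    rw [mem_Pw]
    exact ⟨fun hx => ⟨by rw [← e]; exact (h2 x (hN _ P.2 hx)).1 hx, hN _ P.2 hx⟩,
      fun hx => (h2 x hx.2).2 (by rw [e]; exact hx.1)⟩
  refine ⟨α.1, α.2, b.1, b.2, h3, fun β hβ => ?_, e' ▸ h5, Rl_injF hN hp _ h6⟩
  rcases h4 ⟨β, hN _ α.2 hβ⟩ hβ with h | ⟨f, hf⟩
  · exact Or.inl h
  · refine Or.inr ⟨f.1, f.2, ?_⟩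
    change Fsurj w.1 β f.1 at hf
    rwa [e] at hf

end

/-! ### Part 5: definable functions in a model of ZF -/

noncomputable def img (f : ZFSet → ZFSet) (a : ZFSet) : ZFSet :=
  ZFSet.range (fun x : {y // y ∈ a} => f x.1)

lemma mem_img {f : ZFSet → ZFSet} {a y : ZFSet} : y ∈ img f a ↔ ∃ x ∈ a, f x = y := by
  simp [img]

lemma Dfb.inst {M : ZFSet} {R : (ℕ → ZFSet) → Prop} (h : Dfb M R) (t : ℕ → ℕ ⊕ Vs M) :
    Dfb M (fun v => R (fun i => Sum.elim v Subtype.val (t i))) := by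
  let _ := zfStruct M
  obtain ⟨φ, hφ⟩ := h
  refine ⟨φ.relabel (Sum.elim t Sum.inr), fun v => ?_⟩
  rw [Formula.realize_relabel]
  have := hφ (fun i => Sum.elim v id (t i))
  refine Iff.trans (iff_of_eq ?_) (this.trans (iff_of_eq ?_))
  · dsimp only; congr 1; funext i
    rcases t i with _ | _ <;> rfl
  · congr 1
    funext x; rcases x with x | x <;> rfl

lemma Dfb.inst0 {M : ZFSet} {R : (ℕ → ZFSet) → ZFSet → Prop}
    (h : Dfb M (fun v => R (fun i => v (i+1)) (v 0))) {v : ℕ → ZFSet} (hv : ∀ i, v i ∈ M) :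
    Dfb M (fun u => R v (u 0)) :=
  h.inst (fun i => match i with | 0 => .inl 0 | i+1 => .inr ⟨v i, hv i⟩)

lemma Dfb.inst00 {M : ZFSet} {R : (ℕ → ZFSet) → ZFSet → ZFSet → Prop}
    (h : Dfb M (fun v => R (fun i => v (i+2)) (v 0) (v 1))) {v : ℕ → ZFSet} (hv : ∀ i, v i ∈ M) :
    Dfb M (fun u => R v (u 0) (u 1)) :=
  h.inst (fun i => match i with | 0 => .inl 0 | 1 => .inl 1 | i+2 => .inr ⟨v i, hv i⟩)

section
variable {M : ZFSet} (hM : ZFM M) {F G : (ℕ → ZFSet) → ZFSet}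
include hM

lemma ZFM.emp : ∅ ∈ M := hM.tr _ hM.om ZFSet.omega_zero
lemma ZFM.sing {a : ZFSet} (ha : a ∈ M) : ({a} : ZFSet) ∈ M := by
  have := hM.pair a ha a ha
  rwa [ZFSet.pair_eq_singleton] at this
lemma ZFM.op {a b : ZFSet} (ha : a ∈ M) (hb : b ∈ M) : ZFSet.pair a b ∈ M := op_mem hM.tr hM.pair ha hb
lemma ZFM.op' {a b : ZFSet} (h : ZFSet.pair a b ∈ M) : a ∈ M ∧ b ∈ M := fst_mem hM.tr hM.pair h
lemma ZFM.uni {a b : ZFSet} (ha : a ∈ M) (hb : b ∈ M) : a ∪ b ∈ M := hM.union _ (hM.pair _ ha _ hb)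

lemma Dfb.zall {R : (ℕ → ZFSet) → ZFSet → Prop} (hF : Dfn M F)
    (h : Dfb M (fun v => R (fun i => v (i+1)) (v 0))) :
    Dfb M (fun v => ∀ x, x ∈ F v → R v x) := Dfb.ball hM.tr hF h
lemma Dfb.zex {R : (ℕ → ZFSet) → ZFSet → Prop} (hF : Dfn M F)
    (h : Dfb M (fun v => R (fun i => v (i+1)) (v 0))) :
    Dfb M (fun v => ∃ x, x ∈ F v ∧ R v x) := Dfb.bex hM.tr hF h
lemma Dfb.zsub (hF : Dfn M F) (hG : Dfn M G) : Dfb M (fun v => F v ⊆ G v) := Dfb.sub hM.tr hF hG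

lemma Dfn.emp : Dfn M (fun _ => ∅) := .const hM.emp
lemma Dfn.om : Dfn M (fun _ => ZFSet.omega) := .const hM.om
lemma Dfn.upair (hF : Dfn M F) (hG : Dfn M G) : Dfn M (fun v => ({F v, G v} : ZFSet)) := by
  refine Dfn.of_mem hM.tr (fun v hv => hM.pair _ (hF.1 v hv) _ (hG.1 v hv)) ?_
  refine (Dfb.or (Dfb.eq (.var 0) hF.shift) (Dfb.eq (.var 0) hG.shift)).congr fun v _ => ?_
  rw [ZFSet.mem_pair]
lemma Dfn.sing (hF : Dfn M F) : Dfn M (fun v => ({F v} : ZFSet)) := by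
  have := Dfn.upair hM hF hF
  simpa only [ZFSet.pair_eq_singleton] using this
lemma Dfn.op (hF : Dfn M F) (hG : Dfn M G) : Dfn M (fun v => ZFSet.pair (F v) (G v)) :=
  Dfn.upair hM (Dfn.sing hM hF) (Dfn.upair hM hF hG)
lemma Dfn.sU (hF : Dfn M F) : Dfn M (fun v => ZFSet.sUnion (F v)) := by
  refine Dfn.of_mem hM.tr (fun v hv => hM.union _ (hF.1 v hv)) ?_
  refine (Dfb.zex hM (R := fun v x => v 0 ∈ x) hF.shift (Dfb.vmem 1 0)).congr fun v _ => ?_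
  rw [ZFSet.mem_sUnion]
lemma Dfn.uni (hF : Dfn M F) (hG : Dfn M G) : Dfn M (fun v => F v ∪ G v) :=
  Dfn.sU hM (Dfn.upair hM hF hG)
lemma Dfn.pw (hF : Dfn M F) : Dfn M (fun v => Pw M (F v)) := by
  refine Dfn.of_mem hM.tr (fun v hv => hM.pow _ (hF.1 v hv)) ?_
  refine (Dfb.zsub hM (.var 0) hF.shift).congr fun v hv => ?_
  rw [mem_Pw]; simp [hv 0]
lemma Dfn.sep {R : (ℕ → ZFSet) → ZFSet → Prop} (hF : Dfn M F)
    (h : Dfb M (fun v => R (fun i => v (i+1)) (v 0))) :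
    Dfn M (fun v => ZFSet.sep (fun x => R v x) (F v)) := by
  refine Dfn.of_mem hM.tr (fun v hv => hM.sep _ (h.inst0 hv) _ (hF.1 v hv)) ?_
  refine (Dfb.and (Dfb.mem (.var 0) hF.shift) h).congr fun v hv => ?_
  rw [ZFSet.mem_sep]
lemma ZFM.prod {a b : ZFSet} (ha : a ∈ M) (hb : b ∈ M) : ZFSet.prod a b ∈ M := by
  have h1 := hM.pow _ (hM.pow _ (hM.uni ha hb))
  have h2 : Dfb M (fun v => ∃ x, x ∈ a ∧ ∃ y, y ∈ b ∧ v 0 = ZFSet.pair x y) :=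
    Dfb.zex hM (.const ha) (Dfb.zex hM (.const hb) (Dfb.eq (.var 2) (Dfn.op hM (.var 1) (.var 0))))
  convert hM.sep (fun z => ∃ x, x ∈ a ∧ ∃ y, y ∈ b ∧ z = ZFSet.pair x y) h2 _ h1 using 1
  ext z
  rw [ZFSet.mem_prod, ZFSet.mem_sep]
  refine ⟨fun h => ⟨?_, h⟩, fun h => h.2⟩
  obtain ⟨x, hx, y, hy, rfl⟩ := h
  have hx' := hM.tr _ ha hx
  have hy' := hM.tr _ hb hy
  rw [mem_Pw]
  refine ⟨fun z hz => ?_, hM.op hx' hy'⟩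
  rw [mem_Pw]
  rcases ZFSet.mem_pair.1 hz with rfl | rfl
  · refine ⟨fun u hu => ?_, hM.sing hx'⟩
    rw [ZFSet.mem_singleton] at hu; subst hu
    exact ZFSet.mem_union.2 (Or.inl hx)
  · refine ⟨fun u hu => ?_, hM.pair _ hx' _ hy'⟩
    rcases ZFSet.mem_pair.1 hu with rfl | rfl
    exacts [ZFSet.mem_union.2 (Or.inl hx), ZFSet.mem_union.2 (Or.inr hy)]
lemma Dfn.prod (hF : Dfn M F) (hG : Dfn M G) : Dfn M (fun v => ZFSet.prod (F v) (G v)) := by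
  refine Dfn.of_mem hM.tr (fun v hv => hM.prod (hF.1 v hv) (hG.1 v hv)) ?_
  refine (Dfb.zex hM (R := fun v x => ∃ y, y ∈ G (fun i => v (i+1)) ∧ v 0 = ZFSet.pair x y) hF.shift
    (Dfb.zex hM hG.shift.shift (Dfb.eq (.var 2) (Dfn.op hM (.var 1) (.var 0))))).congr fun v hv => ?_
  rw [ZFSet.mem_prod]

/-- Replacement for definable functions. -/
lemma ZFM.img {f : ZFSet → ZFSet} {a : ZFSet} (ha : a ∈ M) (hf : ∀ x ∈ a, f x ∈ M)
    (h : Dfb M (fun v => v 1 = f (v 0))) : img f a ∈ M := by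
  obtain ⟨b, hb, H⟩ := hM.repl (fun x y => y = f x) h a ha (by rintro x - y - y' - rfl rfl; rfl)
  convert hb
  ext y
  rw [H, mem_img]
  constructor
  · rintro ⟨x, hx, rfl⟩; exact ⟨hf x hx, x, hx, rfl⟩
  · rintro ⟨_, x, hx, rfl⟩; exact ⟨x, hx, rfl⟩

end

lemma dfa {M : ZFSet} {R : (ℕ → ZFSet) → Prop} (h : Dfb M R := by
  repeat' first | assumption | exact Dfn.var _ | exact Dfn.const (by assumption) | apply Dfb.and | apply Dfb.or | apply Dfb.not | apply Dfb.allM | apply Dfb.exM | apply Dfb.zall | apply Dfb.zex | apply Dfb.imp | apply Dfb.iff | apply Dfb.eq | apply Dfb.mem | apply Dfb.zsub | apply Dfn.emp | apply Dfn.om | apply Dfn.sing | apply Dfn.upair | apply Dfn.op | apply Dfn.sU | apply Dfn.uni | apply Dfn.pw | apply Dfn.prod | apply Dfn.sep) :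
    Dfb M R := h

example {M : ZFSet} (hM : ZFM M) (a : ZFSet) (ha : a ∈ M) : Dfb M (fun v => ∃ x ∈ v 0, ∀ y, y ∈ M → ∀ z ∈ y ∪ v 1,
  z ∈ a ∧ ZFSet.pair z y ⊆ ZFSet.prod z (v 0) ∨ x = {z}) := dfa


/-! ### Part 6: levels of the cumulative hierarchy, collection -/

def IsV (M w : ZFSet) : Prop := ∀ x, x ∈ M → (x ∈ w ↔ x.rank < w.rank)
def Hist (M h : ZFSet) : Prop := ∀ v, v ∈ h → ∀ x, x ∈ M → (x ∈ v ↔ ∃ u, u ∈ h ∧ u ∈ v ∧ x ⊆ u)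
def Lev (M w : ZFSet) : Prop := ∃ h, h ∈ M ∧ Hist M h ∧ ∀ x, x ∈ M → (x ∈ w ↔ ∃ u, u ∈ h ∧ x ⊆ u)
noncomputable def Vl (M x : ZFSet) : ZFSet := ZFSet.sep (fun y => y.rank < x.rank) M

lemma mem_Vl {M x y : ZFSet} : y ∈ Vl M x ↔ y ∈ M ∧ y.rank < x.rank := by simp [Vl]

section
variable {M : ZFSet} (hM : ZFM M)
include hM

lemma sub_Vl {x : ZFSet} (hx : x ∈ M) : x ⊆ Vl M x := fun _ h =>
  mem_Vl.2 ⟨hM.tr _ hx h, ZFSet.rank_lt_of_mem h⟩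

lemma rank_Vl {x : ZFSet} (hx : x ∈ M) : (Vl M x).rank = x.rank :=
  le_antisymm (ZFSet.rank_le_iff.2 fun _ h => (mem_Vl.1 h).2) (ZFSet.rank_mono (sub_Vl hM hx))

lemma IsV.eq {w : ZFSet} (h : IsV M w) (hw : w ∈ M) : w = Vl M w := by
  ext x
  rw [mem_Vl]
  exact ⟨fun hx => ⟨hM.tr _ hw hx, ZFSet.rank_lt_of_mem hx⟩, fun hx => (h _ hx.1).2 hx.2⟩

lemma IsV.sub_iff {w x : ZFSet} (h : IsV M w) (hx : x ∈ M) : x ⊆ w ↔ x.rank ≤ w.rank :=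
  ⟨ZFSet.rank_mono, fun hr y hy => (h y (hM.tr _ hx hy)).2 ((ZFSet.rank_lt_of_mem hy).trans_le hr)⟩

lemma isV_aux {k w : ZFSet} (hk : ∀ u ∈ k, u ∈ M ∧ IsV M u) (hwM : w ∈ M)
    (hw : ∀ x, x ∈ M → (x ∈ w ↔ ∃ u, u ∈ k ∧ x ⊆ u)) : IsV M w := by
  intro x hx
  refine ⟨ZFSet.rank_lt_of_mem, fun h => ?_⟩
  obtain ⟨y, hy, hxy⟩ := ZFSet.lt_rank_iff.1 h
  obtain ⟨u, hu, hyu⟩ := (hw y (hM.tr _ hwM hy)).1 hy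
  refine (hw x hx).2 ⟨u, hu, ((hk u hu).2.sub_iff hM hx).2 (hxy.trans (ZFSet.rank_mono hyu))⟩

lemma Hist.isV {h : ZFSet} (hh : Hist M h) (hhM : h ∈ M) : ∀ v, v ∈ h → IsV M v := by
  intro v
  induction v using ZFSet.inductionOn with
  | _ v ih =>
    intro hv
    refine isV_aux hM (k := ZFSet.sep (· ∈ v) h) ?_ (hM.tr _ hhM hv) ?_
    · intro u hu
      rw [ZFSet.mem_sep] at hu
      exact ⟨hM.tr _ hhM hu.1, ih u hu.2 hu.1⟩
    · intro x hx
      rw [hh v hv x hx]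
      simp only [ZFSet.mem_sep, and_assoc]

lemma Lev.isV {w : ZFSet} (h : Lev M w) (hw : w ∈ M) : IsV M w := by
  obtain ⟨h, hhM, hh, H⟩ := h
  exact isV_aux hM (fun u hu => ⟨hM.tr _ hhM hu, hh.isV hM hhM u hu⟩) hw H

lemma dfLev : Dfb M (fun v => Lev M (v 0)) := by
  unfold Lev Hist
  exact dfa

lemma Hist.lev {h : ZFSet} (hh : Hist M h) (hhM : h ∈ M) : ∀ v, v ∈ h → Lev M v := by
  intro v hv
  have hvM := hM.tr _ hhM hv
  refine ⟨ZFSet.sep (· ∈ v) h, hM.sep _ dfa _ hhM, ?_, ?_⟩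
  · intro z hz x hx
    rw [ZFSet.mem_sep] at hz
    rw [hh z hz.1 x hx]
    have hzv := hh.isV hM hhM v hv
    constructor
    · rintro ⟨u, hu, huz, h⟩
      refine ⟨u, ZFSet.mem_sep.2 ⟨hu, ?_⟩, huz, h⟩
      rw [hzv _ (hM.tr _ hhM hu)]
      exact (ZFSet.rank_lt_of_mem huz).trans (ZFSet.rank_lt_of_mem hz.2)
    · rintro ⟨u, hu, huz, h⟩
      exact ⟨u, (ZFSet.mem_sep.1 hu).1, huz, h⟩
  · intro x hx
    rw [hh v hv x hx]
    simp only [ZFSet.mem_sep, and_assoc]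

lemma lev_ext {u w : ZFSet} (hu : u ∈ M) (hw : w ∈ M) (hu' : Lev M u) (hw' : Lev M w)
    (h : u.rank = w.rank) : u = w :=
  subset_antisymm (((hw'.isV hM hw).sub_iff hM hu).2 h.le) (((hu'.isV hM hu).sub_iff hM hw).2 h.ge)

lemma lev_ex : ∀ x, x ∈ M → ∃ u ∈ M, Lev M u ∧ u.rank = x.rank := by
  intro x
  induction x using ZFSet.inductionOn with
  | _ x ih =>
  intro hx
  have dL := dfLev hM
  have d1 : Dfb M (fun v => (fun y u => Lev M u ∧ y ⊆ u ∧ ∀ u', u' ∈ M → Lev M u' → y ⊆ u' → u ⊆ u') (v 0) (v 1)) := by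
    have e1 := Dfb.app1 dL (Dfn.var 1)
    have e2 := Dfb.app1 dL (Dfn.var 0)
    exact dfa
  have key : ∀ y ∈ x, ∀ u ∈ M, (Lev M u ∧ y ⊆ u ∧ ∀ u', u' ∈ M → Lev M u' → y ⊆ u' → u ⊆ u') ↔
      (Lev M u ∧ u.rank = y.rank) := by
    intro y hy u hu
    have hyM := hM.tr _ hx hy
    constructor
    · rintro ⟨h1, h2, h3⟩
      obtain ⟨u', hu', h4, h5⟩ := ih y hy hyM
      exact ⟨h1, le_antisymm ((ZFSet.rank_mono (h3 u' hu' h4 (((h4.isV hM hu').sub_iff hM hyM).2 h5.ge))).trans h5.le)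
        (ZFSet.rank_mono h2)⟩
    · rintro ⟨h1, h2⟩
      refine ⟨h1, ((h1.isV hM hu).sub_iff hM hyM).2 h2.ge, fun u' hu' h4 h5 => ?_⟩
      exact ((h4.isV hM hu').sub_iff hM hu).2 (h2.le.trans (ZFSet.rank_mono h5))
  obtain ⟨a, ha, Ha⟩ := hM.repl _ d1 x hx (by
    intro y hy u hu u' hu' h h'
    have h := (key y hy u hu).1 h
    have h' := (key y hy u' hu').1 h'
    exact lev_ext hM hu hu' h.1 h'.1 (h.2.trans h'.2.symm))
  have Ha' : ∀ u, u ∈ a ↔ u ∈ M ∧ ∃ y ∈ x, Lev M u ∧ u.rank = y.rank := by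
    intro u
    rw [Ha]
    refine and_congr_right fun hu => ?_
    exact exists_congr fun y => and_congr_right fun hy => key y hy u hu
  -- the new level
  obtain ⟨w, hwM, hw⟩ : ∃ w ∈ M, ∀ z, z ∈ M → (z ∈ w ↔ ∃ u, u ∈ a ∧ z ⊆ u) := by
    refine ⟨ZFSet.sep (fun z => ∃ u, u ∈ a ∧ z ⊆ u) (Pw M (ZFSet.sUnion a)), hM.sep _ dfa _ (hM.pow _ (hM.union _ ha)), ?_⟩
    intro z hz
    rw [ZFSet.mem_sep, mem_Pw]
    refine ⟨fun h => h.2, fun h => ⟨⟨?_, hz⟩, h⟩⟩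
    obtain ⟨u, hu, h⟩ := h
    exact fun t ht => ZFSet.mem_sUnion.2 ⟨u, hu, h ht⟩
  have hwV : IsV M w := isV_aux hM (fun u hu => by
    obtain ⟨h1, y, hy, h2, h3⟩ := (Ha' u).1 hu
    exact ⟨h1, h2.isV hM h1⟩) hwM hw
  refine ⟨w, hwM, ⟨ZFSet.sep (Lev M) w, hM.sep _ dL _ hwM, ?_, ?_⟩, ?_⟩
  · intro v hv z hz
    rw [ZFSet.mem_sep] at hv
    obtain ⟨hvw, hvL⟩ := hv
    have hvM := hM.tr _ hwM hvw
    constructor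
    · intro hzv
      obtain ⟨h0, h0M, hh, H⟩ := hvL
      obtain ⟨u, hu, hzu⟩ := (H z hz).1 hzv
      have huM := hM.tr _ h0M hu
      have huv : u ∈ v := (H u huM).2 ⟨u, hu, fun _ h => h⟩
      refine ⟨u, ZFSet.mem_sep.2 ⟨?_, hh.lev hM h0M u hu⟩, huv, hzu⟩
      rw [hwV u huM]
      exact (ZFSet.rank_lt_of_mem huv).trans (ZFSet.rank_lt_of_mem hvw)
    · rintro ⟨u, -, huv, hzu⟩
      rw [hvL.isV hM hvM z hz]
      exact (ZFSet.rank_mono hzu).trans_lt (ZFSet.rank_lt_of_mem huv)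
  · intro z hz
    constructor
    · intro hzw
      obtain ⟨u, hu, hzu⟩ := (hw z hz).1 hzw
      obtain ⟨h1, y, hy, h2, h3⟩ := (Ha' u).1 hu
      exact ⟨u, ZFSet.mem_sep.2 ⟨(hw u h1).2 ⟨u, hu, fun _ h => h⟩, h2⟩, hzu⟩
    · rintro ⟨u, hu, hzu⟩
      rw [hwV z hz]
      exact (ZFSet.rank_mono hzu).trans_lt (ZFSet.rank_lt_of_mem (ZFSet.mem_sep.1 hu).1)
  · refine le_antisymm (ZFSet.rank_le_iff.2 fun z hz => ?_) (ZFSet.rank_le_iff.2 fun y hy => ?_)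
    · obtain ⟨u, hu, hzu⟩ := (hw z (hM.tr _ hwM hz)).1 hz
      obtain ⟨h1, y, hy, h2, h3⟩ := (Ha' u).1 hu
      exact (ZFSet.rank_mono hzu).trans_lt (h3.trans_lt (ZFSet.rank_lt_of_mem hy))
    · obtain ⟨u, hu, h1, h2⟩ := ih y hy (hM.tr _ hx hy)
      have hua : u ∈ a := (Ha' u).2 ⟨hu, y, hy, h1, h2⟩
      exact h2.ge.trans_lt (ZFSet.rank_lt_of_mem ((hw u hu).2 ⟨u, hua, fun _ h => h⟩))

lemma Vl_lev {x : ZFSet} (hx : x ∈ M) : Vl M x ∈ M ∧ Lev M (Vl M x) := by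
  obtain ⟨u, hu, h1, h2⟩ := lev_ex hM x hx
  have : Vl M x = u := by
    rw [(h1.isV hM hu).eq hM hu, Vl, Vl, h2]
  rw [this]; exact ⟨hu, h1⟩

lemma ZFM.vl {x : ZFSet} (hx : x ∈ M) : Vl M x ∈ M := (Vl_lev hM hx).1

lemma Dfn.vl {F : (ℕ → ZFSet) → ZFSet} (hF : Dfn M F) : Dfn M (fun v => Vl M (F v)) := by
  refine Dfn.app1 (f := Vl M) (Dfn.of_mem hM.tr (fun v hv => hM.vl (hv 0)) ?_) hF
  have dL := dfLev hM
  have : Dfb M (fun v => ∀ u, u ∈ M → Lev M u → v 1 ⊆ u → v 0 ∈ u) := by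
    have e1 := Dfb.app1 dL (Dfn.var 0)
    exact dfa
  refine this.congr fun v hv => ?_
  constructor
  · intro h u hu hL hs
    rw [hL.isV hM hu _ (hv 0)]
    exact (mem_Vl.1 h).2.trans_le (ZFSet.rank_mono hs)
  · intro h
    exact h _ (hM.vl (hv 1)) (Vl_lev hM (hv 1)).2 (sub_Vl hM (hv 1))

lemma dfRank {F G : (ℕ → ZFSet) → ZFSet} (hF : Dfn M F) (hG : Dfn M G) :
    Dfb M (fun v => (F v).rank < (G v).rank) :=
  (Dfb.mem hF (Dfn.vl hM hG)).congr fun v hv => by simp [mem_Vl, hF.1 v hv]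

lemma ZFM.coll (R : ZFSet → ZFSet → Prop) (hR : Dfb M (fun v => R (v 0) (v 1))) {a : ZFSet} (ha : a ∈ M) :
    ∃ b ∈ M, ∀ x ∈ a, (∃ y ∈ M, R x y) → ∃ y ∈ b, R x y := by
  have d1 : Dfb M (fun v => (fun x u => ∃ y, y ∈ M ∧ R x y ∧ (∀ y', y' ∈ M → R x y' → ¬ y'.rank < y.rank) ∧ u = Vl M y)
      (v 0) (v 1)) := by
    have e1 := Dfb.app2 hR (Dfn.var 1) (Dfn.var 0)
    have e2 := Dfb.app2 hR (Dfn.var 2) (Dfn.var 0)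
    have e3 := dfRank hM (Dfn.var 0) (Dfn.var 1)
    have e4 := Dfn.vl hM (Dfn.var 0)
    exact dfa
  have hr := hM.repl (fun x u => ∃ y, y ∈ M ∧ R x y ∧ (∀ y', y' ∈ M → R x y' → ¬ y'.rank < y.rank) ∧ u = Vl M y) d1 a ha
  obtain ⟨b, hb, H⟩ := hr (by
    rintro x - u - u' - ⟨y, hy, h1, h2, rfl⟩ ⟨y', hy', h1', h2', rfl⟩
    have h3 := not_lt.1 (h2 y' hy' h1')
    have h4 := not_lt.1 (h2' y hy h1)
    rw [Vl, Vl, le_antisymm h3 h4])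
  refine ⟨Vl M b, hM.vl hb, fun x hx ⟨y0, hy0, hxy0⟩ => ?_⟩
  obtain ⟨y, ⟨hy, hR'⟩, hmin⟩ := WellFounded.has_min (InvImage.wf ZFSet.rank Ordinal.lt_wf)
    {y | y ∈ M ∧ R x y} ⟨y0, hy0, hxy0⟩
  refine ⟨y, mem_Vl.2 ⟨hy, ?_⟩, hR'⟩
  rw [← rank_Vl hM hy]
  refine ZFSet.rank_lt_of_mem ((H _).2 ⟨hM.vl hy, x, hx, y, hy, hR', fun y' h h' => hmin y' ⟨h, h'⟩, rfl⟩)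

lemma ord_rank : ∀ x, x ∈ M → ∃ α ∈ M, IsOrd α ∧ α.rank = x.rank := by
  intro x
  induction x using ZFSet.inductionOn with
  | _ x ih =>
  intro hx
  have dO : Dfb M (fun v => IsOrd (v 0)) := by
    unfold IsOrd ZFSet.IsTransitive
    exact dfa
  refine ⟨ZFSet.sep IsOrd (Vl M x), hM.sep _ dO _ (hM.vl hx), ⟨?_, ?_⟩, ?_⟩
  · intro y hy z hz
    simp only [ZFSet.mem_sep, mem_Vl] at hy ⊢
    refine ⟨⟨hM.tr _ hy.1.1 hz, (ZFSet.rank_lt_of_mem hz).trans hy.1.2⟩, hy.2.2 z hz, fun t ht => hy.2.2 t (hy.2.1 _ hz ht)⟩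
  · intro y hy
    exact (ZFSet.mem_sep.1 hy).2.1
  · refine le_antisymm (ZFSet.rank_le_iff.2 fun z hz => (mem_Vl.1 (ZFSet.mem_sep.1 hz).1).2) (ZFSet.rank_le_iff.2 fun y hy => ?_)
    obtain ⟨α, hα, h1, h2⟩ := ih y hy (hM.tr _ hx hy)
    rw [← h2]
    refine ZFSet.rank_lt_of_mem (ZFSet.mem_sep.2 ⟨mem_Vl.2 ⟨hα, ?_⟩, h1⟩)
    rw [h2]; exact ZFSet.rank_lt_of_mem hy
end

lemma IsOrd.ord {x : ZFSet} (h : IsOrd x) : x.IsOrdinal :=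
  ZFSet.isOrdinal_iff_forall_mem_isTransitive.2 h


/-! ### Part 7: definability of recursions -/

lemma dfa2 {M : ZFSet} {R : (ℕ → ZFSet) → Prop} (h : Dfb M R := by
  repeat' first | assumption | exact Dfn.var _ | exact Dfn.const (by assumption) | apply Dfb.and | apply Dfb.or | apply Dfb.not | apply Dfb.allM | apply Dfb.exM | apply Dfb.zall | apply Dfb.zex | apply Dfb.imp | apply Dfb.iff | apply Dfb.eq | apply Dfb.mem | apply Dfb.zsub | apply dfRank | apply_assumption -exfalso -symm | apply Dfn.vl | apply Dfn.emp | apply Dfn.om | apply Dfn.sing | apply Dfn.upair | apply Dfn.op | apply Dfn.sU | apply Dfn.uni | apply Dfn.pw | apply Dfn.prod | apply Dfn.sep) :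
    Dfb M R := h

lemma dfn2 {M : ZFSet} {R : (ℕ → ZFSet) → ZFSet} (h : Dfn M R := by
  repeat' first | assumption | exact Dfn.var _ | exact Dfn.const (by assumption) | apply Dfb.and | apply Dfb.or | apply Dfb.not | apply Dfb.allM | apply Dfb.exM | apply Dfb.zall | apply Dfb.zex | apply Dfb.imp | apply Dfb.iff | apply Dfb.eq | apply Dfb.mem | apply Dfb.zsub | apply dfRank | apply_assumption -exfalso -symm | apply Dfn.vl | apply Dfn.emp | apply Dfn.om | apply Dfn.sing | apply Dfn.upair | apply Dfn.op | apply Dfn.sU | apply Dfn.uni | apply Dfn.pw | apply Dfn.prod | apply Dfn.sep) :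
    Dfn M R := h

noncomputable def gr (M : ZFSet) (F : ZFSet → ZFSet) (x : ZFSet) : ZFSet :=
  img (fun y => ZFSet.pair y (F y)) (Vl M x)

lemma mem_gr {M x q : ZFSet} {F : ZFSet → ZFSet} : q ∈ gr M F x ↔ ∃ y ∈ Vl M x, ZFSet.pair y (F y) = q := mem_img

def Good (M : ZFSet) (Φ : ZFSet → ZFSet → ZFSet) (f w : ZFSet) : Prop :=
  (∀ q, q ∈ f → ∃ y, y ∈ w ∧ ∃ z, z ∈ M ∧ q = ZFSet.pair y z) ∧
  ∀ y, y ∈ w → ∀ z, z ∈ M → (ZFSet.pair y z ∈ f ↔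
    z = Φ (ZFSet.sep (fun q => ∃ y', y' ∈ Vl M y ∧ ∃ z', z' ∈ M ∧ q = ZFSet.pair y' z') f) y)

section
variable {M : ZFSet} (hM : ZFM M) {F : ZFSet → ZFSet} {Φ : ZFSet → ZFSet → ZFSet}
  (hΦ : Dfn M (fun v => Φ (v 0) (v 1))) (hF : ∀ x ∈ M, F x = Φ (gr M F x) x)
include hM hΦ hF

lemma good_sep {f w y : ZFSet} (h : Good M Φ f w) (hw : ∀ y ∈ w, y ∈ M ∧ Vl M y ⊆ w) (hy : y ∈ w)
    (ih : ∀ y', y' ∈ Vl M y → F y' ∈ M ∧ ∀ z ∈ M, ZFSet.pair y' z ∈ f ↔ z = F y') :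
    ZFSet.sep (fun q => ∃ y', y' ∈ Vl M y ∧ ∃ z', z' ∈ M ∧ q = ZFSet.pair y' z') f = gr M F y := by
  ext q
  rw [mem_gr, ZFSet.mem_sep]
  constructor
  · rintro ⟨h1, y', hy', z', hz', rfl⟩
    exact ⟨y', hy', by rw [((ih y' hy').2 z' hz').1 h1]⟩
  · rintro ⟨y', hy', rfl⟩
    exact ⟨((ih y' hy').2 _ (ih y' hy').1).2 rfl, y', hy', _, (ih y' hy').1, rfl⟩

lemma good_val {f w : ZFSet} (h : Good M Φ f w) (hf : f ∈ M) (hw : ∀ y ∈ w, y ∈ M ∧ Vl M y ⊆ w) :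
    ∀ y, y ∈ w → F y ∈ M ∧ ∀ z ∈ M, ZFSet.pair y z ∈ f ↔ z = F y := by
  have : ∀ o : Ordinal, ∀ y, y.rank = o → y ∈ w → F y ∈ M ∧ ∀ z ∈ M, ZFSet.pair y z ∈ f ↔ z = F y := by
    intro o
    induction o using Ordinal.induction with
    | h o ih =>
    rintro y rfl hy
    have e := good_sep hM hΦ hF h hw hy (fun y' hy' =>
      ih _ (mem_Vl.1 hy').2 y' rfl ((hw y hy).2 hy'))
    have hs : gr M F y ∈ M := by
      rw [← e]
      have := (hw y hy).1
      exact hM.sep _ dfa2 _ hf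
    rw [hF y (hw y hy).1]
    refine ⟨hΦ.1 (fun i => match i with | 0 => gr M F y | _ => y) (fun i => ?_), fun z hz => ?_⟩
    · rcases i with _ | i
      exacts [hs, (hw y hy).1]
    · rw [h.2 y hy z hz, e]
  exact fun y => this _ y rfl

lemma Vl_closed {x : ZFSet} : ∀ y ∈ Vl M x, y ∈ M ∧ Vl M y ⊆ Vl M x := fun y hy =>
  ⟨(mem_Vl.1 hy).1, fun z hz => mem_Vl.2 ⟨(mem_Vl.1 hz).1, (mem_Vl.1 hz).2.trans (mem_Vl.1 hy).2⟩⟩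

lemma good_eq {f x : ZFSet} (h : Good M Φ f (Vl M x)) (hf : f ∈ M) : f = gr M F x := by
  have := good_val hM hΦ hF h hf (Vl_closed hM hΦ hF)
  ext q
  rw [mem_gr]
  constructor
  · intro hq
    obtain ⟨y, hy, z, hz, rfl⟩ := h.1 q hq
    exact ⟨y, hy, by rw [((this y hy).2 z hz).1 hq]⟩
  · rintro ⟨y, hy, rfl⟩
    exact ((this y hy).2 _ (this y hy).1).2 rfl

lemma Phi_mem {a b : ZFSet} (ha : a ∈ M) (hb : b ∈ M) : Φ a b ∈ M := by
  refine hΦ.1 (fun i => match i with | 0 => a | _ => b) (fun i => ?_)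
  rcases i with _ | i
  exacts [ha, hb]

lemma gr_good {x : ZFSet} (hx : ∀ y ∈ Vl M x, F y ∈ M) : Good M Φ (gr M F x) (Vl M x) := by
  constructor
  · intro q hq
    obtain ⟨y, hy, rfl⟩ := mem_gr.1 hq
    exact ⟨y, hy, _, hx y hy, rfl⟩
  · intro y hy z hz
    have : ZFSet.sep (fun q => ∃ y', y' ∈ Vl M y ∧ ∃ z', z' ∈ M ∧ q = ZFSet.pair y' z') (gr M F x) = gr M F y := by
      ext q
      rw [ZFSet.mem_sep, mem_gr, mem_gr]
      constructor
      · rintro ⟨⟨y1, -, rfl⟩, y2, h2, z2, -, h⟩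
        obtain ⟨rfl, -⟩ := ZFSet.pair_injective h
        exact ⟨_, h2, rfl⟩
      · rintro ⟨y', hy', rfl⟩
        have := (Vl_closed hM hΦ hF y hy).2 hy'
        exact ⟨⟨y', this, rfl⟩, y', hy', _, hx _ this, rfl⟩
    rw [this, ← hF y (mem_Vl.1 hy).1, mem_gr]
    constructor
    · rintro ⟨y', -, h⟩
      obtain ⟨rfl, rfl⟩ := ZFSet.pair_injective h
      rfl
    · rintro rfl; exact ⟨y, hy, rfl⟩

lemma gr_mem : ∀ x, x ∈ M → gr M F x ∈ M := by
  have dP : ∀ {F G}, Dfn M F → Dfn M G → Dfn M (fun v => Φ (F v) (G v)) := fun {F G} => Dfn.app2 hΦ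
  have : ∀ o : Ordinal, ∀ x, x.rank = o → x ∈ M → gr M F x ∈ M := by
    intro o
    induction o using Ordinal.induction with
    | h o ih =>
    rintro x rfl hx
    have d : Dfb M (fun v => (fun y q => ∃ f, f ∈ M ∧ Good M Φ f (Vl M y) ∧ q = ZFSet.pair y (Φ f y)) (v 0) (v 1)) := by
      unfold Good
      exact dfa2
    have hg : ∀ y ∈ Vl M x, gr M F y ∈ M := fun y hy => ih _ (mem_Vl.1 hy).2 y rfl (mem_Vl.1 hy).1
    have hFm : ∀ y ∈ Vl M x, F y ∈ M := fun y hy => by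
      rw [hF y (mem_Vl.1 hy).1]
      exact Phi_mem hM hΦ hF (hg y hy) (mem_Vl.1 hy).1
    have hr := hM.repl (fun y q => ∃ f, f ∈ M ∧ Good M Φ f (Vl M y) ∧ q = ZFSet.pair y (Φ f y)) d (Vl M x) (hM.vl hx)
    obtain ⟨b, hb, H⟩ := hr (by
      rintro y hy q - q' - ⟨f, hf, h1, rfl⟩ ⟨f', hf', h1', rfl⟩
      rw [good_eq hM hΦ hF h1 hf, good_eq hM hΦ hF h1' hf'])
    convert hb
    ext q
    rw [mem_gr, H]
    constructor
    · rintro ⟨y, hy, rfl⟩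
      refine ⟨hM.op (mem_Vl.1 hy).1 (hFm y hy), y, hy, _, hg y hy, gr_good hM hΦ hF fun z hz => hFm z ?_, ?_⟩
      · exact (Vl_closed hM hΦ hF y hy).2 hz
      · rw [← hF y (mem_Vl.1 hy).1]
    · rintro ⟨-, y, hy, f, hf, h1, rfl⟩
      refine ⟨y, hy, ?_⟩
      rw [good_eq hM hΦ hF h1 hf, ← hF y (mem_Vl.1 hy).1]
  exact fun x => this _ x rfl

lemma rec_mem {x : ZFSet} (hx : x ∈ M) : F x ∈ M := by
  rw [hF x hx]; exact Phi_mem hM hΦ hF (gr_mem hM hΦ hF x hx) hx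

lemma Dfn.recur : Dfn M (fun v => F (v 0)) := by
  have dP : ∀ {F G}, Dfn M F → Dfn M G → Dfn M (fun v => Φ (F v) (G v)) := fun {F G} => Dfn.app2 hΦ
  refine ⟨fun v hv => rec_mem hM hΦ hF (hv 0), ?_⟩
  have d : Dfb M (fun v => ∃ f, f ∈ M ∧ Good M Φ f (Vl M (v 1)) ∧ v 0 = Φ f (v 1)) := by
    unfold Good
    exact dfa2
  refine d.congr fun v hv => ?_
  have hg := gr_mem hM hΦ hF _ (hv 1)
  change v 0 = F (v 1) ↔ _
  rw [hF _ (hv 1)]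
  constructor
  · intro h
    exact ⟨_, hg, gr_good hM hΦ hF fun z hz => rec_mem hM hΦ hF (mem_Vl.1 hz).1, h⟩
  · rintro ⟨f, hf, h1, h⟩
    rw [h, good_eq hM hΦ hF h1 hf]

end

/-! ### Part 8: names, generic filters, the forcing theorem -/

lemma rank_op {x y s : ZFSet} (h : ZFSet.pair x y ∈ s) : x.rank < s.rank ∧ y.rank < s.rank := by
  have h1 : ({x, y} : ZFSet).rank < s.rank :=
    (ZFSet.rank_lt_of_mem (ZFSet.mem_pair.2 (Or.inr rfl))).trans (ZFSet.rank_lt_of_mem h)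
  exact ⟨(ZFSet.rank_lt_of_mem (ZFSet.mem_pair.2 (Or.inl rfl))).trans h1,
    (ZFSet.rank_lt_of_mem (ZFSet.mem_pair.2 (Or.inr rfl))).trans h1⟩

lemma op_sUU {x y s : ZFSet} (h : ZFSet.pair x y ∈ s) : x ∈ ZFSet.sUnion (ZFSet.sUnion s) :=
  ZFSet.mem_sUnion.2 ⟨{x, y}, ZFSet.mem_sUnion.2 ⟨_, h, ZFSet.mem_pair.2 (Or.inr rfl)⟩,
    ZFSet.mem_pair.2 (Or.inl rfl)⟩

lemma op_sUU' {x y s : ZFSet} (h : ZFSet.pair x y ∈ s) : y ∈ ZFSet.sUnion (ZFSet.sUnion s) :=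
  ZFSet.mem_sUnion.2 ⟨{x, y}, ZFSet.mem_sUnion.2 ⟨_, h, ZFSet.mem_pair.2 (Or.inr rfl)⟩,
    ZFSet.mem_pair.2 (Or.inr rfl)⟩

/-- `p` forces the equality of the names `σ` and `τ`. -/
def Eqv (P : ZFSet) (σ τ p : ZFSet) : Prop :=
  (∀ π s, ∀ _h : ZFSet.pair π s ∈ σ, ∀ q, q ∈ P → p ⊆ q → s ⊆ q →
    ∃ r, r ∈ P ∧ q ⊆ r ∧ ∃ ρ t, ZFSet.pair ρ t ∈ τ ∧ t ⊆ r ∧ Eqv P π ρ r) ∧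
  (∀ ρ t, ZFSet.pair ρ t ∈ τ → ∀ q, q ∈ P → p ⊆ q → t ⊆ q →
    ∃ r, r ∈ P ∧ q ⊆ r ∧ ∃ π s, ∃ _h : ZFSet.pair π s ∈ σ, s ⊆ r ∧ Eqv P π ρ r)
termination_by σ.rank
decreasing_by all_goals exact (rank_op _h).1

noncomputable def val (G : Set ZFSet) (τ : ZFSet) : ZFSet :=
  ZFSet.range (fun x : {y // y ∈ ZFSet.sep (fun y => ∃ p, (∃ r ∈ G, p ⊆ r) ∧ ZFSet.pair y p ∈ τ)
    (ZFSet.sUnion (ZFSet.sUnion τ))} => val G x.1)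
termination_by τ.rank
decreasing_by
  obtain ⟨-, p, -, h⟩ := ZFSet.mem_sep.1 x.2
  exact (rank_op h).1

lemma mem_val {G : Set ZFSet} {τ y : ZFSet} :
    y ∈ val G τ ↔ ∃ σ p, (∃ r ∈ G, p ⊆ r) ∧ ZFSet.pair σ p ∈ τ ∧ val G σ = y := by
  rw [val]
  simp only [ZFSet.mem_range, Set.mem_range, Subtype.exists, ZFSet.mem_sep]
  constructor
  · rintro ⟨σ, ⟨-, p, hp, h⟩, rfl⟩; exact ⟨σ, p, hp, h, rfl⟩
  · rintro ⟨σ, p, hp, h, rfl⟩; exact ⟨σ, ⟨op_sUU h, p, hp, h⟩, rfl⟩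

structure Gen (M P : ZFSet) (G : Set ZFSet) : Prop where
  sub : ∀ p ∈ G, p ∈ P
  up : ∀ p ∈ G, ∀ q ∈ P, q ⊆ p → q ∈ G
  dir : ∀ p ∈ G, ∀ q ∈ G, ∃ r ∈ G, p ⊆ r ∧ q ⊆ r
  meet : ∀ D ∈ M, (∀ p ∈ P, ∃ q ∈ D, q ∈ P ∧ p ⊆ q) → ∃ p ∈ G, p ∈ D

lemma Eqv.mono {P σ τ p q : ZFSet} (h : Eqv P σ τ p) (hpq : p ⊆ q) : Eqv P σ τ q := by
  rw [Eqv] at h ⊢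
  exact ⟨fun π s hs r hr hqr => h.1 π s hs r hr (fun _ hx => hqr (hpq hx)),
    fun π s hs r hr hqr => h.2 π s hs r hr (fun _ hx => hqr (hpq hx))⟩

lemma Eqv.stable {P σ τ p : ZFSet} (h : ∀ q, q ∈ P → p ⊆ q → ∃ r, r ∈ P ∧ q ⊆ r ∧ Eqv P σ τ r) : Eqv P σ τ p := by
  rw [Eqv]
  constructor
  · intro π s hs q hq hpq hsq
    obtain ⟨r, hr, hqr, hE⟩ := h q hq hpq
    rw [Eqv] at hE
    obtain ⟨r', h1, h2, h3⟩ := hE.1 π s hs r hr (fun _ h => h) (fun _ h => hqr (hsq h))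
    exact ⟨r', h1, fun _ h => h2 (hqr h), h3⟩
  · intro π s hs q hq hpq hsq
    obtain ⟨r, hr, hqr, hE⟩ := h q hq hpq
    rw [Eqv] at hE
    obtain ⟨r', h1, h2, h3⟩ := hE.2 π s hs r hr (fun _ h => h) (fun _ h => hqr (hsq h))
    exact ⟨r', h1, fun _ h => h2 (hqr h), h3⟩

section
variable {M P : ZFSet} (hM : ZFM M) (hP : P ∈ M)
include hM hP

lemma ZFM.opm {x y s : ZFSet} (hs : s ∈ M) (h : ZFSet.pair x y ∈ s) : x ∈ M ∧ y ∈ M :=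
  hM.op' (hM.tr _ hs h)

lemma Eqv_iff {σ τ p : ZFSet} (hσ : σ ∈ M) (hτ : τ ∈ M) : Eqv P σ τ p ↔
  (∀ π, π ∈ M → ∀ s, s ∈ M → ZFSet.pair π s ∈ σ → ∀ q, q ∈ P → p ⊆ q → s ⊆ q →
    ∃ r, r ∈ P ∧ q ⊆ r ∧ ∃ ρ, ρ ∈ M ∧ ∃ t, t ∈ M ∧ ZFSet.pair ρ t ∈ τ ∧ t ⊆ r ∧ Eqv P π ρ r) ∧
  (∀ ρ, ρ ∈ M → ∀ t, t ∈ M → ZFSet.pair ρ t ∈ τ → ∀ q, q ∈ P → p ⊆ q → t ⊆ q →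
    ∃ r, r ∈ P ∧ q ⊆ r ∧ ∃ π, π ∈ M ∧ ∃ s, s ∈ M ∧ ZFSet.pair π s ∈ σ ∧ s ⊆ r ∧ Eqv P π ρ r) := by
  rw [Eqv]
  constructor
  · rintro ⟨h1, h2⟩
    constructor
    · intro π _ s _ hs q hq hpq hsq
      obtain ⟨r, hr, hqr, ρ, t, ht, h⟩ := h1 π s hs q hq hpq hsq
      exact ⟨r, hr, hqr, ρ, (hM.opm hP hτ ht).1, t, (hM.opm hP hτ ht).2, ht, h⟩
    · intro π _ s _ hs q hq hpq hsq
      obtain ⟨r, hr, hqr, ρ, t, ht, h⟩ := h2 π s hs q hq hpq hsq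
      exact ⟨r, hr, hqr, ρ, (hM.opm hP hσ ht).1, t, (hM.opm hP hσ ht).2, ht, h⟩
  · rintro ⟨h1, h2⟩
    constructor
    · intro π s hs q hq hpq hsq
      obtain ⟨r, hr, hqr, ρ, _, t, _, ht, h⟩ := h1 π (hM.opm hP hσ hs).1 s (hM.opm hP hσ hs).2 hs q hq hpq hsq
      exact ⟨r, hr, hqr, ρ, t, ht, h⟩
    · intro π s hs q hq hpq hsq
      obtain ⟨r, hr, hqr, ρ, _, t, _, ht, h⟩ := h2 π (hM.opm hP hτ hs).1 s (hM.opm hP hτ hs).2 hs q hq hpq hsq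
      exact ⟨r, hr, hqr, ρ, t, ht, h⟩

lemma dfEqv0 : Dfb M (fun v => v 2 ∈ P ∧ Eqv P (v 0) (v 1) (v 2)) := by
  let F : ZFSet → ZFSet := fun x => ZFSet.sep
    (fun z => ∃ p, p ∈ P ∧ ∃ σ, σ ∈ M ∧ ∃ τ, τ ∈ M ∧ z = ZFSet.pair p (ZFSet.pair σ τ) ∧ Eqv P σ τ p)
    (ZFSet.prod P (ZFSet.prod (Vl M x) (Vl M x)))
  have memF : ∀ x p σ τ, ZFSet.pair p (ZFSet.pair σ τ) ∈ F x ↔ p ∈ P ∧ σ ∈ Vl M x ∧ τ ∈ Vl M x ∧ Eqv P σ τ p := by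
    intro x p σ τ
    rw [ZFSet.mem_sep, ZFSet.pair_mem_prod, ZFSet.pair_mem_prod]
    constructor
    · rintro ⟨⟨h1, h2, h3⟩, p', _, σ', _, τ', _, e, h⟩
      obtain ⟨rfl, e2⟩ := ZFSet.pair_inj.1 e
      obtain ⟨rfl, rfl⟩ := ZFSet.pair_inj.1 e2
      exact ⟨h1, h2, h3, h⟩
    · rintro ⟨h1, h2, h3, h⟩
      exact ⟨⟨h1, h2, h3⟩, p, h1, σ, (mem_Vl.1 h2).1, τ, (mem_Vl.1 h3).1, rfl, h⟩
  let Q : ZFSet → ZFSet → ZFSet → ZFSet → ZFSet → ZFSet → Prop := fun f σ τ π ρ r =>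
    ∃ z, z ∈ ZFSet.sUnion (ZFSet.sUnion f) ∧ ZFSet.pair (σ ∪ τ) z ∈ f ∧ ZFSet.pair r (ZFSet.pair π ρ) ∈ z
  let Φ : ZFSet → ZFSet → ZFSet := fun f x => ZFSet.sep
    (fun z => ∃ p, p ∈ P ∧ ∃ σ, σ ∈ M ∧ ∃ τ, τ ∈ M ∧ z = ZFSet.pair p (ZFSet.pair σ τ) ∧
  (∀ π, π ∈ M → ∀ s, s ∈ M → ZFSet.pair π s ∈ σ → ∀ q, q ∈ P → p ⊆ q → s ⊆ q →
    ∃ r, r ∈ P ∧ q ⊆ r ∧ ∃ ρ, ρ ∈ M ∧ ∃ t, t ∈ M ∧ ZFSet.pair ρ t ∈ τ ∧ t ⊆ r ∧ Q f σ τ π ρ r) ∧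
  (∀ ρ, ρ ∈ M → ∀ t, t ∈ M → ZFSet.pair ρ t ∈ τ → ∀ q, q ∈ P → p ⊆ q → t ⊆ q →
    ∃ r, r ∈ P ∧ q ⊆ r ∧ ∃ π, π ∈ M ∧ ∃ s, s ∈ M ∧ ZFSet.pair π s ∈ σ ∧ s ⊆ r ∧ Q f σ τ π ρ r))
    (ZFSet.prod P (ZFSet.prod (Vl M x) (Vl M x)))
  have hΦ : Dfn M (fun v => Φ (v 0) (v 1)) := by
    dsimp only [Φ, Q]
    exact dfn2
  have hF : ∀ x ∈ M, F x = Φ (gr M F x) x := by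
    intro x hx
    ext z
    refine (ZFSet.mem_sep.trans ?_).trans (ZFSet.mem_sep (x := ZFSet.prod P (ZFSet.prod (Vl M x) (Vl M x)))).symm
    refine and_congr_right fun hz => exists_congr fun p => and_congr_right fun hp => exists_congr fun σ =>
      and_congr_right fun hσ => exists_congr fun τ => and_congr_right fun hτ => and_congr_right fun hz' => ?_
    subst hz'
    rw [ZFSet.pair_mem_prod, ZFSet.pair_mem_prod] at hz
    have hu : σ ∪ τ ∈ Vl M x := by
      refine mem_Vl.2 ⟨hM.uni hσ hτ, ?_⟩
      rw [ZFSet.rank_union]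
      exact max_lt (mem_Vl.1 hz.2.1).2 (mem_Vl.1 hz.2.2).2
    have key : ∀ π s ρ t r, ZFSet.pair π s ∈ σ → ZFSet.pair ρ t ∈ τ → r ∈ P →
        (Q (gr M F x) σ τ π ρ r ↔ Eqv P π ρ r) := by
      intro π s ρ t r h1 h2 hr
      have h3 : ZFSet.pair r (ZFSet.pair π ρ) ∈ F (σ ∪ τ) ↔ Eqv P π ρ r := by
        rw [memF]
        have a1 : π ∈ Vl M (σ ∪ τ) := mem_Vl.2 ⟨(hM.opm hP hσ h1).1, by
          rw [ZFSet.rank_union]; exact lt_max_of_lt_left (rank_op h1).1⟩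
        have a2 : ρ ∈ Vl M (σ ∪ τ) := mem_Vl.2 ⟨(hM.opm hP hτ h2).1, by
          rw [ZFSet.rank_union]; exact lt_max_of_lt_right (rank_op h2).1⟩
        simp [a1, a2, hr]
      rw [← h3]
      constructor
      · rintro ⟨z, _, h4, h5⟩
        obtain ⟨y, _, e⟩ := mem_gr.1 h4
        obtain ⟨rfl, rfl⟩ := ZFSet.pair_inj.1 e
        exact h5
      · intro h
        have hg : ZFSet.pair (σ ∪ τ) (F (σ ∪ τ)) ∈ gr M F x := mem_gr.2 ⟨_, hu, rfl⟩
        exact ⟨F (σ ∪ τ), op_sUU' hg, hg, h⟩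
    rw [Eqv_iff hM hP hσ hτ]
    refine and_congr ?_ ?_
    · refine forall_congr' fun π => forall_congr' fun _ => forall_congr' fun s => forall_congr' fun _ => forall_congr' fun h1 =>
        forall_congr' fun q => forall_congr' fun _ => forall_congr' fun _ => forall_congr' fun _ => exists_congr fun r =>
        and_congr_right fun hr => and_congr_right fun _ => exists_congr fun ρ => and_congr_right fun _ => exists_congr fun t =>
        and_congr_right fun _ => and_congr_right fun h2 => and_congr_right fun _ => ?_
      exact (key π s ρ t r h1 h2 hr).symm
    · refine forall_congr' fun ρ => forall_congr' fun _ => forall_congr' fun t => forall_congr' fun _ => forall_congr' fun h2 =>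
        forall_congr' fun q => forall_congr' fun _ => forall_congr' fun _ => forall_congr' fun _ => exists_congr fun r =>
        and_congr_right fun hr => and_congr_right fun _ => exists_congr fun π => and_congr_right fun _ => exists_congr fun s =>
        and_congr_right fun _ => and_congr_right fun h1 => and_congr_right fun _ => ?_
      exact (key π s ρ t r h1 h2 hr).symm
  have dF : ∀ {G}, Dfn M G → Dfn M (fun v => F (G v)) := fun {G} => Dfn.app1 (Dfn.recur hM hΦ hF)
  have : Dfb M (fun v => ZFSet.pair (v 2) (ZFSet.pair (v 0) (v 1)) ∈ F {v 0, v 1}) := by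
    exact dfa2
  refine this.congr fun v hv => ?_
  rw [memF]
  have a1 : v 0 ∈ Vl M {v 0, v 1} := mem_Vl.2 ⟨hv 0, ZFSet.rank_lt_of_mem (ZFSet.mem_pair.2 (Or.inl rfl))⟩
  have a2 : v 1 ∈ Vl M {v 0, v 1} := mem_Vl.2 ⟨hv 1, ZFSet.rank_lt_of_mem (ZFSet.mem_pair.2 (Or.inr rfl))⟩
  simp [a1, a2]

end

section
variable {M P : ZFSet} (hM : ZFM M) (hP : P ∈ M)
include hM hP

lemma Gen.ne {G : Set ZFSet} (hG : Gen M P G) : ∃ p, p ∈ G :=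
  (hG.meet P hP (fun p hp => ⟨p, hp, hp, fun _ h => h⟩)).imp fun _ h => h.1

lemma Gen.below {G : Set ZFSet} (hG : Gen M P G) (A : ZFSet → Prop) (hA : Dfb M (fun v => A (v 0)))
    {p : ZFSet} (hp : p ∈ G) (h : ∀ q, q ∈ P → p ⊆ q → ∃ r, r ∈ P ∧ q ⊆ r ∧ A r) : ∃ r ∈ G, A r := by
  have hpM := hM.tr _ hP (hG.sub p hp)
  obtain ⟨r, hr, hrD⟩ := hG.meet (ZFSet.sep (fun r => A r ∨ ¬ ∃ q, q ∈ P ∧ p ⊆ q ∧ r ⊆ q) P)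
    (hM.sep _ dfa2 _ hP) (by
      intro q hq
      by_cases hc : ∃ q', q' ∈ P ∧ p ⊆ q' ∧ q ⊆ q'
      · obtain ⟨q', h1, h2, h3⟩ := hc
        obtain ⟨r, hr, h4, h5⟩ := h q' h1 h2
        exact ⟨r, ZFSet.mem_sep.2 ⟨hr, Or.inl h5⟩, hr, fun _ hx => h4 (h3 hx)⟩
      · exact ⟨q, ZFSet.mem_sep.2 ⟨hq, Or.inr hc⟩, hq, fun _ hx => hx⟩)
  rcases (ZFSet.mem_sep.1 hrD).2 with h1 | h1
  · exact ⟨r, hr, h1⟩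
  · obtain ⟨q, hq, h2, h3⟩ := hG.dir p hp r hr
    exact absurd ⟨q, hG.sub q hq, h2, h3⟩ h1

lemma Gen.dense {G : Set ZFSet} (hG : Gen M P G) (A : ZFSet → Prop) (hA : Dfb M (fun v => A (v 0)))
    (h : ∀ q, q ∈ P → ∃ r, r ∈ P ∧ q ⊆ r ∧ A r) : ∃ r ∈ G, A r := by
  obtain ⟨p, hp⟩ := hG.ne hM hP
  exact hG.below hM hP A hA hp fun q hq _ => h q hq

lemma dfEqv {F G H : (ℕ → ZFSet) → ZFSet} (hF : Dfn M F) (hG : Dfn M G) (hH : Dfn M H) :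
    Dfb M (fun v => H v ∈ P ∧ Eqv P (F v) (G v) (H v)) :=
  Dfb.app3 (R := fun x y z => z ∈ P ∧ Eqv P x y z) (dfEqv0 hM hP) hF hG hH

lemma eqv_truth {G : Set ZFSet} (hG : Gen M P G) : ∀ o : Ordinal, ∀ σ, σ.rank = o → σ ∈ M → ∀ τ ∈ M,
    (val G σ = val G τ ↔ ∃ p ∈ G, Eqv P σ τ p) := by
  intro o
  induction o using Ordinal.induction with
  | h o ih =>
  rintro σ rfl hσ τ hτ
  have ih' : ∀ π s, ZFSet.pair π s ∈ σ → ∀ ρ t, ZFSet.pair ρ t ∈ τ →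
      (val G π = val G ρ ↔ ∃ p ∈ G, Eqv P π ρ p) := fun π s h ρ t h' =>
    ih _ (rank_op h).1 π rfl (hM.opm hP hσ h).1 ρ (hM.opm hP hτ h').1
  have dE := @dfEqv M P hM hP
  constructor
  · intro hv
    let A : ZFSet → Prop := fun p => (p ∈ P ∧ Eqv P σ τ p) ∨
      (∃ π, π ∈ M ∧ ∃ s, s ∈ M ∧ ZFSet.pair π s ∈ σ ∧ s ⊆ p ∧ ∀ r, r ∈ P → p ⊆ r → ∀ ρ, ρ ∈ M → ∀ t, t ∈ M →
        ZFSet.pair ρ t ∈ τ → t ⊆ r → ¬ (r ∈ P ∧ Eqv P π ρ r)) ∨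
      (∃ ρ, ρ ∈ M ∧ ∃ t, t ∈ M ∧ ZFSet.pair ρ t ∈ τ ∧ t ⊆ p ∧ ∀ r, r ∈ P → p ⊆ r → ∀ π, π ∈ M → ∀ s, s ∈ M →
        ZFSet.pair π s ∈ σ → s ⊆ r → ¬ (r ∈ P ∧ Eqv P π ρ r))
    have dA : Dfb M (fun v => A (v 0)) := by
      have e1 := dE (.const hσ) (.const hτ) (.var 0)
      have e2 := dE (.var 4) (.var 1) (.var 2)
      have e3 := dE (.var 1) (.var 4) (.var 2)
      exact dfa2
    obtain ⟨p, hp, h⟩ := hG.dense hM hP A dA (by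
      intro p hp
      by_cases h : Eqv P σ τ p
      · exact ⟨p, hp, fun _ h => h, Or.inl ⟨hp, h⟩⟩
      rw [Eqv_iff hM hP hσ hτ, not_and_or] at h
      rcases h with h | h
      · push Not at h
        obtain ⟨π, hπ, s, hs, h1, q, hq, hpq, hsq, h⟩ := h
        refine ⟨q, hq, hpq, Or.inr (Or.inl ⟨π, hπ, s, hs, h1, hsq, ?_⟩)⟩
        intro r hr hqr ρ hρ t ht h2 htr h3
        exact h r hr hqr ρ hρ t ht h2 htr h3.2
      · push Not at h
        obtain ⟨π, hπ, s, hs, h1, q, hq, hpq, hsq, h⟩ := h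
        refine ⟨q, hq, hpq, Or.inr (Or.inr ⟨π, hπ, s, hs, h1, hsq, ?_⟩)⟩
        intro r hr hqr ρ hρ t ht h2 htr h3
        exact h r hr hqr ρ hρ t ht h2 htr h3.2)
    rcases h with h | ⟨π, hπ, s, hs, h1, h2, h3⟩ | ⟨ρ, hρ, t, ht, h1, h2, h3⟩
    · exact ⟨p, hp, h.2⟩
    · exfalso
      have : val G π ∈ val G τ := by
        rw [← hv]; exact mem_val.2 ⟨π, s, ⟨p, hp, h2⟩, h1, rfl⟩
      obtain ⟨ρ, t, ⟨t', ht', ht⟩, h4, h5⟩ := mem_val.1 this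
      obtain ⟨r, hr, h6⟩ := (ih' π s h1 ρ t h4).1 h5.symm
      obtain ⟨r', hr', h7, h8⟩ := hG.dir p hp r hr
      obtain ⟨r2, hr2, h9, h10⟩ := hG.dir r' hr' t' ht'
      exact h3 r2 (hG.sub _ hr2) (h7.trans h9) ρ (hM.opm hP hτ h4).1 t (hM.opm hP hτ h4).2 h4 (ht.trans h10)
        ⟨hG.sub _ hr2, h6.mono (h8.trans h9)⟩
    · exfalso
      have : val G ρ ∈ val G σ := by
        rw [hv]; exact mem_val.2 ⟨ρ, t, ⟨p, hp, h2⟩, h1, rfl⟩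
      obtain ⟨π, s, ⟨t', ht', ht⟩, h4, h5⟩ := mem_val.1 this
      obtain ⟨r, hr, h6⟩ := (ih' π s h4 ρ t h1).1 h5
      obtain ⟨r', hr', h7, h8⟩ := hG.dir p hp r hr
      obtain ⟨r2, hr2, h9, h10⟩ := hG.dir r' hr' t' ht'
      exact h3 r2 (hG.sub _ hr2) (h7.trans h9) π (hM.opm hP hσ h4).1 s (hM.opm hP hσ h4).2 h4 (ht.trans h10)
        ⟨hG.sub _ hr2, h6.mono (h8.trans h9)⟩
  · rintro ⟨p, hp, hE⟩
    have hE' := (Eqv_iff hM hP hσ hτ).1 hE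
    ext y
    rw [mem_val, mem_val]
    constructor
    · rintro ⟨π, s, ⟨p', hp', hs⟩, h1, rfl⟩
      obtain ⟨p2, hp2, h2, h3⟩ := hG.dir p hp p' hp'
      obtain ⟨hπM, hsM⟩ := hM.opm hP hσ h1
      obtain ⟨r, hr, ρ, hρ, t, ht, h4, h5, h6⟩ := hG.below hM hP (fun r => ∃ ρ, ρ ∈ M ∧ ∃ t, t ∈ M ∧ ZFSet.pair ρ t ∈ τ ∧ t ⊆ r ∧
        (r ∈ P ∧ Eqv P π ρ r)) (by
          have e1 := dE (.const hπM) (.var 1) (.var 2)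
          exact dfa2) hp2 (by
          intro q hq hpq
          obtain ⟨r, hr, hqr, ρ, hρ, t, ht, h4, h5, h6⟩ := hE'.1 π hπM s hsM h1 q hq (h2.trans hpq) (hs.trans (h3.trans hpq))
          exact ⟨r, hr, hqr, ρ, hρ, t, ht, h4, h5, hr, h6⟩)
      exact ⟨ρ, t, ⟨r, hr, h5⟩, h4, ((ih' π s h1 ρ t h4).2 ⟨r, hr, h6.2⟩).symm⟩
    · rintro ⟨ρ, t, ⟨p', hp', hs⟩, h1, rfl⟩
      obtain ⟨p2, hp2, h2, h3⟩ := hG.dir p hp p' hp'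
      obtain ⟨hρM, htM⟩ := hM.opm hP hτ h1
      obtain ⟨r, hr, π, hπ, s, hs, h4, h5, h6⟩ := hG.below hM hP (fun r => ∃ π, π ∈ M ∧ ∃ s, s ∈ M ∧ ZFSet.pair π s ∈ σ ∧ s ⊆ r ∧
        (r ∈ P ∧ Eqv P π ρ r)) (by
          have e1 := dE (.var 1) (.const hρM) (.var 2)
          exact dfa2) hp2 (by
          intro q hq hpq
          obtain ⟨r, hr, hqr, π, hπ, s, hs', h4, h5, h6⟩ := hE'.2 ρ hρM t htM h1 q hq (h2.trans hpq) (hs.trans (h3.trans hpq))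
          exact ⟨r, hr, hqr, π, hπ, s, hs', h4, h5, hr, h6⟩)
      exact ⟨π, s, ⟨r, hr, h5⟩, h4, (ih' π s h4 ρ t h1).2 ⟨r, hr, h6.2⟩⟩

end

/-- A forcing relation for a formula. -/
structure FOK (M P : ZFSet) {n : ℕ} (φ : BF n) (F : (Fin n → ZFSet) → ZFSet → Prop) : Prop where
  inP : ∀ τ p, F τ p → p ∈ P
  mono : ∀ τ p q, F τ p → q ∈ P → p ⊆ q → F τ q
  stab : ∀ τ p, p ∈ P → (∀ q, q ∈ P → p ⊆ q → ∃ r, r ∈ P ∧ q ⊆ r ∧ F τ r) → F τ p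
  df : ∀ (ι : Fin n → ℕ) k, Dfb M (fun v => F (fun i => v (ι i)) (v k))
  truth : ∀ G, Gen M P G → ∀ τ, (∀ i, τ i ∈ M) → ∀ w : Fin n → Vs (img (val G) M),
    (∀ i, (w i).1 = val G (τ i)) → (Rl φ w ↔ ∃ p ∈ G, F τ p)

/-- forcing a membership statement -/
def Mf (P σ τ p : ZFSet) : Prop := p ∈ P ∧ ∀ q, q ∈ P → p ⊆ q → ∃ r, r ∈ P ∧ q ⊆ r ∧
  ∃ ρ, ρ ∈ ZFSet.sUnion (ZFSet.sUnion τ) ∧ ∃ t, t ∈ ZFSet.sUnion (ZFSet.sUnion τ) ∧ ZFSet.pair ρ t ∈ τ ∧ t ⊆ r ∧ (r ∈ P ∧ Eqv P σ ρ r)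

section
variable {M P : ZFSet} (hM : ZFM M) (hP : P ∈ M)
include hM hP

lemma dfMf (i j k : ℕ) : Dfb M (fun v => Mf P (v i) (v j) (v k)) := by
  unfold Mf
  have e1 := @dfEqv M P hM hP _ _ _ (.var (i+4)) (.var 1) (.var 2)
  exact dfa2

lemma FOK.dfτ {n : ℕ} {φ : BF n} {F : (Fin n → ZFSet) → ZFSet → Prop} (h : FOK M P φ F) {τ : Fin n → ZFSet}
    (hτ : ∀ i, τ i ∈ M) : Dfb M (fun v => F τ (v 0)) := by
  have := Dfb.inst0 (R := fun v x => F (fun i : Fin n => v i) x) (h.df (fun i => i + 1) 0)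
    (v := fun j => if h : j < n then τ ⟨j, h⟩ else ∅) (fun j => by
      split_ifs
      exacts [hτ _, hM.emp])
  simpa using this

lemma mf_truth {G : Set ZFSet} (hG : Gen M P G) {σ τ : ZFSet} (hσ : σ ∈ M) (hτ : τ ∈ M) :
    val G σ ∈ val G τ ↔ ∃ p ∈ G, Mf P σ τ p := by
  have dE := @dfEqv M P hM hP
  have tr : ∀ ρ ∈ M, (val G σ = val G ρ ↔ ∃ p ∈ G, Eqv P σ ρ p) := fun ρ hρ => eqv_truth hM hP hG _ σ rfl hσ ρ hρ
  constructor
  · intro h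
    obtain ⟨ρ, t, ⟨t', ht', ht⟩, h4, h5⟩ := mem_val.1 h
    obtain ⟨p, hp, hE⟩ := (tr ρ (hM.opm hP hτ h4).1).1 h5.symm
    obtain ⟨r, hr, h1, h2⟩ := hG.dir p hp t' ht'
    refine ⟨r, hr, hG.sub r hr, fun q hq hrq => ⟨q, hq, fun _ h => h, ρ, op_sUU h4, t, op_sUU' h4, h4, ht.trans (h2.trans hrq), hq,
      hE.mono (h1.trans hrq)⟩⟩
  · rintro ⟨p, hp, -, h⟩
    obtain ⟨r, hr, ρ, _, t, _, h1, h2, h3⟩ := hG.below hM hP (fun r => ∃ ρ, ρ ∈ ZFSet.sUnion (ZFSet.sUnion τ) ∧ ∃ t, t ∈ ZFSet.sUnion (ZFSet.sUnion τ) ∧ ZFSet.pair ρ t ∈ τ ∧ t ⊆ r ∧ (r ∈ P ∧ Eqv P σ ρ r)) (by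
      have e1 := dE (.const hσ) (.var 1) (.var 2)
      exact dfa2) hp h
    rw [(tr ρ (hM.opm hP hτ h1).1).2 ⟨r, hr, h3.2⟩]
    exact mem_val.2 ⟨ρ, t, ⟨r, hr, h2⟩, h1, rfl⟩

/-- **The forcing theorem.** -/
lemma forcing {n : ℕ} (φ : BF n) : ∃ F, FOK M P φ F := by
  have tm : ∀ {n} (t : SetLang.Term (Empty ⊕ Fin n)), ∃ i, t = Term.var (Sum.inr i) := by
    intro n t
    rcases t with (e | i) | f
    · exact e.elim
    · exact ⟨i, rfl⟩
    · exact Empty.elim (by assumption)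
  induction φ with
  | falsum =>
    refine ⟨fun _ _ => False, ⟨fun _ _ h => h.elim, fun _ _ _ h => h.elim, fun τ p hp h => ?_, fun _ _ => Dfb.false, fun G hG τ hτ w hw => ?_⟩⟩
    · obtain ⟨_, _, _, h⟩ := h p hp (fun _ h => h)
      exact h
    · exact ⟨fun h => h.elim, fun ⟨_, _, h⟩ => h.elim⟩
  | equal t₁ t₂ =>
    obtain ⟨i, rfl⟩ := tm t₁
    obtain ⟨j, rfl⟩ := tm t₂
    refine ⟨fun τ p => p ∈ P ∧ Eqv P (τ i) (τ j) p, ⟨fun _ _ h => h.1, fun _ _ _ h hq hpq => ⟨hq, h.2.mono hpq⟩, fun τ p hp h => ⟨hp, ?_⟩, fun ι k => dfEqv hM hP (.var _) (.var _) (.var _), fun G hG τ hτ w hw => ?_⟩⟩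
    · refine Eqv.stable fun q hq hpq => ?_
      obtain ⟨r, h1, h2, h3⟩ := h q hq hpq
      exact ⟨r, h1, h2, h3.2⟩
    · refine (Rl_eqf i j w).trans ?_
      rw [hw, hw, eqv_truth hM hP hG _ _ rfl (hτ i) _ (hτ j)]
      exact exists_congr fun p => and_congr_right fun hp => ⟨fun h => ⟨hG.sub p hp, h⟩, fun h => h.2⟩
  | rel R ts =>
    cases R
    obtain ⟨i, hi⟩ := tm (ts 0)
    obtain ⟨j, hj⟩ := tm (ts 1)
    have hts : ts = ![Term.var (Sum.inr i), Term.var (Sum.inr j)] := by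
      funext x; fin_cases x
      exacts [hi, hj]
    subst hts
    refine ⟨fun τ p => Mf P (τ i) (τ j) p, ⟨fun _ _ h => h.1, fun _ _ _ h hq hpq => ⟨hq, fun r hr hqr => h.2 r hr (hpq.trans hqr)⟩, fun τ p hp h => ⟨hp, fun q hq hpq => ?_⟩, fun ι k => dfMf hM hP _ _ _, fun G hG τ hτ w hw => ?_⟩⟩
    · obtain ⟨r, h1, h2, h3⟩ := h q hq hpq
      obtain ⟨r', h4, h5, h6⟩ := h3.2 r h1 (fun _ h => h)
      exact ⟨r', h4, h2.trans h5, h6⟩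
    · refine (Rl_memf i j w).trans ?_
      rw [hw, hw, mf_truth hM hP hG (hτ i) (hτ j)]
  | imp φ ψ ih1 ih2 =>
    obtain ⟨F1, h1⟩ := ih1
    obtain ⟨F2, h2⟩ := ih2
    refine ⟨fun τ p => p ∈ P ∧ ∀ q, q ∈ P → p ⊆ q → F1 τ q → F2 τ q, ⟨fun _ _ h => h.1, fun _ _ _ h hq hpq => ⟨hq, fun r hr hqr => h.2 r hr (hpq.trans hqr)⟩, fun τ p hp h => ⟨hp, fun q hq hpq hF => ?_⟩, fun ι k => ?_, fun G hG τ hτ w hw => ?_⟩⟩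
    · refine h2.stab τ q hq fun q' hq' hqq' => ?_
      obtain ⟨r, h3, h4, h5⟩ := h q' hq' (hpq.trans hqq')
      exact ⟨r, h3, h4, h5.2 r h3 (fun _ h => h) (h1.mono τ q r hF h3 (hqq'.trans h4))⟩
    · have e1 := h1.df (fun i => ι i + 1) 0
      have e2 := h2.df (fun i => ι i + 1) 0
      exact dfa2
    · refine (Rl_imp φ ψ w).trans ?_
      rw [h1.truth G hG τ hτ w hw, h2.truth G hG τ hτ w hw]
      constructor
      · intro h
        have e1 := h1.dfτ hM hP hτ
        have e2 := h2.dfτ hM hP hτ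
        obtain ⟨r, hr, h3⟩ := hG.dense hM hP (fun p => (∀ q, q ∈ P → p ⊆ q → F1 τ q → F2 τ q) ∨ (F1 τ p ∧ ∀ r, r ∈ P → p ⊆ r → ¬ F2 τ r)) (by
          have e3 := Dfb.app1 e1 (.var 0)
          have e4 := Dfb.app1 e2 (.var 0)
          exact dfa2) (by
          intro q hq
          by_cases hc : ∀ q', q' ∈ P → q ⊆ q' → F1 τ q' → F2 τ q'
          · exact ⟨q, hq, fun _ h => h, Or.inl hc⟩
          · push Not at hc
            obtain ⟨q', hq', hqq', h3, h4⟩ := hc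
            have h5 := mt (h2.stab τ q' hq') h4
            push Not at h5
            obtain ⟨r, hr, h6, h7⟩ := h5
            exact ⟨r, hr, hqq'.trans h6, Or.inr ⟨h1.mono _ _ _ h3 hr h6, h7⟩⟩)
        rcases h3 with h3 | ⟨h3, h4⟩
        · exact ⟨r, hr, hG.sub r hr, h3⟩
        · obtain ⟨p, hp, h5⟩ := h ⟨r, hr, h3⟩
          obtain ⟨r', hr', h6, h7⟩ := hG.dir p hp r hr
          exact absurd (h2.mono _ _ _ h5 (hG.sub _ hr') h6) (h4 r' (hG.sub _ hr') h7)
      · rintro ⟨p, hp, hpP, h⟩ ⟨q, hq, h'⟩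
        obtain ⟨r', hr', h6, h7⟩ := hG.dir p hp q hq
        have := hG.sub _ hr'
        exact ⟨r', hr', h r' this h6 (h1.mono _ _ _ h' this h7)⟩
  | @all n φ ih =>
    obtain ⟨F1, h1⟩ := ih
    refine ⟨fun τ p => p ∈ P ∧ ∀ x, x ∈ M → F1 (Fin.snoc τ x : Fin (n+1) → ZFSet) p, ⟨fun _ _ h => h.1, fun _ _ _ h hq hpq => ⟨hq, fun x hx => h1.mono _ _ _ (h.2 x hx) hq hpq⟩, fun τ p hp h => ⟨hp, fun x hx => ?_⟩, fun ι k => ?_, fun G hG τ hτ w hw => ?_⟩⟩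
    · refine h1.stab _ _ hp fun q hq hpq => ?_
      obtain ⟨r, h2, h3, h4⟩ := h q hq hpq
      exact ⟨r, h2, h3, h4.2 x hx⟩
    · have e1 : Dfb M (fun v => F1 (Fin.snoc (fun i => v (ι i + 1)) (v 0) : Fin (n+1) → ZFSet) (v (k+1))) := by
        refine (h1.df (Fin.snoc (fun i => ι i + 1) 0 : Fin (n+1) → ℕ) (k+1)).congr fun v _ => ?_
        refine iff_of_eq ?_
        congr 1
        funext i
        refine Fin.lastCases ?_ (fun i => ?_) i <;> simp
      exact dfa2
    · refine (Rl_all φ w).trans ?_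
      have hτ' : ∀ x ∈ M, ∀ i, (Fin.snoc τ x : Fin (n+1) → ZFSet) i ∈ M := by
        intro x hx i
        refine Fin.lastCases ?_ (fun i => ?_) i
        · simpa using hx
        · simpa using hτ i
      have key : ∀ x ∈ M, ∀ y : Vs (img (val G) M), y.1 = val G x → (Rl φ (Fin.snoc w y : Fin (n+1) → _) ↔
          ∃ p ∈ G, F1 (Fin.snoc τ x : Fin (n+1) → ZFSet) p) := by
        intro x hx y hy
        refine h1.truth G hG _ (hτ' x hx) _ fun i => ?_
        refine Fin.lastCases ?_ (fun i => ?_) i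
        · simpa using hy
        · simpa using hw i
      constructor
      · intro h
        have e1 : Dfb M (fun v => F1 (Fin.snoc τ (v 0) : Fin (n+1) → ZFSet) (v 1)) := by
          have := Dfb.inst00 (R := fun v x p => F1 (Fin.snoc (fun i : Fin n => v i) x : Fin (n+1) → ZFSet) p) (by
            refine (h1.df (Fin.snoc (fun i => i + 2) 0 : Fin (n+1) → ℕ) 1).congr fun v _ => ?_
            refine iff_of_eq ?_
            congr 1
            funext i
            refine Fin.lastCases ?_ (fun i => ?_) i <;> simp)
            (v := fun j => if h : j < n then τ ⟨j, h⟩ else ∅) (fun j => by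
            split_ifs
            exacts [hτ _, hM.emp])
          simpa using this
        obtain ⟨r, hr, h3⟩ := hG.dense hM hP (fun p => (∀ x, x ∈ M → F1 (Fin.snoc τ x : Fin (n+1) → ZFSet) p) ∨
            (∃ x, x ∈ M ∧ ∀ r, r ∈ P → p ⊆ r → ¬ F1 (Fin.snoc τ x : Fin (n+1) → ZFSet) r)) (by
          have e3 := Dfb.app2 (R := fun x p => F1 (Fin.snoc τ x : Fin (n+1) → ZFSet) p) e1 (.var 0) (.var 1)
          have e4 := Dfb.app2 (R := fun x p => F1 (Fin.snoc τ x : Fin (n+1) → ZFSet) p) e1 (.var 1) (.var 0)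
          exact dfa2) (by
          intro q hq
          by_cases hc : ∀ x, x ∈ M → F1 (Fin.snoc τ x : Fin (n+1) → ZFSet) q
          · exact ⟨q, hq, fun _ h => h, Or.inl hc⟩
          · push Not at hc
            obtain ⟨x, hx, h4⟩ := hc
            have h5 := mt (h1.stab _ q hq) h4
            push Not at h5
            obtain ⟨r, hr, h6, h7⟩ := h5
            exact ⟨r, hr, h6, Or.inr ⟨x, hx, h7⟩⟩)
        rcases h3 with h3 | ⟨x, hx, h4⟩
        · exact ⟨r, hr, hG.sub r hr, h3⟩
        · obtain ⟨p, hp, h5⟩ := (key x hx ⟨val G x, mem_img.2 ⟨x, hx, rfl⟩⟩ rfl).1 (h _)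
          obtain ⟨r', hr', h6, h7⟩ := hG.dir p hp r hr
          exact absurd (h1.mono _ _ _ h5 (hG.sub _ hr') h6) (h4 r' (hG.sub _ hr') h7)
      · rintro ⟨p, hp, hpP, h⟩ ⟨y, hy⟩
        obtain ⟨x, hx, rfl⟩ := mem_img.1 hy
        exact (key x hx _ rfl).2 ⟨p, hp, h x hx⟩

end

/-! ### Part 9: the generic extension satisfies ZFC -/

noncomputable def ck (x : ZFSet) : ZFSet :=
  ZFSet.range (fun y : {y // y ∈ x} => ZFSet.pair (ck y.1) ∅)
termination_by x.rank
decreasing_by exact ZFSet.rank_lt_of_mem y.2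

lemma mem_ck {x z : ZFSet} : z ∈ ck x ↔ ∃ y ∈ x, ZFSet.pair (ck y) ∅ = z := by
  rw [ck]; simp

/-- name of an unordered pair -/
noncomputable def upn (σ τ : ZFSet) : ZFSet := {ZFSet.pair σ ∅, ZFSet.pair τ ∅}
noncomputable def opn (σ τ : ZFSet) : ZFSet := upn (upn σ σ) (upn σ τ)

section
variable {M P : ZFSet} (hM : ZFM M) (hP : P ∈ M)
include hM hP

lemma dfCk {F : (ℕ → ZFSet) → ZFSet} (hF : Dfn M F) : Dfn M (fun v => ck (F v)) := by
  refine Dfn.app1 ?_ hF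
  let Φ : ZFSet → ZFSet → ZFSet := fun f x => ZFSet.sep (fun z => ∃ y, y ∈ x ∧
    ∃ c, c ∈ ZFSet.sUnion (ZFSet.sUnion f) ∧ ZFSet.pair y c ∈ f ∧ z = ZFSet.pair c ∅) (ZFSet.prod (ZFSet.sUnion (ZFSet.sUnion f)) {∅})
  refine Dfn.recur hM (Φ := Φ) ?_ ?_
  · dsimp only [Φ]; exact dfn2
  · intro x hx
    ext z
    rw [mem_ck, ZFSet.mem_sep]
    constructor
    · rintro ⟨y, hy, rfl⟩
      have h1 : ZFSet.pair y (ck y) ∈ gr M ck x := mem_gr.2 ⟨y, mem_Vl.2 ⟨hM.tr _ hx hy, ZFSet.rank_lt_of_mem hy⟩, rfl⟩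
      refine ⟨?_, y, hy, _, op_sUU' h1, h1, rfl⟩
      rw [ZFSet.pair_mem_prod]
      exact ⟨op_sUU' h1, ZFSet.mem_singleton.2 rfl⟩
    · rintro ⟨-, y, hy, c, hc, h1, rfl⟩
      obtain ⟨y', h2, h3⟩ := mem_gr.1 h1
      obtain ⟨rfl, rfl⟩ := ZFSet.pair_inj.1 h3
      exact ⟨_, hy, rfl⟩

lemma ck_mem {x : ZFSet} (hx : x ∈ M) : ck x ∈ M := (dfCk hM hP (.const hx)).1 (fun _ => x) (fun _ => hx)

variable {G : Set ZFSet} (hG : Gen M P G)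
include hG

lemma val_ck (x : ZFSet) : val G (ck x) = x := by
  induction x using ZFSet.inductionOn with
  | _ x ih =>
  obtain ⟨r, hr⟩ := hG.ne hM hP
  ext y
  rw [mem_val]
  constructor
  · rintro ⟨σ, p, -, h, rfl⟩
    obtain ⟨z, hz, h⟩ := mem_ck.1 h
    obtain ⟨rfl, -⟩ := ZFSet.pair_inj.1 h
    rwa [ih z hz]
  · intro hy
    exact ⟨ck y, ∅, ⟨r, hr, ZFSet.empty_subset _⟩, mem_ck.2 ⟨y, hy, rfl⟩, ih y hy⟩

lemma val_upn (σ τ : ZFSet) : val G (upn σ τ) = {val G σ, val G τ} := by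
  obtain ⟨r, hr⟩ := hG.ne hM hP
  ext y
  rw [mem_val, ZFSet.mem_pair]
  constructor
  · rintro ⟨σ, p, -, h, rfl⟩
    rcases ZFSet.mem_pair.1 h with h | h <;> obtain ⟨rfl, -⟩ := ZFSet.pair_inj.1 h <;> simp
  · rintro (rfl | rfl)
    exacts [⟨σ, ∅, ⟨r, hr, ZFSet.empty_subset _⟩, ZFSet.mem_pair.2 (Or.inl rfl), rfl⟩,
      ⟨τ, ∅, ⟨r, hr, ZFSet.empty_subset _⟩, ZFSet.mem_pair.2 (Or.inr rfl), rfl⟩]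

lemma val_opn (σ τ : ZFSet) : val G (opn σ τ) = ZFSet.pair (val G σ) (val G τ) := by
  rw [opn, val_upn hM hP hG, val_upn hM hP hG, val_upn hM hP hG, ZFSet.pair_eq_singleton]; rfl

lemma sub_N {x : ZFSet} (hx : x ∈ M) : x ∈ img (val G) M := mem_img.2 ⟨ck x, ck_mem hM hP hx, val_ck hM hP hG x⟩

lemma N_tr : (img (val G) M).IsTransitive := by
  intro y hy z hz
  obtain ⟨τ, hτ, rfl⟩ := mem_img.1 hy
  obtain ⟨σ, p, -, h, rfl⟩ := mem_val.1 hz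
  exact mem_img.2 ⟨σ, (hM.opm hP hτ h).1, rfl⟩

omit hM hP hG in
lemma rank_val (τ : ZFSet) : (val G τ).rank ≤ τ.rank := by
  have : ∀ o : Ordinal, ∀ τ : ZFSet, τ.rank = o → (val G τ).rank ≤ τ.rank := by
    intro o
    induction o using Ordinal.induction with
    | h o ih =>
    rintro τ rfl
    refine ZFSet.rank_le_iff.2 fun y hy => ?_
    obtain ⟨σ, p, -, h, rfl⟩ := mem_val.1 hy
    exact (ih _ (rank_op h).1 σ rfl).trans_lt (rank_op h).1
  exact this _ τ rfl

lemma N_ord {α : ZFSet} (hα : IsOrd α) (h : α ∈ img (val G) M) : α ∈ M := by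
  obtain ⟨τ, hτ, rfl⟩ := mem_img.1 h
  obtain ⟨β, hβ, h1, h2⟩ := ord_rank hM τ hτ
  have h3 : val G τ ⊆ β := (hα.ord.rank_le_iff_subset h1.ord).1 (h2 ▸ rank_val τ)
  rcases (hα.ord.subset_iff_eq_or_mem h1.ord).1 h3 with h4 | h4
  · rw [h4]; exact hβ
  · exact hM.tr _ hβ h4

lemma forceN (R : ZFSet → ZFSet → Prop) (hR : Dfb (img (val G) M) (fun v => R (v 0) (v 1))) :
    ∃ F : ZFSet → ZFSet → ZFSet → Prop, Dfb M (fun v => F (v 0) (v 1) (v 2)) ∧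
      (∀ σ τ p, F σ τ p → p ∈ P) ∧ (∀ σ τ p q, F σ τ p → q ∈ P → p ⊆ q → F σ τ q) ∧
      ∀ σ ∈ M, ∀ τ ∈ M, (R (val G σ) (val G τ) ↔ ∃ p ∈ G, F σ τ p) := by
  obtain ⟨φ, hφ⟩ := hR
  obtain ⟨m, f, ψ, hψ⟩ := exists_BF (N := img (val G) M) φ
  obtain ⟨F, hF⟩ := forcing hM hP ψ
  have hn : ∀ c : Vs (img (val G) M), ∃ τ : Vs M, val G τ.1 = c.1 := fun c => by
    obtain ⟨τ, hτ, h⟩ := mem_img.1 c.2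
    exact ⟨⟨τ, hτ⟩, h⟩
  choose nm hnm using hn
  let k : ℕ ⊕ Vs (img (val G) M) → ℕ ⊕ Vs M := Sum.map (fun j => if j = 0 then 0 else 1) nm
  let N : ZFSet → ZFSet → Fin m → ZFSet := fun σ τ i => Sum.elim (fun j => if j = 0 then σ else τ) (fun c => (nm c).1) (f i)
  refine ⟨fun σ τ p => F (N σ τ) p, ?_, fun σ τ p => hF.inP _ p, fun σ τ p q h1 h2 h3 => hF.mono _ _ _ h1 h2 h3, ?_⟩
  · have := (hF.df (fun i => i) m).inst (fun j => if h : j < m then k (f ⟨j, h⟩) else .inl 2)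
    refine this.congr fun v _ => ?_
    refine iff_of_eq ?_
    simp only [lt_self_iff_false, dite_false, Sum.elim_inl]
    congr 1
    funext i
    simp only [Fin.is_lt, dite_true, Fin.eta]
    dsimp only [N, k]
    rcases f i with j | c
    · simp only [Sum.map_inl, Sum.elim_inl]; split_ifs <;> rfl
    · rfl
  · intro σ hσ τ hτ
    let v : ℕ → Vs (img (val G) M) := fun j => if j = 0 then ⟨val G σ, mem_img.2 ⟨σ, hσ, rfl⟩⟩ else ⟨val G τ, mem_img.2 ⟨τ, hτ, rfl⟩⟩
    refine Iff.trans (hφ v) ((hψ _).trans (hF.truth G hG _ ?_ _ ?_))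
    · intro i
      dsimp only [N]
      rcases f i with j | c
      · simp only [Sum.elim_inl]; split_ifs <;> assumption
      · exact (nm c).2
    · intro i
      dsimp only [N]
      rcases f i with j | c
      · simp only [Sum.elim_inl, v]; split_ifs <;> rfl
      · exact (hnm c).symm

lemma sepW (R : ZFSet → Prop) (hR : Dfb (img (val G) M) (fun v => R (v 0))) {w : ZFSet} (hw : w ∈ M) :
    ∃ ν ∈ M, ν ⊆ ZFSet.prod w P ∧ val G ν = ZFSet.sep R (img (val G) w) := by
  obtain ⟨F, dF, hF1, hF2, hF3⟩ := forceN hM hP hG (fun x _ => R x) hR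
  have d2 : Dfb M (fun v => F (v 1) (v 1) (v 0)) := Dfb.app3 dF (.var 1) (.var 1) (.var 0)
  refine ⟨ZFSet.sep (fun z => ∃ π, π ∈ M ∧ ∃ p, p ∈ P ∧ z = ZFSet.pair π p ∧ F π π p) (ZFSet.prod w P),
    hM.sep _ dfa2 _ (hM.prod hw hP), fun z hz => (ZFSet.mem_sep.1 hz).1, ?_⟩
  ext y
  rw [mem_val, ZFSet.mem_sep, mem_img]
  constructor
  · rintro ⟨σ, p, ⟨r, hr, hpr⟩, h, rfl⟩
    obtain ⟨h1, π, hπ, p', hp', e, h3⟩ := ZFSet.mem_sep.1 h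
    obtain ⟨rfl, rfl⟩ := ZFSet.pair_inj.1 e
    exact ⟨⟨_, (ZFSet.pair_mem_prod.1 h1).1, rfl⟩, (hF3 _ hπ _ hπ).2 ⟨p, hG.up r hr p hp' hpr, h3⟩⟩
  · rintro ⟨⟨σ, hσ, rfl⟩, h⟩
    have hσM := hM.tr _ hw hσ
    obtain ⟨p, hp, h1⟩ := (hF3 σ hσM σ hσM).1 h
    have hpP := hF1 _ _ _ h1
    exact ⟨σ, p, ⟨p, hp, fun _ h => h⟩, ZFSet.mem_sep.2 ⟨ZFSet.pair_mem_prod.2 ⟨hσ, hpP⟩, σ, hσM, p, hpP, rfl, h1⟩, rfl⟩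

lemma sepW' (R : ZFSet → Prop) (hR : Dfb (img (val G) M) (fun v => R (v 0))) {w a : ZFSet} (hw : w ∈ M)
    (ha : ∀ y, y ∈ a ↔ (∃ x ∈ w, val G x = y) ∧ R y) : a ∈ img (val G) M := by
  obtain ⟨ν, hν, -, h⟩ := sepW hM hP hG R hR hw
  refine mem_img.2 ⟨ν, hν, h.trans ?_⟩
  ext y
  rw [ha, ZFSet.mem_sep, mem_img]

omit hM hP hG in
lemma mem_val_dom {τ y : ZFSet} (h : y ∈ val G τ) : ∃ x ∈ ZFSet.sUnion (ZFSet.sUnion τ), val G x = y := by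
  obtain ⟨σ, p, -, h', rfl⟩ := mem_val.1 h
  exact ⟨σ, op_sUU h', rfl⟩

lemma N_ZFM : ZFM (img (val G) M) := by
  have hT := N_tr hM hP hG
  have uu : ∀ {τ}, τ ∈ M → ZFSet.sUnion (ZFSet.sUnion τ) ∈ M := fun h => hM.union _ (hM.union _ h)
  refine ⟨hT, ?_, ?_, ?_, sub_N hM hP hG hM.om, ?_, ?_⟩
  · intro a ha b hb
    obtain ⟨σ, hσ, rfl⟩ := mem_img.1 ha
    obtain ⟨τ, hτ, rfl⟩ := mem_img.1 hb
    rw [← val_upn hM hP hG]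
    exact mem_img.2 ⟨_, hM.pair _ (hM.op hσ hM.emp) _ (hM.op hτ hM.emp), rfl⟩
  · intro a ha
    obtain ⟨τ, hτ, rfl⟩ := mem_img.1 ha
    refine sepW' hM hP hG (fun x => ∃ y, y ∈ val G τ ∧ x ∈ y)
      (Dfb.bex hT (.const ha) (Dfb.vmem 1 0)) (hM.union _ (uu (uu hτ))) fun y => ?_
    rw [ZFSet.mem_sUnion]
    refine ⟨fun h => ⟨?_, h⟩, fun h => h.2⟩
    obtain ⟨z, hz, hy⟩ := h
    obtain ⟨π, p, -, h1, rfl⟩ := mem_val.1 hz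
    obtain ⟨ρ, q, -, h2, rfl⟩ := mem_val.1 hy
    refine ⟨ρ, ?_, rfl⟩
    refine ZFSet.mem_sUnion.2 ⟨_, ZFSet.mem_sUnion.2 ⟨_, ZFSet.mem_sUnion.2 ⟨π, ?_, h2⟩, ZFSet.mem_pair.2 (Or.inr rfl)⟩, ZFSet.mem_pair.2 (Or.inl rfl)⟩
    exact op_sUU h1
  · intro a ha
    obtain ⟨τ, hτ, rfl⟩ := mem_img.1 ha
    have d : Dfb (img (val G) M) (fun v => v 0 ⊆ val G τ) := Dfb.sub hT (.var 0) (.const ha)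
    refine sepW' hM hP hG (fun x => x ⊆ val G τ) d (hM.pow _ (hM.prod (uu hτ) hP)) fun y => ?_
    rw [mem_Pw]
    constructor
    · rintro ⟨h1, h2⟩
      refine ⟨?_, h1⟩
      obtain ⟨ν, hν, h3, h4⟩ := sepW hM hP hG (fun x => x ∈ y) (Dfb.mem (.var 0) (.const h2)) (uu hτ)
      refine ⟨ν, mem_Pw.2 ⟨h3, hν⟩, ?_⟩
      rw [h4]
      ext z
      rw [ZFSet.mem_sep, mem_img]
      exact ⟨fun h => h.2, fun h => ⟨mem_val_dom (h1 h), h⟩⟩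
    · rintro ⟨⟨x, hx, rfl⟩, h⟩
      exact ⟨h, mem_img.2 ⟨x, (mem_Pw.1 hx).2, rfl⟩⟩
  · intro R hR a ha
    obtain ⟨τ, hτ, rfl⟩ := mem_img.1 ha
    refine sepW' hM hP hG (fun x => x ∈ val G τ ∧ R x) (Dfb.and (Dfb.mem (.var 0) (.const ha)) hR) (uu hτ) fun y => ?_
    rw [ZFSet.mem_sep]
    exact ⟨fun h => ⟨mem_val_dom h.1, h⟩, fun h => h.2⟩
  · intro R hR a ha hfun
    obtain ⟨τ, hτ, rfl⟩ := mem_img.1 ha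
    obtain ⟨F, dF, hF1, hF2, hF3⟩ := forceN hM hP hG R hR
    have d2 : Dfb M (fun v => F (v 1) (v 3) (v 0)) := Dfb.app3 dF (.var 1) (.var 3) (.var 0)
    obtain ⟨b, hb, H⟩ := hM.coll (fun z ρ => ∃ π, π ∈ M ∧ ∃ p, p ∈ P ∧ z = ZFSet.pair π p ∧ F π ρ p) dfa2 (hM.prod (uu hτ) hP)
    have d3 : Dfb (img (val G) M) (fun v => ∃ x, x ∈ val G τ ∧ R x (v 0)) :=
      Dfb.bex hT (.const ha) (Dfb.app2 hR (.var 0) (.var 1))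
    refine ⟨ZFSet.sep (fun y => ∃ x, x ∈ val G τ ∧ R x y) (img (val G) b), ?_, ?_⟩
    · refine sepW' hM hP hG (fun y => ∃ x, x ∈ val G τ ∧ R x y) d3 hb fun y => ?_
      rw [ZFSet.mem_sep, mem_img]
    · intro y
      rw [ZFSet.mem_sep, mem_img]
      constructor
      · rintro ⟨⟨x, hx, rfl⟩, h⟩
        exact ⟨mem_img.2 ⟨x, hM.tr _ hb hx, rfl⟩, h⟩
      · rintro ⟨hy, x, hx, h⟩
        refine ⟨?_, x, hx, h⟩
        obtain ⟨ρ, hρ, rfl⟩ := mem_img.1 hy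
        obtain ⟨π, hπ, rfl⟩ := mem_val_dom hx
        have hπM := hM.tr _ (uu hτ) hπ
        obtain ⟨p, hp, h1⟩ := (hF3 π hπM ρ hρ).1 h
        have hpP := hG.sub _ hp
        obtain ⟨ρ', hρ', π', hπ', p', hp', e, h2⟩ := H (ZFSet.pair π p) (ZFSet.pair_mem_prod.2 ⟨hπ, hpP⟩) ⟨ρ, hρ, π, hπM, p, hpP, rfl, h1⟩
        obtain ⟨rfl, rfl⟩ := ZFSet.pair_inj.1 e
        refine ⟨ρ', hρ', ?_⟩
        have hρ'M := hM.tr _ hb hρ'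
        exact hfun _ hx _ (mem_img.2 ⟨ρ', hρ'M, rfl⟩) _ hy ((hF3 π hπM ρ' hρ'M).2 ⟨p, hp, h2⟩) h

end

section
variable {M P : ZFSet} (hM : ZFM M) (hP : P ∈ M)
include hM hP

omit hP in
lemma dfUpn {F G : (ℕ → ZFSet) → ZFSet} (hF : Dfn M F) (hG : Dfn M G) : Dfn M (fun v => upn (F v) (G v)) := by
  unfold upn; exact dfn2

omit hP in
lemma dfOpn {F G : (ℕ → ZFSet) → ZFSet} (hF : Dfn M F) (hG : Dfn M G) : Dfn M (fun v => opn (F v) (G v)) :=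
  dfUpn hM (dfUpn hM hF hF) (dfUpn hM hF hG)

omit hM hP in
lemma Dfn.mem1 {T : ZFSet → ZFSet} (h : Dfn M (fun v => T (v 0))) {x : ZFSet} (hx : x ∈ M) : T x ∈ M :=
  h.1 (fun _ => x) (fun _ => hx)

omit hM hP in
lemma Dfn.eq1 {T : ZFSet → ZFSet} (h : Dfn M (fun v => T (v 0))) : Dfb M (fun v => v 1 = T (v 0)) :=
  Dfb.eq (.var 1) h

variable {G : Set ZFSet} (hG : Gen M P G)
include hG

lemma G_mem : ∃ g ∈ img (val G) M, ∀ p, p ∈ g ↔ p ∈ G := by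
  have d : Dfn M (fun v => ZFSet.pair (ck (v 0)) (v 0)) := by
    have := @dfCk M P hM hP
    exact dfn2
  refine ⟨_, mem_img.2 ⟨img (fun p => ZFSet.pair (ck p) p) P, hM.img hP (fun p hp => d.mem1 (T := fun p => ZFSet.pair (ck p) p) (hM.tr _ hP hp)) (Dfn.eq1 (T := fun p => ZFSet.pair (ck p) p) d), rfl⟩, fun p => ?_⟩
  rw [mem_val]
  constructor
  · rintro ⟨σ, q, ⟨r, hr, hqr⟩, h, rfl⟩
    obtain ⟨q', hq', e⟩ := mem_img.1 h
    obtain ⟨rfl, rfl⟩ := ZFSet.pair_inj.1 e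
    rw [val_ck hM hP hG]
    exact hG.up r hr _ hq' hqr
  · intro hp
    exact ⟨ck p, p, ⟨p, hp, fun _ h => h⟩, mem_img.2 ⟨p, hG.sub p hp, rfl⟩, val_ck hM hP hG p⟩

lemma vgr_mem {w : ZFSet} (hw : w ∈ M) : img (fun x => ZFSet.pair x (val G x)) w ∈ img (val G) M := by
  have d : Dfn M (fun v => opn (ck (v 0)) (v 0)) := dfOpn hM (dfCk hM hP (.var 0)) (.var 0)
  refine sepW' hM hP hG (fun _ => True) Dfb.true (w := img (fun x => opn (ck x) x) w)
    (hM.img hw (fun p hp => d.mem1 (T := fun p => opn (ck p) p) (hM.tr _ hw hp)) (Dfn.eq1 (T := fun p => opn (ck p) p) d)) fun y => ?_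
  rw [mem_img, and_true]
  constructor
  · rintro ⟨x, hx, rfl⟩
    exact ⟨_, mem_img.2 ⟨x, hx, rfl⟩, by rw [val_opn hM hP hG, val_ck hM hP hG]⟩
  · rintro ⟨x, hx, rfl⟩
    obtain ⟨z, hz, rfl⟩ := mem_img.1 hx
    exact ⟨z, hz, by rw [val_opn hM hP hG, val_ck hM hP hG]⟩

lemma N_AC (hAC : ACM M) : ACM (img (val G) M) := by
  have hN := N_ZFM hM hP hG
  intro x hxN
  obtain ⟨τ, hτ, rfl⟩ := mem_img.1 hxN
  rcases ZFSet.eq_empty_or_nonempty (val G τ) with h0 | ⟨x0, hx0⟩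
  · rw [h0]
    refine ⟨∅, hN.emp, ⟨fun y hy => (ZFSet.notMem_empty _ hy).elim, fun y hy => (ZFSet.notMem_empty _ hy).elim⟩, ∅, hN.emp, ?_⟩
    refine ⟨fun y hy => (ZFSet.notMem_empty _ hy).elim, fun y hy => (ZFSet.notMem_empty _ hy).elim, fun _ _ _ h => (ZFSet.notMem_empty _ h).elim, fun y hy => (ZFSet.notMem_empty _ hy).elim⟩
  obtain ⟨α, hα, oα, f, hf, hs⟩ := hAC _ (hM.union _ (hM.union _ hτ))
  have hwN := sub_N hM hP hG (hM.union _ (hM.union _ hτ))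
  have hαN := sub_N hM hP hG hα
  have hfN := sub_N hM hP hG hf
  have hx0N := hN.tr _ hxN hx0
  have hvN := vgr_mem hM hP hG (hM.union _ (hM.union _ hτ))
  generalize hv : img (fun x => ZFSet.pair x (val G x)) (ZFSet.sUnion (ZFSet.sUnion τ)) = h at hvN
  have mv : ∀ π y, ZFSet.pair π y ∈ h ↔ π ∈ ZFSet.sUnion (ZFSet.sUnion τ) ∧ y = val G π := by
    intro π y
    rw [← hv, mem_img]
    constructor
    · rintro ⟨x, hx, e⟩
      obtain ⟨rfl, rfl⟩ := ZFSet.pair_inj.1 e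
      exact ⟨hx, rfl⟩
    · rintro ⟨hx, rfl⟩; exact ⟨_, hx, rfl⟩
  have dom : ∀ y, y ∈ val G τ → ∃ x ∈ ZFSet.sUnion (ZFSet.sUnion τ), val G x = y := fun y hy => mem_val_dom hy
  generalize val G τ = X at *
  generalize ZFSet.sUnion (ZFSet.sUnion τ) = w at *
  let Q : ZFSet → ZFSet → Prop := fun β y => ∃ π, π ∈ w ∧ ZFSet.pair β π ∈ f ∧ ZFSet.pair π y ∈ h
  have Qf : ∀ β y y', Q β y → Q β y' → y = y' := by
    rintro β y y' ⟨π, h1, h2, h3⟩ ⟨π', h1', h2', h3'⟩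
    rw [hs.2.2.1 _ _ _ h2 h2', mv] at h3
    rw [mv] at h3'
    rw [h3.2, h3'.2]
  refine ⟨α, hαN, oα, ZFSet.sep (fun z => ∃ β, β ∈ α ∧ ∃ y, y ∈ X ∧ z = ZFSet.pair β y ∧
    (Q β y ∨ (y = x0 ∧ ¬ ∃ y', y' ∈ X ∧ Q β y'))) (ZFSet.prod α X), hN.sep _ (by
      dsimp only [Q]
      generalize img (val G) M = N at *
      clear hM hP hG hα hf
      exact dfa2) _ (hN.prod hαN hxN), ?_, ?_, ?_, ?_⟩
  · intro p hp
    obtain ⟨-, β, hβ, y, hy, e, -⟩ := ZFSet.mem_sep.1 hp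
    exact ⟨β, hβ, y, hy, e⟩
  · intro β hβ
    by_cases hc : ∃ y', y' ∈ X ∧ Q β y'
    · obtain ⟨y, hy, hQ⟩ := hc
      exact ⟨y, hy, ZFSet.mem_sep.2 ⟨ZFSet.pair_mem_prod.2 ⟨hβ, hy⟩, β, hβ, y, hy, rfl, Or.inl hQ⟩⟩
    · exact ⟨x0, hx0, ZFSet.mem_sep.2 ⟨ZFSet.pair_mem_prod.2 ⟨hβ, hx0⟩, β, hβ, x0, hx0, rfl, Or.inr ⟨rfl, hc⟩⟩⟩
  · intro β y y' h1 h2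
    obtain ⟨-, β1, hβ1, y1, hy1, e1, k1⟩ := ZFSet.mem_sep.1 h1
    obtain ⟨-, β2, hβ2, y2, hy2, e2, k2⟩ := ZFSet.mem_sep.1 h2
    obtain ⟨rfl, rfl⟩ := ZFSet.pair_inj.1 e1
    obtain ⟨rfl, rfl⟩ := ZFSet.pair_inj.1 e2
    rcases k1 with k1 | ⟨k, k1⟩ <;> rcases k2 with k2 | ⟨k', k2⟩
    · exact Qf _ _ _ k1 k2
    · exact absurd ⟨_, hy1, k1⟩ k2
    · exact absurd ⟨_, hy2, k2⟩ k1
    · rw [k, k']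
  · intro y hy
    obtain ⟨π, hπ, rfl⟩ := dom y hy
    obtain ⟨β, hβ, hb⟩ := hs.2.2.2 π hπ
    exact ⟨β, hβ, ZFSet.mem_sep.2 ⟨ZFSet.pair_mem_prod.2 ⟨hβ, hy⟩, β, hβ, _, hy, rfl, Or.inl ⟨π, hπ, hb, (mv _ _).2 ⟨hπ, rfl⟩⟩⟩⟩

end

lemma gen_exists {M P p0 : ZFSet} (hc : M.toSet.Countable) (hp0 : p0 ∈ P) : ∃ G, Gen M P G ∧ p0 ∈ G := by
  classical
  by_cases hne : M.toSet.Nonempty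
  swap
  · refine ⟨{p | p ∈ P ∧ p ⊆ p0}, ⟨fun p h => h.1, fun p h q hq hqp => ⟨hq, hqp.trans h.2⟩, fun p hp q hq => ⟨p0, ⟨hp0, fun _ h => h⟩, hp.2, hq.2⟩, fun D hD => (hne ⟨D, hD⟩).elim⟩, hp0, fun _ h => h⟩
  obtain ⟨D, hD⟩ := hc.exists_eq_range hne
  let st : ℕ → {p // p ∈ P} → {p // p ∈ P} := fun n q =>
    if h : ∃ q' : {p // p ∈ P}, q'.1 ∈ D n ∧ q.1 ⊆ q'.1 then h.choose else q
  let q : ℕ → {p // p ∈ P} := fun n => Nat.rec ⟨p0, hp0⟩ st n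
  have hst : ∀ n x, x.1 ⊆ (st n x).1 := by
    intro n x
    dsimp only [st]
    split_ifs with h
    · exact h.choose_spec.2
    · exact fun _ h => h
  have hq : ∀ m n, m ≤ n → (q m).1 ⊆ (q n).1 := by
    intro m n h
    induction h with
    | refl => exact fun _ h => h
    | step h ih => exact ih.trans (hst _ _)
  refine ⟨{p | p ∈ P ∧ ∃ n, p ⊆ (q n).1}, ⟨fun p h => h.1, fun p h r hr hrp => ⟨hr, h.2.imp fun n hn => hrp.trans hn⟩, ?_, ?_⟩, hp0, 0, fun _ h => h⟩
  · rintro p ⟨hp, n, hn⟩ r ⟨hr, m, hm⟩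
    exact ⟨(q (max n m)).1, ⟨(q (max n m)).2, max n m, fun _ h => h⟩, fun x hx => hq n _ (le_max_left n m) (hn hx), fun x hx => hq m _ (le_max_right n m) (hm hx)⟩
  · intro E hE hd
    obtain ⟨n, rfl⟩ : E ∈ Set.range D := by rw [← hD]; exact hE
    refine ⟨(q (n+1)).1, ⟨(q (n+1)).2, n+1, fun _ h => h⟩, ?_⟩
    have : ∃ q' : {p // p ∈ P}, q'.1 ∈ D n ∧ (q n).1 ⊆ q'.1 := by
      obtain ⟨q', h1, h2, h3⟩ := hd _ (q n).2
      exact ⟨⟨q', h2⟩, h1, h3⟩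
    change (st n (q n)).1 ∈ D n
    dsimp only [st]
    rw [dif_pos this]
    exact this.choose_spec.1

lemma N_count {M : ZFSet} {G : Set ZFSet} (hc : M.toSet.Countable) : (img (val G) M).toSet.Countable := by
  refine (hc.image (val G)).mono fun y hy => ?_
  obtain ⟨x, hx, rfl⟩ := mem_img.1 hy
  exact ⟨x, hx, rfl⟩


/-! ### Part 10: finite partial functions -/

lemma mem_ts {x p : ZFSet} : x ∈ p.toSet ↔ x ∈ p := Iff.rfl

lemma mem_nn {n : ℕ} {x : ZFSet} : x ∈ nn n ↔ ∃ k < n, x = nn k := by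
  induction n with
  | zero => simp [nn]
  | succ n ih =>
    rw [nn, ZFSet.mem_insert_iff, ih]
    constructor
    · rintro (rfl | ⟨k, hk, rfl⟩)
      exacts [⟨n, by omega, rfl⟩, ⟨k, by omega, rfl⟩]
    · rintro ⟨k, hk, rfl⟩
      rcases Nat.lt_succ_iff_lt_or_eq.1 hk with h | rfl
      exacts [Or.inr ⟨k, h, rfl⟩, Or.inl rfl]

lemma nn_lt {m n : ℕ} (h : m < n) : nn m ∈ nn n := mem_nn.2 ⟨m, h, rfl⟩

lemma nn_inj {m n : ℕ} (h : nn m = nn n) : m = n := by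
  rcases lt_trichotomy m n with h1 | h1 | h1
  · exact absurd (h ▸ nn_lt h1) (ZFSet.mem_irrefl _)
  · exact h1
  · exact absurd (h ▸ nn_lt h1) (ZFSet.mem_irrefl _)

lemma nn_mem {m n : ℕ} : nn m ∈ nn n ↔ m < n := by
  refine ⟨fun h => ?_, nn_lt⟩
  obtain ⟨k, hk, e⟩ := mem_nn.1 h
  rwa [nn_inj e]

lemma nn_sub {m n : ℕ} : nn m ⊆ nn n ↔ m ≤ n := by
  constructor
  · intro h
    by_contra hc
    exact ZFSet.mem_irrefl _ (h (nn_lt (not_le.1 hc)))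
  · intro h x hx
    obtain ⟨k, hk, rfl⟩ := mem_nn.1 hx
    exact nn_lt (by omega)

/-- `p` has at most `n` elements -/
def Fn (M n p : ZFSet) : Prop := ∃ f, f ∈ M ∧ (∀ e, e ∈ p → ∃ i, i ∈ n ∧ ZFSet.pair i e ∈ f) ∧
  ∀ i, i ∈ n → ∀ e, e ∈ p → ∀ e', e' ∈ p → ZFSet.pair i e ∈ f → ZFSet.pair i e' ∈ f → e = e'

def one : ZFSet := {∅}

lemma one_ne : (∅ : ZFSet) ≠ one := by
  intro h
  have : (∅ : ZFSet) ∈ one := ZFSet.mem_singleton.2 rfl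
  rw [← h] at this
  exact ZFSet.notMem_empty _ this

noncomputable def Po (M κ : ZFSet) : ZFSet :=
  ZFSet.sep (fun p => (∀ x, x ∈ ZFSet.prod κ ZFSet.omega → ¬ (ZFSet.pair x ∅ ∈ p ∧ ZFSet.pair x one ∈ p)) ∧
    ∃ n, n ∈ ZFSet.omega ∧ Fn M n p) (Pw M (ZFSet.prod (ZFSet.prod κ ZFSet.omega) {∅, one}))

/-- conflicting atoms -/
def Cf (e e' : ZFSet) : Prop := ∃ x, (e = ZFSet.pair x ∅ ∧ e' = ZFSet.pair x one) ∨ (e = ZFSet.pair x one ∧ e' = ZFSet.pair x ∅)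

lemma Cf.symm {e e' : ZFSet} (h : Cf e e') : Cf e' e := by
  obtain ⟨x, h | h⟩ := h
  exacts [⟨x, Or.inr h.symm⟩, ⟨x, Or.inl h.symm⟩]

lemma Cf.fn {e a b : ZFSet} (h : Cf e a) (h' : Cf e b) : a = b := by
  obtain ⟨x, ⟨h1, h2⟩ | ⟨h1, h2⟩⟩ := h <;> obtain ⟨y, ⟨h3, h4⟩ | ⟨h3, h4⟩⟩ := h' <;>
    obtain ⟨h5, h6⟩ := ZFSet.pair_inj.1 (h1.symm.trans h3)
  · rw [h2, h4, h5]
  · exact absurd h6 one_ne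
  · exact absurd h6.symm one_ne
  · rw [h2, h4, h5]

lemma anti {ι : Type*} : ∀ (n : ℕ) (S : Set ι) (c : ι → Set ZFSet), (∀ i ∈ S, (c i).encard ≤ n) →
    (∀ i ∈ S, ∀ a ∈ c i, ∀ b ∈ c i, ¬ Cf a b) →
    (∀ i ∈ S, ∀ j ∈ S, i ≠ j → ∃ a ∈ c i, ∃ b ∈ c j, Cf a b) → S.Finite := by
  intro n
  induction n with
  | zero =>
    intro S c h1 _ h3
    refine Set.Subsingleton.finite fun i hi j hj => ?_
    by_contra hne
    obtain ⟨a, ha, -⟩ := h3 i hi j hj hne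
    have := h1 i hi
    simp only [Nat.cast_zero, nonpos_iff_eq_zero, Set.encard_eq_zero] at this
    rw [this] at ha
    exact ha
  | succ n ih =>
    intro S c h1 h2 h3
    rcases S.eq_empty_or_nonempty with rfl | ⟨i0, hi0⟩
    · exact Set.finite_empty
    have hf : (c i0).Finite := Set.finite_of_encard_le_coe (h1 i0 hi0)
    have : S ⊆ {i0} ∪ ⋃ e ∈ c i0, {j ∈ S | ∃ b ∈ c j, Cf e b} := by
      intro j hj
      by_cases h : j = i0
      · exact Or.inl h
      · obtain ⟨a, ha, b, hb, hab⟩ := h3 i0 hi0 j hj (Ne.symm h)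
        exact Or.inr (Set.mem_biUnion ha ⟨hj, b, hb, hab⟩)
    refine ((Set.finite_singleton i0).union (hf.biUnion fun e _ => ?_)).subset this
    refine ih _ (fun j => c j \ {b | Cf e b}) ?_ ?_ ?_
    · rintro j ⟨hj, b, hb, hab⟩
      have e1 : (c j \ {b | Cf e b}) = c j \ {b} := by
        ext x
        simp only [Set.mem_diff, Set.mem_setOf_eq, Set.mem_singleton_iff]
        refine and_congr_right fun _ => not_congr ⟨fun h => h.fn hab, fun h => h ▸ hab⟩
      have e2 := Set.encard_diff_singleton_add_one hb
      have e3 := h1 j hj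
      rw [← e2] at e3
      rw [e1]
      push_cast at e3
      exact (ENat.add_le_add_iff_right (by simp)).1 e3
    · rintro j ⟨hj, -⟩ a ha b hb
      exact h2 j hj a ha.1 b hb.1
    · rintro j ⟨hj, b1, hb1, k1⟩ k ⟨hk, b2, hb2, k2⟩ hne
      obtain ⟨a, ha, b, hb, hab⟩ := h3 j hj k hk hne
      refine ⟨a, ⟨ha, fun h => ?_⟩, b, ⟨hb, fun h => ?_⟩, hab⟩
      · have := hab.fn (Cf.symm h)
        subst this
        exact h2 k hk _ hb _ hb2 k2
      · have := hab.symm.fn (Cf.symm h)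
        subst this
        exact h2 j hj _ ha _ hb1 k1

lemma Fn.card {M p : ZFSet} {n : ℕ} (h : Fn M (nn n) p) : p.toSet.encard ≤ n := by
  obtain ⟨f, -, h1, h2⟩ := h
  have : ∀ e : ZFSet, ∃ k : ℕ, e ∈ p → k < n ∧ ZFSet.pair (nn k) e ∈ f := by
    intro e
    by_cases he : e ∈ p
    · obtain ⟨i, hi, h⟩ := h1 e he
      obtain ⟨k, hk, rfl⟩ := mem_nn.1 hi
      exact ⟨k, fun _ => ⟨hk, h⟩⟩
    · exact ⟨0, fun h => absurd h he⟩
  choose k hk using this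
  have := Set.encard_le_encard_of_injOn (s := p.toSet) (t := (Finset.range n : Set ℕ)) (f := k) (fun e he => by simpa using (hk e he).1)
    (fun e he e' he' hee => h2 _ (nn_lt (hk e he).1) e he e' he' (hk e he).2 (hee ▸ (hk e' he').2))
  rw [Set.encard_coe_eq_coe_finsetCard] at this
  simpa using this

section
variable {M κ : ZFSet} (hM : ZFM M)
include hM

lemma ZFM.nn (n : ℕ) : nn n ∈ M := hM.tr _ hM.om (mem_omega.2 ⟨n, rfl⟩)

lemma one_M : one ∈ M := hM.sing hM.emp

lemma dfFn {F G : (ℕ → ZFSet) → ZFSet} (hF : Dfn M F) (hG : Dfn M G) : Dfb M (fun v => Fn M (F v) (G v)) := by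
  unfold Fn
  refine Dfb.app2 (R := fun n p => ∃ f, f ∈ M ∧ (∀ e, e ∈ p → ∃ i, i ∈ n ∧ ZFSet.pair i e ∈ f) ∧
  ∀ i, i ∈ n → ∀ e, e ∈ p → ∀ e', e' ∈ p → ZFSet.pair i e ∈ f → ZFSet.pair i e' ∈ f → e = e') ?_ hF hG
  clear hF hG
  exact dfa2

lemma fin_Fn : ∀ (s : Set ZFSet), s.Finite → (∀ x ∈ s, x ∈ M) → ∃ p ∈ M, p.toSet = s ∧ ∃ n, Fn M (CtmForcing.nn n) p := by
  intro s hs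
  induction s, hs using Set.Finite.induction_on with
  | empty =>
    intro _
    refine ⟨∅, hM.emp, by ext; simp [mem_ts], 0, ∅, hM.emp, fun e he => (ZFSet.notMem_empty _ he).elim, fun i hi => (ZFSet.notMem_empty _ hi).elim⟩
  | @insert a s ha hs ih =>
    intro h
    obtain ⟨p, hp, rfl, n, f, hf, h1, h2⟩ := ih fun x hx => h x (Or.inr hx)
    have haM := h a (Or.inl rfl)
    refine ⟨p ∪ {a}, hM.uni hp (hM.sing haM), by ext; simp [mem_ts, or_comm], n+1,
      ZFSet.sep (fun z => ∃ i, i ∈ CtmForcing.nn n ∧ ∃ e, e ∈ p ∧ z = ZFSet.pair i e) f ∪ {ZFSet.pair (CtmForcing.nn n) a}, hM.uni (hM.sep _ (by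
        have := hM.nn n
        exact dfa2) _ hf) (hM.sing (hM.op (hM.nn n) haM)), ?_, ?_⟩
    · intro e he
      rcases ZFSet.mem_union.1 he with he | he
      · obtain ⟨i, hi, h3⟩ := h1 e he
        obtain ⟨k, hk, rfl⟩ := mem_nn.1 hi
        exact ⟨_, nn_lt (by omega), ZFSet.mem_union.2 (Or.inl (ZFSet.mem_sep.2 ⟨h3, _, hi, e, he, rfl⟩))⟩
      · rw [ZFSet.mem_singleton] at he
        subst he
        exact ⟨_, nn_lt (Nat.lt_succ_self n), ZFSet.mem_union.2 (Or.inr (ZFSet.mem_singleton.2 rfl))⟩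
    · have key : ∀ i e, ZFSet.pair i e ∈ ZFSet.sep (fun z => ∃ i, i ∈ CtmForcing.nn n ∧ ∃ e, e ∈ p ∧ z = ZFSet.pair i e) f ∪ {ZFSet.pair (CtmForcing.nn n) a} →
          (i ∈ CtmForcing.nn n ∧ e ∈ p ∧ ZFSet.pair i e ∈ f) ∨ (i = CtmForcing.nn n ∧ e = a) := by
        intro i e hie
        rcases ZFSet.mem_union.1 hie with h | h
        · obtain ⟨h3, i', hi', e', he', h4⟩ := ZFSet.mem_sep.1 h
          obtain ⟨rfl, rfl⟩ := ZFSet.pair_inj.1 h4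
          exact Or.inl ⟨hi', he', h3⟩
        · exact Or.inr (ZFSet.pair_inj.1 (ZFSet.mem_singleton.1 h))
      intro i hi e he e' he' h3 h4
      rcases key _ _ h3 with ⟨k1, k2, k3⟩ | ⟨k1, k2⟩ <;> rcases key _ _ h4 with ⟨l1, l2, l3⟩ | ⟨l1, l2⟩
      · exact h2 i k1 e k2 e' l2 k3 l3
      · rw [l1] at k1; exact (ZFSet.mem_irrefl _ k1).elim
      · rw [k1] at l1; exact (ZFSet.mem_irrefl _ l1).elim
      · rw [k2, l2]

variable (hκ : κ ∈ M)
include hκ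

lemma Po_mem : Po M κ ∈ M := by
  have := one_M hM
  have := @dfFn M hM
  refine hM.sep _ ?_ _ (hM.pow _ (hM.prod (hM.prod hκ hM.om) (hM.pair _ hM.emp _ (one_M hM))))
  exact dfa2

lemma Po_iff {p : ZFSet} : p ∈ Po M κ ↔ p.toSet.Finite ∧ (∀ e ∈ p, ∃ i ∈ κ, ∃ n, e = ZFSet.pair (ZFSet.pair i (nn n)) ∅ ∨ e = ZFSet.pair (ZFSet.pair i (nn n)) one) ∧
    ∀ e ∈ p, ∀ e' ∈ p, ¬ Cf e e' := by
  have hE : ∀ e, e ∈ ZFSet.prod (ZFSet.prod κ ZFSet.omega) {∅, one} ↔ ∃ i ∈ κ, ∃ n, e = ZFSet.pair (ZFSet.pair i (nn n)) ∅ ∨ e = ZFSet.pair (ZFSet.pair i (nn n)) one := by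
    intro e
    rw [ZFSet.mem_prod]
    constructor
    · rintro ⟨z, hz, b, hb, rfl⟩
      obtain ⟨i, hi, m, hm, rfl⟩ := ZFSet.mem_prod.1 hz
      obtain ⟨n, rfl⟩ := mem_omega.1 hm
      rcases ZFSet.mem_pair.1 hb with rfl | rfl
      exacts [⟨i, hi, n, Or.inl rfl⟩, ⟨i, hi, n, Or.inr rfl⟩]
    · rintro ⟨i, hi, n, rfl | rfl⟩
      · exact ⟨_, ZFSet.pair_mem_prod.2 ⟨hi, mem_omega.2 ⟨n, rfl⟩⟩, _, ZFSet.mem_pair.2 (Or.inl rfl), rfl⟩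
      · exact ⟨_, ZFSet.pair_mem_prod.2 ⟨hi, mem_omega.2 ⟨n, rfl⟩⟩, _, ZFSet.mem_pair.2 (Or.inr rfl), rfl⟩
  rw [Po, ZFSet.mem_sep, mem_Pw]
  constructor
  · rintro ⟨⟨h1, h2⟩, h3, n, hn, h4⟩
    obtain ⟨n, rfl⟩ := mem_omega.1 hn
    refine ⟨Set.finite_of_encard_le_coe h4.card, fun e he => (hE e).1 (h1 he), ?_⟩
    have k : ∀ x, ¬ (ZFSet.pair x ∅ ∈ p ∧ ZFSet.pair x one ∈ p) := fun x hx => h3 x (ZFSet.pair_mem_prod.1 (h1 hx.1)).1 hx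
    rintro e he e' he' ⟨x, ⟨rfl, rfl⟩ | ⟨rfl, rfl⟩⟩
    exacts [k x ⟨he, he'⟩, k x ⟨he', he⟩]
  · rintro ⟨h1, h2, h3⟩
    have hEM : ZFSet.prod (ZFSet.prod κ ZFSet.omega) {∅, one} ∈ M := hM.prod (hM.prod hκ hM.om) (hM.pair _ hM.emp _ (one_M hM))
    obtain ⟨p', hp', e, n, hn⟩ := fin_Fn hM p.toSet h1 (fun x hx => hM.tr _ hEM ((hE x).2 (h2 x hx)))
    have : p' = p := by
      ext x
      exact Set.ext_iff.1 e x
    subst this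
    exact ⟨⟨fun x hx => (hE x).2 (h2 x hx), hp'⟩, fun x _ hx => h3 _ hx.1 _ hx.2 ⟨x, Or.inl ⟨rfl, rfl⟩⟩, _, mem_omega.2 ⟨n, rfl⟩, hn⟩

lemma Po_union {p q : ZFSet} (hp : p ∈ Po M κ) (hq : q ∈ Po M κ) (h : ∀ a ∈ p, ∀ b ∈ q, ¬ Cf a b) : p ∪ q ∈ Po M κ := by
  rw [Po_iff hM hκ] at *
  refine ⟨?_, ?_, ?_⟩
  · convert hp.1.union hq.1
    ext x; simp [mem_ts]
  · intro e he
    rcases ZFSet.mem_union.1 he with h1 | h1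
    exacts [hp.2.1 e h1, hq.2.1 e h1]
  · intro e he e' he'
    rcases ZFSet.mem_union.1 he with h1 | h1 <;> rcases ZFSet.mem_union.1 he' with h2 | h2
    exacts [hp.2.2 e h1 e' h2, h e h1 e' h2, fun hc => h e' h2 e h1 hc.symm, hq.2.2 e h1 e' h2]

lemma Po_emp : ∅ ∈ Po M κ := by
  rw [Po_iff hM hκ]
  refine ⟨by convert Set.finite_empty; ext; simp [mem_ts], fun e he => (ZFSet.notMem_empty _ he).elim, fun e he => (ZFSet.notMem_empty _ he).elim⟩

end

/-! ### Part 11: no new surjections onto large sets -/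

lemma Mf.mono {P σ τ p q : ZFSet} (h : Mf P σ τ p) (hq : q ∈ P) (hpq : p ⊆ q) : Mf P σ τ q :=
  ⟨hq, fun r hr hqr => h.2 r hr (hpq.trans hqr)⟩

lemma cover {M κ : ZFSet} (hM : ZFM M) (hκ : κ ∈ M) {G : Set ZFSet} (hG : Gen M (Po M κ) G) {A B S : ZFSet} (hA : A ∈ M)
    (hB : B = Pw M (ZFSet.prod A (ZFSet.prod ZFSet.omega ZFSet.omega))) (hS : S ∈ img (val G) M)
    (hf : ∀ a ∈ A, ∀ i ∈ B, ∀ j ∈ B, ZFSet.pair a i ∈ S → ZFSet.pair a j ∈ S → i = j)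
    (hs : ∀ i ∈ B, ∃ a ∈ A, ZFSet.pair a i ∈ S) : False := by
  have hP := Po_mem hM hκ
  have hX := hM.prod hA (hM.prod hM.om hM.om)
  have hBM : B ∈ M := hB ▸ hM.pow _ hX
  obtain ⟨s, hsM, rfl⟩ := mem_img.1 hS
  have om := hM.om
  let W : ZFSet → ZFSet → ZFSet → Prop := fun a i p => Mf (Po M κ) (opn (ck a) (ck i)) s p
  have dW : ∀ {F G H : (ℕ → ZFSet) → ZFSet}, Dfn M F → Dfn M G → Dfn M H → Dfb M (fun v => W (F v) (G v) (H v)) := by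
    intro F G H h1 h2 h3
    exact Dfb.app3 (R := fun x y z => Mf (Po M κ) x y z) (dfMf hM hP 0 1 2)
      (dfOpn hM (dfCk hM hP h1) (dfCk hM hP h2)) (.const hsM) h3
  have Wm : ∀ a i p q, W a i p → q ∈ Po M κ → p ⊆ q → W a i q := fun a i p q h => Mf.mono h
  have WP : ∀ a i p, W a i p → p ∈ Po M κ := fun a i p h => h.1
  have Wt : ∀ a ∈ A, ∀ i ∈ B, (ZFSet.pair a i ∈ val G s ↔ ∃ p ∈ G, W a i p) := by
    intro a ha i hi
    have := mf_truth hM hP hG (σ := opn (ck a) (ck i)) (τ := s) ((dfOpn hM (dfCk hM hP (.const (hM.tr _ hA ha))) (dfCk hM hP (.const (hM.tr _ hBM hi)))).1 (fun _ => s) (fun _ => hsM)) hsM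
    rwa [val_opn hM hP hG, val_ck hM hP hG, val_ck hM hP hG] at this
  have dFn := @dfFn M hM
  clear_value W
  generalize hPP : Po M κ = P at *
  let K : ZFSet → Prop := fun p => ∃ a, a ∈ A ∧ ∃ i, i ∈ B ∧ ∃ j, j ∈ B ∧ ¬ i = j ∧ W a i p ∧ W a j p
  obtain ⟨p0, hp0, hK⟩ : ∃ p0 ∈ G, ∀ q, q ∈ P → p0 ⊆ q → ¬ K q := by
    obtain ⟨r, hr, h⟩ := hG.dense hM hP (fun p => K p ∨ ∀ q, q ∈ P → p ⊆ q → ¬ K q) (by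
      clear hG hB
      exact dfa2) (by
      intro q hq
      by_cases h : ∃ r, r ∈ P ∧ q ⊆ r ∧ K r
      · obtain ⟨r, hr, h1, h2⟩ := h
        exact ⟨r, hr, h1, Or.inl h2⟩
      · push Not at h
        exact ⟨q, hq, fun _ h => h, Or.inr h⟩)
    rcases h with ⟨a, ha, i, hi, j, hj, hne, h1, h2⟩ | h
    · exact (hne (hf a ha i hi j hj ((Wt a ha i hi).2 ⟨r, hr, h1⟩) ((Wt a ha j hj).2 ⟨r, hr, h2⟩))).elim
    · exact ⟨r, hr, h⟩
  have hp0M := hM.tr _ hP (hG.sub _ hp0)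
  let Fo : ZFSet → ZFSet → ZFSet → Prop := fun a n i => ∃ p, p ∈ P ∧ Fn M n p ∧ p0 ⊆ p ∧ W a i p
  have hfin : ∀ a ∈ A, ∀ n, {i | i ∈ B ∧ Fo a (nn n) i}.Finite := by
    intro a ha n
    have : ∀ i, ∃ p, (i ∈ B ∧ Fo a (nn n) i) → p ∈ P ∧ Fn M (nn n) p ∧ p0 ⊆ p ∧ W a i p := by
      intro i
      by_cases h : i ∈ B ∧ Fo a (nn n) i
      · obtain ⟨p, hp⟩ := h.2
        exact ⟨p, fun _ => hp⟩
      · exact ⟨∅, fun h' => absurd h' h⟩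
    choose c hc using this
    refine anti n _ (fun i => (c i).toSet) (fun i hi => (hc i hi).2.1.card) ?_ ?_
    · intro i hi
      have := (hc i hi).1
      rw [← hPP, Po_iff hM hκ] at this
      exact this.2.2
    · intro i hi j hj hne
      by_contra hno
      push Not at hno
      obtain ⟨h1, -, h2, h3⟩ := hc i hi
      obtain ⟨k1, -, k2, k3⟩ := hc j hj
      have hU : c i ∪ c j ∈ P := by
        rw [← hPP] at h1 k1 ⊢
        exact Po_union hM hκ h1 k1 hno
      have s1 : c i ⊆ c i ∪ c j := fun x hx => ZFSet.mem_union.2 (Or.inl hx)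
      have s2 : c j ⊆ c i ∪ c j := fun x hx => ZFSet.mem_union.2 (Or.inr hx)
      exact hK _ hU (h2.trans s1) ⟨a, ha, i, hi.1, j, hj.1, hne, Wm _ _ _ _ h3 hU s1, Wm _ _ _ _ k3 hU s2⟩
  have hcov : ∀ i ∈ B, ∃ a ∈ A, ∃ n, Fo a (nn n) i := by
    intro i hi
    obtain ⟨a, ha, h⟩ := hs i hi
    obtain ⟨p, hp, hw⟩ := (Wt a ha i hi).1 h
    obtain ⟨r, hr, h1, h2⟩ := hG.dir p hp p0 hp0
    have hrP := hG.sub r hr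
    have := hrP
    rw [← hPP, Po, ZFSet.mem_sep] at this
    obtain ⟨-, -, n, hn, h3⟩ := this
    obtain ⟨n, rfl⟩ := mem_omega.1 hn
    exact ⟨a, ha, n, r, hrP, h3, h2, Wm _ _ _ _ hw hrP h1⟩
  let Rw : ZFSet → ZFSet → ZFSet → ZFSet → Prop := fun a n i m => ∀ k, k ∈ ZFSet.omega → (ZFSet.pair a (ZFSet.pair n k) ∈ i ↔ k ∈ m)
  let DD : ZFSet → ZFSet → ZFSet → Prop := fun a n k => ∀ m, m ∈ ZFSet.omega → m ⊆ k → ∃ i, i ∈ B ∧ Fo a n i ∧ Rw a n i m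
  let D := ZFSet.sep (fun z => ∃ a, a ∈ A ∧ ∃ n, n ∈ ZFSet.omega ∧ ∃ k, k ∈ ZFSet.omega ∧ z = ZFSet.pair a (ZFSet.pair n k) ∧ DD a n k)
    (ZFSet.prod A (ZFSet.prod ZFSet.omega ZFSet.omega))
  have hDM : D ∈ M := hM.sep _ (by
    dsimp only [DD, Rw, Fo]
    clear hG hB
    exact dfa2) _ hX
  have hDB : D ∈ B := by
    rw [hB, mem_Pw]
    exact ⟨fun z hz => (ZFSet.mem_sep.1 hz).1, hDM⟩
  have hDm : ∀ a ∈ A, ∀ n k, ZFSet.pair a (ZFSet.pair (nn n) (nn k)) ∈ D ↔ DD a (nn n) (nn k) := by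
    intro a ha n k
    have w1 : nn n ∈ ZFSet.omega := mem_omega.2 ⟨n, rfl⟩
    have w2 : nn k ∈ ZFSet.omega := mem_omega.2 ⟨k, rfl⟩
    constructor
    · intro h
      obtain ⟨-, a', ha', n', hn', k', hk', e, h⟩ := ZFSet.mem_sep.1 h
      obtain ⟨rfl, e'⟩ := ZFSet.pair_inj.1 e
      obtain ⟨rfl, rfl⟩ := ZFSet.pair_inj.1 e'
      exact h
    · intro h
      exact ZFSet.mem_sep.2 ⟨ZFSet.pair_mem_prod.2 ⟨ha, ZFSet.pair_mem_prod.2 ⟨w1, w2⟩⟩, a, ha, _, w1, _, w2, rfl, h⟩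
  obtain ⟨a, ha, n, hD⟩ := hcov D hDB
  let R : Set ℕ := {m | ∃ i, i ∈ B ∧ Fo a (nn n) i ∧ Rw a (nn n) i (nn m)}
  have hR : R.Finite := by
    have : ∀ m : ℕ, ∃ i, m ∈ R → (i ∈ B ∧ Fo a (nn n) i) ∧ Rw a (nn n) i (nn m) := by
      intro m
      by_cases h : m ∈ R
      · obtain ⟨i, h1, h2, h3⟩ := h
        exact ⟨i, fun _ => ⟨⟨h1, h2⟩, h3⟩⟩
      · exact ⟨∅, fun h' => absurd h' h⟩
    choose g hg using this
    refine Set.Finite.of_injOn (f := g) (fun m hm => (hg m hm).1) ?_ (hfin a ha n)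
    intro m hm m' hm' e
    have h1 := (hg m hm).2
    have h2 := (hg m' hm').2
    rw [← e] at h2
    have h3 : ∀ k, nn k ∈ nn m ↔ nn k ∈ nn m' := fun k =>
      (h1 _ (mem_omega.2 ⟨k, rfl⟩)).symm.trans (h2 _ (mem_omega.2 ⟨k, rfl⟩))
    simp only [nn_mem] at h3
    have := h3 m
    have := h3 m'
    omega
  have hex : ∃ k, k ∉ R := hR.exists_notMem
  classical
  have hmin : ∀ j < Nat.find hex, j ∈ R := fun j hj => not_not.1 (Nat.find_min hex hj)
  refine Nat.find_spec hex ⟨D, hDB, hD, fun k hk => ?_⟩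
  obtain ⟨k, rfl⟩ := mem_omega.1 hk
  rw [hDm a ha, nn_mem]
  constructor
  · intro h
    by_contra hc
    exact Nat.find_spec hex (h _ (mem_omega.2 ⟨_, rfl⟩) (nn_sub.2 (not_lt.1 hc)))
  · intro h m hm hmk
    obtain ⟨m, rfl⟩ := mem_omega.1 hm
    exact hmin m (lt_of_le_of_lt (nn_sub.1 hmk) h)


/-! ### Part 12: the failure of CH -/

lemma Cf.key {x y b c : ZFSet} (h : Cf (ZFSet.pair x b) (ZFSet.pair y c)) : x = y ∧ b ≠ c := by
  obtain ⟨z, ⟨h1, h2⟩ | ⟨h1, h2⟩⟩ := h <;> obtain ⟨rfl, rfl⟩ := ZFSet.pair_inj.1 h1 <;> obtain ⟨rfl, rfl⟩ := ZFSet.pair_inj.1 h2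
  exacts [⟨rfl, one_ne⟩, ⟨rfl, one_ne.symm⟩]

lemma split {M κ : ZFSet} (hM : ZFM M) (hκ : κ ∈ M) {i j q : ZFSet} (hi : i ∈ κ) (hj : j ∈ κ) (hne : i ≠ j) (hq : q ∈ Po M κ) :
    ∃ r, r ∈ Po M κ ∧ q ⊆ r ∧ ∃ n, n ∈ ZFSet.omega ∧ ZFSet.pair (ZFSet.pair i n) one ∈ r ∧ ZFSet.pair (ZFSet.pair j n) ∅ ∈ r := by
  obtain ⟨hq1, hq2, hq3⟩ := (Po_iff hM hκ).1 hq
  let S : Set ℕ := {n | ∃ x b, ZFSet.pair (ZFSet.pair x (nn n)) b ∈ q}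
  have hS : S.Finite := by
    have : ∀ n : ℕ, ∃ e, n ∈ S → e ∈ q ∧ ∃ x b, e = ZFSet.pair (ZFSet.pair x (nn n)) b := by
      intro n
      by_cases h : n ∈ S
      · obtain ⟨x, b, h⟩ := h
        exact ⟨_, fun _ => ⟨h, x, b, rfl⟩⟩
      · exact ⟨∅, fun h' => absurd h' h⟩
    choose g hg using this
    refine Set.Finite.of_injOn (f := g) (fun m hm => (hg m hm).1) ?_ hq1
    intro m hm m' hm' e
    obtain ⟨x, b, h1⟩ := (hg m hm).2
    obtain ⟨x', b', h2⟩ := (hg m' hm').2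
    exact nn_inj (ZFSet.pair_inj.1 (ZFSet.pair_inj.1 (h1.symm.trans (e.trans h2))).1).2
  obtain ⟨n, hn⟩ := hS.exists_notMem
  have hp : ({ZFSet.pair (ZFSet.pair i (nn n)) one, ZFSet.pair (ZFSet.pair j (nn n)) ∅} : ZFSet) ∈ Po M κ := by
    rw [Po_iff hM hκ]
    refine ⟨?_, ?_, ?_⟩
    · refine (Set.toFinite {ZFSet.pair (ZFSet.pair i (nn n)) one, ZFSet.pair (ZFSet.pair j (nn n)) ∅}).subset fun x hx => ?_
      simpa [mem_ts] using hx
    · intro e he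
      rcases ZFSet.mem_pair.1 he with rfl | rfl
      exacts [⟨i, hi, n, Or.inr rfl⟩, ⟨j, hj, n, Or.inl rfl⟩]
    · intro e he e' he' hc
      rcases ZFSet.mem_pair.1 he with rfl | rfl <;> rcases ZFSet.mem_pair.1 he' with rfl | rfl <;> obtain ⟨h1, h2⟩ := hc.key
      · exact h2 rfl
      · exact hne (ZFSet.pair_inj.1 h1).1
      · exact hne (ZFSet.pair_inj.1 h1).1.symm
      · exact h2 rfl
  refine ⟨_, Po_union hM hκ hq hp ?_, fun x hx => ZFSet.mem_union.2 (Or.inl hx), nn n, mem_omega.2 ⟨n, rfl⟩,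
    ZFSet.mem_union.2 (Or.inr (ZFSet.mem_pair.2 (Or.inl rfl))), ZFSet.mem_union.2 (Or.inr (ZFSet.mem_pair.2 (Or.inr rfl)))⟩
  intro a ha b hb hc
  obtain ⟨x, hx, m, h | h⟩ := hq2 a ha <;> subst h <;> rcases ZFSet.mem_pair.1 hb with rfl | rfl <;>
    obtain ⟨-, h3⟩ := ZFSet.pair_inj.1 hc.key.1 <;> rw [h3] at ha <;> exact hn ⟨_, _, ha⟩

lemma notCH {M θ B f0 κ : ZFSet} (hM : ZFM M) (hθ : θ ∈ M) (oθ : IsOrd θ) (hB : B = Pw M (ZFSet.prod ZFSet.omega (ZFSet.prod ZFSet.omega ZFSet.omega)))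
    (hf0 : f0 ∈ M) (hs : Fsurj θ B f0) (hκ : κ = Pw M (ZFSet.prod θ (ZFSet.prod ZFSet.omega ZFSet.omega)))
    {G : Set ZFSet} (hG : Gen M (Po M κ) G)
    (hc : letI := zfStruct (img (val G) M); Sentence.Realize (M := Vs (img (val G) M)) chSent) : False := by
  have hκM : κ ∈ M := hκ ▸ hM.pow _ (hM.prod hθ (hM.prod hM.om hM.om))
  have hBM : B ∈ M := hB ▸ hM.pow _ (hM.prod hM.om (hM.prod hM.om hM.om))
  have hP := Po_mem hM hκM
  have hN := N_ZFM hM hP hG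
  have hcov := fun {A B S : ZFSet} => @cover M κ hM hκM G hG A B S
  obtain ⟨g, hgN, hg⟩ := G_mem hM hP hG
  have sN := @sub_N M _ hM hP G hG
  obtain ⟨α, hα, b, hb, oα, hcount, hbs, hinj⟩ := of_chSent hN hc
  have hθN := sN hθ
  have hBN := sN hBM
  have hκN := sN hκM
  have hf0N := sN hf0
  have h1N := sN (one_M hM)
  have hOMN := hN.om
  clear sN
  rcases oθ.ord.mem_or_subset oα.ord with h | hsub
  · rcases hcount θ h with h0 | ⟨f, hf, hfs⟩
    · have hE : (∅ : ZFSet) ∈ B := by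
        rw [hB, mem_Pw]; exact ⟨ZFSet.empty_subset _, hM.emp⟩
      obtain ⟨x, hx, -⟩ := hs.2.2.2 ∅ hE
      rw [h0] at hx
      exact ZFSet.notMem_empty _ hx
    · let Q : ZFSet → ZFSet → Prop := fun n i => ∃ t, t ∈ θ ∧ ZFSet.pair n t ∈ f ∧ ZFSet.pair t i ∈ f0
      have hT : ZFSet.sep (fun z => ∃ n, n ∈ ZFSet.omega ∧ ∃ i, i ∈ B ∧ z = ZFSet.pair n i ∧ Q n i) (ZFSet.prod ZFSet.omega B) ∈ img (val G) M :=
        hN.sep _ (by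
          dsimp only [Q]
          generalize img (val G) M = N at *
          clear hM hP hG hcov hκM hBM hf0 hc hcount
          exact dfa2) _ (hN.prod hOMN hBN)
      refine hcov hM.om hB hT ?_ ?_
      · intro n hn i hi j hj h1 h2
        obtain ⟨-, n1, _, i1, _, e1, t1, _, k1, l1⟩ := ZFSet.mem_sep.1 h1
        obtain ⟨-, n2, _, i2, _, e2, t2, _, k2, l2⟩ := ZFSet.mem_sep.1 h2
        obtain ⟨rfl, rfl⟩ := ZFSet.pair_inj.1 e1
        obtain ⟨rfl, rfl⟩ := ZFSet.pair_inj.1 e2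
        rw [hfs.2.2.1 _ _ _ k1 k2] at l1
        exact hs.2.2.1 _ _ _ l1 l2
      · intro i hi
        obtain ⟨t, ht, h1⟩ := hs.2.2.2 i hi
        obtain ⟨n, hn, h2⟩ := hfs.2.2.2 t ht
        exact ⟨n, hn, ZFSet.mem_sep.2 ⟨ZFSet.pair_mem_prod.2 ⟨hn, hi⟩, n, hn, i, hi, rfl, t, ht, h2, h1⟩⟩
  · let Gi : ZFSet → ZFSet → Prop := fun i n => ∃ p, p ∈ g ∧ ZFSet.pair (ZFSet.pair i n) one ∈ p
    let Q : ZFSet → ZFSet → Prop := fun a i => ∃ u, u ∈ Pw (img (val G) M) ZFSet.omega ∧ ZFSet.pair u a ∈ b ∧ ∀ n, n ∈ ZFSet.omega → (n ∈ u ↔ Gi i n)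
    have hT : ZFSet.sep (fun z => ∃ a, a ∈ θ ∧ ∃ i, i ∈ κ ∧ z = ZFSet.pair a i ∧ Q a i) (ZFSet.prod θ κ) ∈ img (val G) M :=
      hN.sep _ (by
        dsimp only [Q, Gi]
        generalize img (val G) M = N at *
        clear hM hP hG hcov hκM hBM hf0 hc hcount
        exact dfa2) _ (hN.prod hθN hκN)
    refine hcov hθ hκ hT ?_ ?_
    · intro a ha i hi j hj h1 h2
      obtain ⟨-, a1, _, i1, _, e1, u1, w1, k1, l1⟩ := ZFSet.mem_sep.1 h1
      obtain ⟨-, a2, _, i2, _, e2, u2, w2, k2, l2⟩ := ZFSet.mem_sep.1 h2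
      obtain ⟨rfl, rfl⟩ := ZFSet.pair_inj.1 e1
      obtain ⟨rfl, rfl⟩ := ZFSet.pair_inj.1 e2
      have hu := hinj _ _ _ k1 k2
      subst hu
      by_contra hne
      have hiM := hM.tr _ hκM hi
      have hjM := hM.tr _ hκM hj
      have h1M := one_M hM
      have hoM := hM.om
      obtain ⟨r, hr, n, hn, h3, h4⟩ := hG.dense hM hP (fun r => ∃ n, n ∈ ZFSet.omega ∧ ZFSet.pair (ZFSet.pair i n) one ∈ r ∧ ZFSet.pair (ZFSet.pair j n) ∅ ∈ r)
        (by
          clear hN hG hcov hc hcount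
          exact dfa2) (fun q hq => split hM hκM hi hj hne hq)
      obtain ⟨p, hp, h5⟩ := (l2 n hn).1 ((l1 n hn).2 ⟨r, (hg r).2 hr, h3⟩)
      obtain ⟨r', hr', h6, h7⟩ := hG.dir r hr p ((hg p).1 hp)
      exact ((Po_iff hM hκM).1 (hG.sub _ hr')).2.2 _ (h6 h4) _ (h7 h5) ⟨_, Or.inl ⟨rfl, rfl⟩⟩
    · intro i hi
      have hiN := hN.tr _ hκN hi
      have hu : ZFSet.sep (Gi i) ZFSet.omega ∈ img (val G) M := hN.sep _ (by
        dsimp only [Gi]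
        generalize img (val G) M = N at *
        clear hM hP hG hcov hκM hBM hf0 hc hcount
        exact dfa2) _ hOMN
      have hu' : ZFSet.sep (Gi i) ZFSet.omega ∈ Pw (img (val G) M) ZFSet.omega := mem_Pw.2 ⟨fun x hx => (ZFSet.mem_sep.1 hx).1, hu⟩
      obtain ⟨a, ha, h1⟩ := hbs.2.1 _ hu'
      refine ⟨a, hsub ha, ZFSet.mem_sep.2 ⟨ZFSet.pair_mem_prod.2 ⟨hsub ha, hi⟩, a, hsub ha, i, hi, rfl, _, hu', h1, fun n hn => ?_⟩⟩
      rw [ZFSet.mem_sep]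
      exact ⟨fun h => h.2, fun h => ⟨hn, h⟩⟩

/-- a ctm of `ZFC` has a countable transitive extension with the same ordinals
that models `ZFC + ¬CH`. -/
theorem ctm_ZFC_imp_ctm_not_CH (M : ZFSet) (hcount : M.toSet.Countable)
    (htrans : M.IsTransitive) (hmodel : ZModels M ZFC) :
    ∃ N : ZFSet, M ⊆ N ∧ N.toSet.Countable ∧ N.IsTransitive ∧
      (∀ α : ZFSet, IsOrd α → (α ∈ M ↔ α ∈ N)) ∧
      ZModels N (ZFC ∪ {chSent.not}) := by
  have hM : ZFM M := ZFM_of_models htrans fun φ hφ => hmodel φ (Or.inl hφ)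
  have hAC : ACM M := (acAx_iff hM).1 (hmodel acAx (Or.inr rfl))
  obtain ⟨θ, hθ, oθ, f0, hf0, hs⟩ := hAC _ (hM.pow _ (hM.prod hM.om (hM.prod hM.om hM.om)))
  have hκ := hM.pow _ (hM.prod hθ (hM.prod hM.om hM.om))
  obtain ⟨G, hG, -⟩ := gen_exists hcount (Po_emp hM hκ)
  have hP := Po_mem hM hκ
  have hN := N_ZFM hM hP hG
  refine ⟨img (val G) M, fun x hx => sub_N hM hP hG hx, N_count hcount, hN.tr,
    fun α oα => ⟨fun h => sub_N hM hP hG h, fun h => N_ord hM hP hG oα h⟩, ?_⟩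
  rintro φ ((hφ | hφ) | hφ)
  · exact models_of_ZFM hN φ hφ
  · rw [Set.mem_singleton_iff.1 hφ]
    exact (acAx_iff hN).2 (N_AC hM hP hG hAC)
  · rw [Set.mem_singleton_iff.1 hφ]
    intro hc
    exact notCH hM hθ oθ rfl hf0 hs rfl hG hc


end CtmForcing
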